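/- Let X > 0 and ρ = e^{−1/X}, and define Φ(ρ) = Σ_{j≥1} (1/j) Σ_{p₁ prime} Σ_{p₂ prime} ρ^{p₁p₂j}. Then for every integer m ≥ 0, as X → ∞, (ρ d/dρ)^m Φ(ρ) = 2 · ζ(2) · Γ(m+1) · X^{m+1} · (M + log log X) / log X · (1 + O(1/log X)), where M is the Meissel–Mertens constant; moreover the same asymptotic formula holds for the ordinary m-th derivative Φ^{(m)}(ρ). -/

import Mathlib

open Filter Real Topology

noncomputable section

/-- The Meissel–Mertens constant `M = γ + Σ_p (log(1 - 1/p) + 1/p)`. -/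
def meisselMertens : ℝ := Real.eulerMascheroniConstant +
  ∑' p : Nat.Primes, (Real.log (1 - 1/(p : ℝ)) + 1/(p : ℝ))

/-- `ζ(2)` as a real number. -/
def zeta2 : ℝ := (riemannZeta 2).re

/-- `Φ(ρ) = Σ_{j ≥ 1} (1/j) Σ_{p₁, p₂ prime} ρ^{p₁p₂j}`. -/
def PhiP2 (ρ : ℝ) : ℝ :=
  ∑' (j : ℕ+) (p : Nat.Primes) (q : Nat.Primes),
    (1 / (j : ℝ)) * ρ ^ ((p : ℕ) * (q : ℕ) * (j : ℕ))

/-- The operator `ρ · d/dρ`. -/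
def Dop (f : ℝ → ℝ) : ℝ → ℝ := fun x => x * deriv f x

/-- The weights `a` have partial sums `∑_{N i ≤ x} a i ≤ K x`. -/
structure LinearlyBounded {ι : Type*} (N a : ι → ℝ) (K : ℝ) : Prop where
  pos : ∀ i, 0 < N i
  nonneg : ∀ i, 0 ≤ a i
  sum_le : ∀ (s : Finset ι) (x : ℝ), 0 ≤ x → (∀ i ∈ s, N i ≤ x) → ∑ i ∈ s, a i ≤ K * x

lemma LinearlyBounded.sum_mul_le {ι : Type*} {N a : ι → ℝ} {K : ℝ} (h : LinearlyBounded N a K)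
    {c t : ℕ → ℝ} (hc : ∀ k, 0 ≤ c k) (ht : ∀ k, 0 ≤ t k) (hsum : Summable fun k => c k * t k)
    {G : ι → ℝ} {Y : ℝ} (hY : 0 < Y)
    (hG : ∀ i, G i ≤ 0 ∨ ∃ k, N i ≤ t k * Y ∧ G i ≤ c k) (s : Finset ι) :
    ∑ i ∈ s, a i * G i ≤ K * Y * ∑' k, c k * t k := by
  classical
  have hs : ∀ i, Summable fun k => if N i ≤ t k * Y then c k else 0 := by
    intro i
    refine Summable.of_nonneg_of_le (fun k => ?_) (fun k => ?_) (hsum.mul_right (Y / N i))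
    · split_ifs <;> simp [hc]
    · have hN := h.pos i
      split_ifs with hk
      · have : 1 ≤ t k * Y / N i := by rwa [one_le_div hN]
        calc c k = c k * 1 := by ring
          _ ≤ c k * (t k * Y / N i) := by gcongr; exact hc k
          _ = _ := by ring
      · have := hc k; have := ht k; positivity
  calc ∑ i ∈ s, a i * G i
      ≤ ∑ i ∈ s, a i * ∑' k, (if N i ≤ t k * Y then c k else 0) := by
        refine Finset.sum_le_sum fun i _ => mul_le_mul_of_nonneg_left ?_ (h.nonneg i)
        rcases hG i with h0 | ⟨k, hk, hGk⟩
        · refine h0.trans (tsum_nonneg fun k => ?_)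
          split_ifs <;> simp [hc]
        · refine hGk.trans ?_
          have := (hs i).le_tsum k (fun j _ => by split_ifs <;> simp [hc])
          simpa [hk] using this
    _ = ∑' k, ∑ i ∈ s, a i * (if N i ≤ t k * Y then c k else 0) := by
        rw [Summable.tsum_finsetSum (fun i _ => (hs i).mul_left _)]
        simp_rw [tsum_mul_left]
    _ ≤ ∑' k, K * Y * (c k * t k) := by
        refine Summable.tsum_le_tsum (fun k => ?_)
          (summable_sum fun i _ => (hs i).mul_left _) (hsum.mul_left _)
        have := h.sum_le (s.filter fun i => N i ≤ t k * Y) (t k * Y)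
          (mul_nonneg (ht k) hY.le) (by simp)
        calc ∑ i ∈ s, a i * (if N i ≤ t k * Y then c k else 0)
            = (∑ i ∈ s.filter (fun i => N i ≤ t k * Y), a i) * c k := by
              rw [Finset.sum_filter, Finset.sum_mul]
              refine Finset.sum_congr rfl fun i _ => ?_
              split_ifs <;> simp
          _ ≤ K * (t k * Y) * c k := by gcongr; exact hc k
          _ = _ := by ring
    _ = _ := tsum_mul_left

/-- The majorant `min (u^{-1/2}) (u^{-2})`. -/
def decayBound (u : ℝ) : ℝ := min (1 / √u) (1 / u ^ 2)

lemma decayBound_nonneg (u : ℝ) : 0 ≤ decayBound u := by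
  unfold decayBound; positivity

lemma decayBound_le_sq (u : ℝ) : decayBound u ≤ 1 / u ^ 2 := min_le_right _ _

lemma decayBound_of_one_le {u : ℝ} (hu : 1 ≤ u) : decayBound u = 1 / u ^ 2 := by
  refine min_eq_right ?_
  have h1 : √u ≤ u := by rw [Real.sqrt_le_left (by linarith)]; nlinarith
  have h2 : 0 < √u := Real.sqrt_pos.2 (by linarith)
  apply one_div_le_one_div_of_le h2
  nlinarith

lemma decayBound_le_of_le_one (u : ℝ) : decayBound u ≤ 1 / √u := min_le_left _ _

lemma LinearlyBounded.sum_decayBound_le {ι : Type*} {N a : ι → ℝ} {K : ℝ}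
    (h : LinearlyBounded N a K) {Y : ℝ} (hY : 0 < Y) (s : Finset ι) :
    ∑ i ∈ s, a i * decayBound (N i / Y) ≤ 8 * K * Y := by
  have e1 : (fun k : ℕ => (2 : ℝ) * 2 ^ k * (1 / 4) ^ k) = fun k : ℕ => 2 * (1 / 2 : ℝ) ^ k := by
    ext k; rw [mul_assoc, ← mul_pow]; norm_num
  have e2 : (fun k : ℕ => (1 / 4 : ℝ) ^ k * 2 ^ (k + 1)) = fun k : ℕ => 2 * (1 / 2 : ℝ) ^ k := by
    ext k; rw [pow_succ, ← mul_assoc, ← mul_pow]; norm_num; ring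
  have hsum : Summable fun k : ℕ => 2 * (1 / 2 : ℝ) ^ k := summable_geometric_two.mul_left 2
  have hval : ∑' k : ℕ, 2 * (1 / 2 : ℝ) ^ k = 4 := by
    rw [tsum_mul_left, tsum_geometric_two]; norm_num
  have h1 := h.sum_mul_le (c := fun k => 2 * 2 ^ k) (t := fun k => (1 / 4) ^ k)
    (fun k => by positivity) (fun k => by positivity) (by rw [e1]; exact hsum)
    (G := fun i => if N i / Y ≤ 1 then decayBound (N i / Y) else 0) hY (fun i => by
      split_ifs with hi
      · right
        have hu : 0 < N i / Y := div_pos (h.pos i) hY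
        obtain ⟨k, hk1, hk2⟩ := exists_nat_pow_near_of_lt_one hu hi (y := 1 / 4)
          (by norm_num) (by norm_num)
        refine ⟨k, by rwa [← div_le_iff₀ hY], (decayBound_le_of_le_one _).trans ?_⟩
        have : (1 / 2 : ℝ) ^ (k + 1) ≤ √(N i / Y) := by
          apply Real.le_sqrt_of_sq_le
          rw [← pow_mul, mul_comm, pow_mul]
          norm_num at hk1 ⊢
          exact hk1.le
        calc 1 / √(N i / Y) ≤ 1 / (1 / 2 : ℝ) ^ (k + 1) :=
              one_div_le_one_div_of_le (by positivity) this
          _ = 2 * 2 ^ k := by simp [pow_succ, mul_comm]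
      · left; rfl) s
  have h2 := h.sum_mul_le (c := fun k => (1 / 4) ^ k) (t := fun k => 2 ^ (k + 1))
    (fun k => by positivity) (fun k => by positivity) (by rw [e2]; exact hsum)
    (G := fun i => if N i / Y ≤ 1 then 0 else decayBound (N i / Y)) hY (fun i => by
      split_ifs with hi
      · left; rfl
      · right
        push Not at hi
        obtain ⟨k, hk1, hk2⟩ := exists_nat_pow_near hi.le (y := 2) (by norm_num)
        refine ⟨k, by rw [← div_le_iff₀ hY]; exact hk2.le, (decayBound_le_sq _).trans ?_⟩
        calc 1 / (N i / Y) ^ 2 ≤ 1 / ((2 : ℝ) ^ k) ^ 2 := by gcongr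
          _ = (1 / 4) ^ k := by rw [← pow_mul, mul_comm, pow_mul]; norm_num; rw [one_div, inv_pow]) s
  rw [e1, hval] at h1
  rw [e2, hval] at h2
  calc ∑ i ∈ s, a i * decayBound (N i / Y)
      = ∑ i ∈ s, a i * (if N i / Y ≤ 1 then decayBound (N i / Y) else 0)
        + ∑ i ∈ s, a i * (if N i / Y ≤ 1 then 0 else decayBound (N i / Y)) := by
        rw [← Finset.sum_add_distrib]
        refine Finset.sum_congr rfl fun i _ => ?_
        split_ifs <;> simp
    _ ≤ _ := by linarith

lemma LinearlyBounded.summable_decayBound {ι : Type*} {N a : ι → ℝ} {K : ℝ}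
    (h : LinearlyBounded N a K) {Y : ℝ} (hY : 0 < Y) :
    Summable fun i => a i * decayBound (N i / Y) :=
  summable_of_sum_le (fun i => mul_nonneg (h.nonneg i) (decayBound_nonneg _))
    (h.sum_decayBound_le hY)

lemma LinearlyBounded.tsum_decayBound_le {ι : Type*} {N a : ι → ℝ} {K : ℝ}
    (h : LinearlyBounded N a K) {Y : ℝ} (hY : 0 < Y) :
    ∑' i, a i * decayBound (N i / Y) ≤ 8 * K * Y :=
  (h.summable_decayBound hY).tsum_le_of_sum_le (h.sum_decayBound_le hY)

lemma linearlyBounded_log_primes :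
    LinearlyBounded (fun p : Nat.Primes => (p : ℝ)) (fun p => Real.log p) (Real.log 4) where
  pos p := by exact_mod_cast p.2.pos
  nonneg p := Real.log_natCast_nonneg _
  sum_le s x hx hs := by
    refine le_trans ?_ (Chebyshev.theta_le_log4_mul_x hx)
    rw [Chebyshev.theta]
    have := Finset.sum_map s ⟨fun p : Nat.Primes => (p : ℕ), Nat.Primes.coe_nat_injective⟩
      (fun n : ℕ => Real.log n)
    refine this.symm.trans_le ?_
    refine Finset.sum_le_sum_of_subset_of_nonneg ?_ (fun n _ _ => Real.log_natCast_nonneg _)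
    intro n hn
    simp only [Finset.mem_map] at hn
    obtain ⟨p, hp, rfl⟩ := hn
    simp only [Finset.mem_filter, Finset.mem_Ioc]
    exact ⟨⟨p.2.pos, Nat.le_floor (hs p hp)⟩, p.2⟩

lemma linearlyBounded_pnat :
    LinearlyBounded (fun n : ℕ+ => (n : ℝ)) (fun _ => 1) 1 where
  pos n := by exact_mod_cast n.pos
  nonneg _ := zero_le_one
  sum_le s x hx hs := by
    simp only [Finset.sum_const, nsmul_eq_mul, mul_one, one_mul]
    have : s.card ≤ ⌊x⌋₊ := by
      rw [← Finset.card_map ⟨fun n : ℕ+ => (n : ℕ), PNat.coe_injective⟩,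
      show ⌊x⌋₊ = (Finset.Icc 1 ⌊x⌋₊).card by simp]
      refine Finset.card_le_card ?_
      intro n hn
      simp only [Finset.mem_map, Function.Embedding.coeFn_mk] at hn
      obtain ⟨p, hp, rfl⟩ := hn
      simp only [Finset.mem_Icc]
      exact ⟨p.pos, Nat.le_floor (hs p hp)⟩
    exact (Nat.cast_le.2 this).trans (Nat.floor_le hx)

/-- Polynomial growth in vertical strips. -/
def StripBound (a b : ℝ) (f : ℂ → ℂ) : Prop :=
  ∃ (C : ℝ) (k : ℕ), ∀ s : ℂ, a ≤ s.re → s.re ≤ b → ‖f s‖ ≤ C * (1 + |s.im|) ^ k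

lemma StripBound.exists_one_le {a b : ℝ} {f : ℂ → ℂ} (h : StripBound a b f) :
    ∃ (C : ℝ) (k : ℕ), 1 ≤ C ∧
      ∀ s : ℂ, a ≤ s.re → s.re ≤ b → ‖f s‖ ≤ C * (1 + |s.im|) ^ k := by
  obtain ⟨C, k, h⟩ := h
  refine ⟨max C 1, k, le_max_right _ _, fun s h1 h2 => (h s h1 h2).trans ?_⟩
  gcongr
  exact le_max_left _ _

lemma StripBound.mul {a b : ℝ} {f g : ℂ → ℂ} (hf : StripBound a b f) (hg : StripBound a b g) :
    StripBound a b fun s => f s * g s := by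
  obtain ⟨C, k, hC, hf⟩ := hf.exists_one_le
  obtain ⟨D, l, hD, hg⟩ := hg.exists_one_le
  refine ⟨C * D, k + l, fun s h1 h2 => ?_⟩
  rw [norm_mul, pow_add]
  calc _ ≤ (C * (1 + |s.im|) ^ k) * (D * (1 + |s.im|) ^ l) := by
        gcongr
        · exact hf s h1 h2
        · exact hg s h1 h2
    _ = _ := by ring

lemma StripBound.add {a b : ℝ} {f g : ℂ → ℂ} (hf : StripBound a b f) (hg : StripBound a b g) :
    StripBound a b fun s => f s + g s := by
  obtain ⟨C, k, hC, hf⟩ := hf.exists_one_le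
  obtain ⟨D, l, hD, hg⟩ := hg.exists_one_le
  refine ⟨C + D, k + l, fun s h1 h2 => (norm_add_le _ _).trans ?_⟩
  have h0 : 1 ≤ 1 + |s.im| := by linarith [abs_nonneg s.im]
  calc _ ≤ C * (1 + |s.im|) ^ k + D * (1 + |s.im|) ^ l := add_le_add (hf s h1 h2) (hg s h1 h2)
    _ ≤ C * (1 + |s.im|) ^ (k + l) + D * (1 + |s.im|) ^ (k + l) := by
        gcongr <;> first | exact h0 | omega
    _ = _ := by ring

lemma StripBound.neg {a b : ℝ} {f : ℂ → ℂ} (hf : StripBound a b f) :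
    StripBound a b fun s => - f s := by
  simpa [StripBound] using hf

lemma StripBound.mono {a b a' b' : ℝ} {f : ℂ → ℂ} (hf : StripBound a b f) (ha : a ≤ a')
    (hb : b' ≤ b) : StripBound a' b' f := by
  obtain ⟨C, k, hf⟩ := hf
  exact ⟨C, k, fun s h1 h2 => hf s (ha.trans h1) (h2.trans hb)⟩

lemma StripBound.deriv {a b : ℝ} {f : ℂ → ℂ} (hf : StripBound a b f) (hd : Differentiable ℂ f)
    {r : ℝ} (hr : 0 < r) : StripBound (a + r) (b - r) (deriv f) := by
  obtain ⟨C, k, hC, hf⟩ := hf.exists_one_le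
  refine ⟨C * (1 + r) ^ k / r, k, fun s h1 h2 => ?_⟩
  have := Complex.norm_deriv_le_of_forall_mem_sphere_norm_le (c := s) hr hd.diffContOnCl
    (C := C * ((1 + r) ^ k * (1 + |s.im|) ^ k)) (fun z hz => ?_)
  · refine this.trans (le_of_eq (by ring))
  · have hz' : ‖z - s‖ = r := by simpa [dist_eq_norm] using hz
    have hre := (Complex.abs_re_le_norm (z - s))
    have him := (Complex.abs_im_le_norm (z - s))
    rw [hz', Complex.sub_re] at hre
    rw [hz', Complex.sub_im] at him
    rw [abs_le] at hre
    refine (hf z (by linarith) (by linarith)).trans ?_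
    rw [← mul_pow]
    gcongr
    have : |z.im| ≤ |s.im| + r := by
      have := abs_add_le s.im (z.im - s.im)
      rw [add_sub_cancel] at this
      linarith
    nlinarith [abs_nonneg s.im]

/-- The `n`-th term of the Euler summation series of `(s - 1) ζ(s) - 1`. -/
def zetaTerm (n : ℕ) (s : ℂ) : ℂ :=
  (s - 1) * ((n : ℝ) + 1 : ℝ) ^ (-s) +
    ((((n : ℝ) + 2 : ℝ) : ℂ) ^ (1 - s) - (((n : ℝ) + 1 : ℝ) : ℂ) ^ (1 - s))

lemma differentiable_zetaTerm (n : ℕ) : Differentiable ℂ (zetaTerm n) := by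
  have h1 : (((n : ℝ) + 1 : ℝ) : ℂ) ≠ 0 := by
    rw [Complex.ofReal_ne_zero]; positivity
  have h2 : (((n : ℝ) + 2 : ℝ) : ℂ) ≠ 0 := by
    rw [Complex.ofReal_ne_zero]; positivity
  intro s
  unfold zetaTerm
  refine DifferentiableAt.add ?_ (DifferentiableAt.sub ?_ ?_)
  · exact (differentiableAt_id.sub_const 1).mul
      (differentiableAt_id.neg.const_cpow (Or.inl h1))
  · exact (differentiableAt_id.const_sub 1).const_cpow (Or.inl h2)
  · exact (differentiableAt_id.const_sub 1).const_cpow (Or.inl h1)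

lemma norm_zetaTerm_le (n : ℕ) {s : ℂ} (hs : 1 / 2 ≤ s.re) :
    ‖zetaTerm n s‖ ≤ ‖s - 1‖ * ‖s‖ * ((n : ℝ) + 1) ^ (-(3 / 2) : ℝ) := by
  set N : ℝ := (n : ℝ) + 1 with hN
  have hN1 : 1 ≤ N := by rw [hN]; linarith [(Nat.cast_nonneg n : (0 : ℝ) ≤ n)]
  have hN0 : 0 < N := by linarith
  have hN2 : (n : ℝ) + 2 = N + 1 := by rw [hN]; ring
  have hder : ∀ (c : ℂ) (x : ℝ), 0 < x →
      HasDerivAt (fun y : ℝ => (y : ℂ) ^ c) (c * (x : ℂ) ^ (c - 1)) x := by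
    intro c x hx
    have := (hasDerivAt_id (x : ℂ)).cpow_const (c := c) (Or.inl (by simpa using hx))
    simpa using this.comp_ofReal
  have step1 : ∀ x ∈ Set.Icc N (N + 1), ‖(x : ℂ) ^ (-s) - (N : ℂ) ^ (-s)‖
      ≤ ‖s‖ * N ^ (-(3 / 2) : ℝ) := by
    intro x hx
    have := (convex_Icc N (N + 1)).norm_image_sub_le_of_norm_hasDerivWithin_le
      (f := fun y : ℝ => (y : ℂ) ^ (-s)) (C := ‖s‖ * N ^ (-(3 / 2) : ℝ))
      (fun y hy => (hder (-s) y (hN0.trans_le hy.1)).hasDerivWithinAt) (fun y hy => ?_)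
      (Set.left_mem_Icc.2 (by linarith)) hx
    · refine this.trans ?_
      have h2 : ‖x - N‖ ≤ 1 := by
        rw [Real.norm_eq_abs, abs_le]; constructor <;> linarith [hx.1, hx.2]
      exact mul_le_of_le_one_right (by positivity) h2
    · have hy0 : 0 < y := hN0.trans_le hy.1
      rw [norm_mul, norm_neg, Complex.norm_cpow_eq_rpow_re_of_pos hy0]
      gcongr
      calc y ^ (-s - 1).re ≤ y ^ (-(3 / 2) : ℝ) := by
            apply Real.rpow_le_rpow_of_exponent_le (hN1.trans hy.1)
            simp; linarith
        _ ≤ _ := Real.rpow_le_rpow_of_nonpos hN0 hy.1 (by norm_num)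
  have hd : ∀ y : ℝ, 0 < y → HasDerivAt
      (fun y : ℝ => (s - 1) * (N : ℂ) ^ (-s) * y + (y : ℂ) ^ (1 - s))
      ((s - 1) * (N : ℂ) ^ (-s) + (1 - s) * (y : ℂ) ^ (-s)) y := by
    intro y hy
    have h1 := (hder (1 - s) y hy)
    have h2 : HasDerivAt (fun y : ℝ => (s - 1) * (N : ℂ) ^ (-s) * (y : ℂ))
      ((s - 1) * (N : ℂ) ^ (-s)) y := by
      simpa using (Complex.ofRealCLM.hasDerivAt (x := y)).const_mul ((s - 1) * (N : ℂ) ^ (-s))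
    rw [show 1 - s - 1 = -s by ring] at h1
    exact h2.add h1
  have := (convex_Icc N (N + 1)).norm_image_sub_le_of_norm_hasDerivWithin_le
      (C := ‖s - 1‖ * ‖s‖ * N ^ (-(3 / 2) : ℝ))
      (fun y hy => (hd y (hN0.trans_le hy.1)).hasDerivWithinAt) (fun y hy => ?_)
      (Set.left_mem_Icc.2 (by linarith)) (Set.right_mem_Icc.2 (by linarith : N ≤ N + 1))
  · have h1 : ‖N + 1 - N‖ = 1 := by simp
    rw [h1, mul_one] at this
    refine le_trans (le_of_eq ?_) this
    unfold zetaTerm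
    rw [hN2, ← hN]
    congr 1
    push_cast
    ring
  · have e : (s - 1) * (N : ℂ) ^ (-s) + (1 - s) * (y : ℂ) ^ (-s)
      = -((s - 1) * ((y : ℂ) ^ (-s) - (N : ℂ) ^ (-s))) := by ring
    rw [e, norm_neg, norm_mul, mul_assoc]
    gcongr
    exact step1 y hy

lemma summable_rpow_neg_three_halves :
    Summable fun n : ℕ => ((n : ℝ) + 1) ^ (-(3 / 2) : ℝ) := by
  have := (summable_nat_add_iff 1).2 (Real.summable_nat_rpow.2 (by norm_num : (-(3 / 2) : ℝ) < -1))
  simpa using this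

lemma riemannZeta₁_eq_of_one_lt_re {s : ℂ} (hs : 1 < s.re) :
    riemannZeta₁ s = 1 + ∑' n, zetaTerm n s := by
  have hs1 : s ≠ 1 := by rintro rfl; simp at hs
  have hsum : Summable fun n => zetaTerm n s :=
    Summable.of_norm_bounded (summable_rpow_neg_three_halves.mul_left (‖s - 1‖ * ‖s‖))
      (fun n => norm_zetaTerm_le n (by linarith))
  have hpart : ∀ N : ℕ, ∑ n ∈ Finset.range N, zetaTerm n s =
      (s - 1) * ∑ n ∈ Finset.range N, 1 / ((n : ℂ) + 1) ^ s
        + ((((N : ℝ) + 1 : ℝ) : ℂ) ^ (1 - s) - 1) := by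
    intro N
    induction N with
    | zero => simp
    | succ N ih =>
      rw [Finset.sum_range_succ, ih, Finset.sum_range_succ]
      unfold zetaTerm
      push_cast
      rw [Complex.cpow_neg]
      ring_nf
  have hlim : Tendsto (fun N : ℕ => (((N : ℝ) + 1 : ℝ) : ℂ) ^ (1 - s)) atTop (𝓝 0) := by
    rw [tendsto_zero_iff_norm_tendsto_zero]
    have h1 : ∀ N : ℕ, ‖(((N : ℝ) + 1 : ℝ) : ℂ) ^ (1 - s)‖ = ((N : ℝ) + 1) ^ (-(s.re - 1)) := by
      intro N
      rw [Complex.norm_cpow_eq_rpow_re_of_pos (by positivity)]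
      simp
    simp_rw [h1]
    exact (tendsto_rpow_neg_atTop (by linarith)).comp
      (tendsto_atTop_add_const_right _ _ tendsto_natCast_atTop_atTop)
  have hz : Tendsto (fun N : ℕ => ∑ n ∈ Finset.range N, 1 / ((n : ℂ) + 1) ^ s) atTop
      (𝓝 (riemannZeta s)) := by
    rw [zeta_eq_tsum_one_div_nat_add_one_cpow hs]
    apply Summable.tendsto_sum_tsum_nat
    have := (summable_nat_add_iff 1).2 (Complex.summable_one_div_nat_cpow.2 hs)
    simpa using this
  have h2 := (hz.const_mul (s - 1)).add (hlim.sub_const 1)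
  simp_rw [← hpart] at h2
  have h3 := tendsto_nhds_unique hsum.tendsto_sum_tsum_nat h2
  rw [h3, riemannZeta_eq_inv_sub_mul hs1]
  field_simp [sub_ne_zero.2 hs1]
  ring

lemma riemannZeta₁_eq {s : ℂ} (hs : 1 / 2 < s.re) :
    riemannZeta₁ s = 1 + ∑' n, zetaTerm n s := by
  have hopen : IsOpen {z : ℂ | 1 / 2 < z.re} := isOpen_lt continuous_const Complex.continuous_re
  have hconn : IsPreconnected {z : ℂ | 1 / 2 < z.re} :=
    (convex_halfSpace_re_gt (1 / 2)).isPreconnected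
  have hana : DifferentiableOn ℂ (fun s => 1 + ∑' n, zetaTerm n s) {z : ℂ | 1 / 2 < z.re} := by
    refine (differentiableOn_const _).add ?_
    intro z hz
    have hz' : 1 / 2 < z.re := hz
    set U : Set ℂ := {w : ℂ | 1 / 2 < w.re} ∩ Metric.ball 0 (‖z‖ + 1) with hU
    have hUo : IsOpen U := hopen.inter Metric.isOpen_ball
    have hzU : z ∈ U := ⟨hz, by simp⟩
    have := Complex.differentiableOn_tsum_of_summable_norm (F := zetaTerm) (U := U)
      (summable_rpow_neg_three_halves.mul_left ((‖z‖ + 2) * (‖z‖ + 1)))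
      (fun n => (differentiable_zetaTerm n).differentiableOn) hUo (fun n w hw => by
        refine (norm_zetaTerm_le n (le_of_lt hw.1)).trans ?_
        have hw2 : ‖w‖ ≤ ‖z‖ + 1 := by simpa using (Metric.mem_ball.1 hw.2).le
        gcongr
        refine (norm_sub_le _ _).trans ?_
        rw [norm_one]; linarith)
    exact ((this z hzU).differentiableAt (hUo.mem_nhds hzU)).differentiableWithinAt
  have h2 : (2 : ℂ) ∈ {z : ℂ | 1 / 2 < z.re} := by simp; norm_num
  refine AnalyticOnNhd.eqOn_of_preconnected_of_eventuallyEq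
    (differentiable_riemannZeta₁.differentiableOn.analyticOnNhd hopen)
    (hana.analyticOnNhd hopen) hconn h2 ?_ hs
  filter_upwards [(isOpen_lt continuous_const Complex.continuous_re).mem_nhds
    (show (2 : ℂ) ∈ {z : ℂ | 1 < z.re} by simp)] with w hw
  exact riemannZeta₁_eq_of_one_lt_re hw

lemma stripBound_riemannZeta₁ : StripBound (3 / 4) 4 riemannZeta₁ := by
  set S := ∑' n : ℕ, ((n : ℝ) + 1) ^ (-(3 / 2) : ℝ) with hS
  have hS0 : 0 ≤ S := tsum_nonneg fun n => by positivity
  refine ⟨1 + 5 * 4 * S, 2, fun s h1 h2 => ?_⟩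
  rw [riemannZeta₁_eq (by linarith)]
  have h3 : ‖∑' n, zetaTerm n s‖ ≤ ‖s - 1‖ * ‖s‖ * S := by
    refine tsum_of_norm_bounded (summable_rpow_neg_three_halves.hasSum.mul_left _)
      (fun n => norm_zetaTerm_le n (by linarith))
  have h4 : ‖s‖ ≤ 4 * (1 + |s.im|) := by
    refine (Complex.norm_le_abs_re_add_abs_im s).trans ?_
    rw [abs_of_nonneg (by linarith : 0 ≤ s.re)]
    linarith [abs_nonneg s.im]
  have h5 : ‖s - 1‖ ≤ 5 * (1 + |s.im|) := by
    refine (norm_sub_le _ _).trans ?_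
    rw [norm_one]; linarith [abs_nonneg s.im]
  calc ‖1 + ∑' n, zetaTerm n s‖ ≤ 1 + ‖s - 1‖ * ‖s‖ * S := by
        refine (norm_add_le _ _).trans ?_
        rw [norm_one]; linarith
    _ ≤ 1 * (1 + |s.im|) ^ 2 + (5 * (1 + |s.im|)) * (4 * (1 + |s.im|)) * S := by
        gcongr
        nlinarith [abs_nonneg s.im]
    _ = _ := by ring

lemma stripBound_riemannZeta₀ : StripBound (3 / 4) 4 riemannZeta₀ := by
  obtain ⟨C, k, hC, h⟩ := stripBound_riemannZeta₁.exists_one_le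
  obtain ⟨B, hB⟩ := (isCompact_closedBall (1 : ℂ) 1).exists_bound_of_continuousOn
    differentiable_riemannZeta₀.continuous.continuousOn
  refine ⟨(C + 1) + max B 0, k, fun s h1 h2 => ?_⟩
  have h0 : 1 ≤ (1 + |s.im|) ^ k := one_le_pow₀ (by linarith [abs_nonneg s.im])
  have hm := le_max_left B 0
  have hm0 := le_max_right B 0
  by_cases hs : ‖s - 1‖ ≤ 1
  · have := hB s (by simpa [dist_eq_norm] using hs)
    nlinarith
  · push Not at hs
    have hs1 : s - 1 ≠ 0 := by intro h0; rw [h0] at hs; simp at hs; linarith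
    have e : riemannZeta₀ s = (riemannZeta₁ s - 1) / (s - 1) := by
      unfold riemannZeta₁; field_simp; ring
    rw [e, norm_div]
    have h3 : ‖riemannZeta₁ s - 1‖ ≤ C * (1 + |s.im|) ^ k + 1 := by
      refine (norm_sub_le _ _).trans ?_
      rw [norm_one]; linarith [h s h1 h2]
    calc _ ≤ ‖riemannZeta₁ s - 1‖ / 1 := by gcongr
      _ ≤ _ := by nlinarith

lemma riemannZeta₁_eq_mul {s : ℂ} (hs : s ≠ 1) : riemannZeta₁ s = (s - 1) * riemannZeta s := by
  rw [riemannZeta_eq_inv_sub_mul hs, ← mul_assoc, mul_inv_cancel₀ (sub_ne_zero.2 hs), one_mul]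

lemma riemannZeta₁_ne_zero {s : ℂ} (hs : 1 ≤ s.re) : riemannZeta₁ s ≠ 0 := by
  by_cases h : s = 1
  · rw [h, riemannZeta₁_one]; exact one_ne_zero
  · rw [riemannZeta₁_eq_mul h]
    exact mul_ne_zero (sub_ne_zero.2 h) (riemannZeta_ne_zero_of_one_le_re hs)

lemma cube_le_norm_riemannZeta₁_mul {x t : ℝ} (hx : 0 < x) (ht : 1 ≤ |t|) :
    x ^ 3 ≤ ‖riemannZeta₁ (1 + x)‖ ^ 3 * ‖riemannZeta₁ (1 + x + Complex.I * t)‖ ^ 4 *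
      ‖riemannZeta₁ (1 + x + 2 * Complex.I * t)‖ := by
  have h := DirichletCharacter.norm_LFunction_product_ge_one
    (1 : DirichletCharacter ℂ 1) hx t
  simp only [DirichletCharacter.LFunctionTrivChar, DirichletCharacter.LFunction_modOne_eq,
    norm_mul, norm_pow] at h
  have n1 : (1 + x : ℂ) ≠ 1 := by
    intro h; have := congrArg Complex.re h; simp at this; linarith
  have n2 : (1 + x + Complex.I * t : ℂ) ≠ 1 := by
    intro h; have := congrArg Complex.re h; simp at this; linarith
  have n3 : (1 + x + 2 * Complex.I * t : ℂ) ≠ 1 := by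
    intro h; have := congrArg Complex.re h; simp at this; linarith
  rw [riemannZeta₁_eq_mul n1, riemannZeta₁_eq_mul n2, riemannZeta₁_eq_mul n3]
  simp only [norm_mul, mul_pow]
  have m1 : ‖(1 + x : ℂ) - 1‖ = x := by
    rw [add_sub_cancel_left, Complex.norm_real, Real.norm_of_nonneg hx.le]
  have m2 : 1 ≤ ‖(1 + x + Complex.I * t : ℂ) - 1‖ := by
    refine ht.trans ?_
    simpa using Complex.abs_im_le_norm ((1 + x + Complex.I * t : ℂ) - 1)
  have m3 : 1 ≤ ‖(1 + x + 2 * Complex.I * t : ℂ) - 1‖ := by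
    have := Complex.abs_im_le_norm ((1 + x + 2 * Complex.I * t : ℂ) - 1)
    simp [abs_mul] at this
    linarith
  rw [m1]
  set a := ‖(1 + x + Complex.I * t : ℂ) - 1‖
  set b := ‖(1 + x + 2 * Complex.I * t : ℂ) - 1‖
  set u := ‖riemannZeta (1 + x)‖
  set v := ‖riemannZeta (1 + x + Complex.I * t)‖
  set w := ‖riemannZeta (1 + x + 2 * Complex.I * t)‖
  calc x ^ 3 ≤ x ^ 3 * (u ^ 3 * v ^ 4 * w) * (1 ^ 4 * 1) := by
        rw [one_pow, mul_one, mul_one]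
        exact le_mul_of_one_le_right (by positivity) h
    _ ≤ x ^ 3 * (u ^ 3 * v ^ 4 * w) * (a ^ 4 * b) := by gcongr
    _ = _ := by ring

lemma stripBound_inv_riemannZeta₁ : StripBound 1 2 fun s => (riemannZeta₁ s)⁻¹ := by
  obtain ⟨A, k, hA, hAb⟩ := stripBound_riemannZeta₁.exists_one_le
  obtain ⟨A', k', hA', hA'b⟩ := ((stripBound_riemannZeta₁.deriv differentiable_riemannZeta₁
    (r := 1 / 4) (by norm_num)).mono (a' := 1) (b' := 2) (by norm_num) (by norm_num)).exists_one_le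
  have hcpt : IsCompact (Set.Icc (1 : ℝ) 2 ×ℂ Set.Icc (-1 : ℝ) 1) :=
    isCompact_Icc.reProdIm isCompact_Icc
  obtain ⟨B₀, hB₀⟩ := hcpt.exists_bound_of_continuousOn
    (f := fun s => (riemannZeta₁ s)⁻¹)
    (differentiable_riemannZeta₁.continuous.continuousOn.inv₀ fun s hs =>
      riemannZeta₁_ne_zero (Complex.mem_reProdIm.1 hs).1.1)
  refine ⟨max B₀ 0 + 16 * A' ^ 4 * (A ^ 4 * A * 2 ^ k), 4 * k' + k, fun s h1 h2 => ?_⟩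
  have habs := abs_nonneg s.im
  by_cases ht : |s.im| ≤ 1
  · refine (hB₀ s (Complex.mem_reProdIm.2 ⟨⟨h1, h2⟩, abs_le.1 ht⟩)).trans ?_
    calc B₀ ≤ max B₀ 0 := le_max_left _ _
      _ ≤ max B₀ 0 + 16 * A' ^ 4 * (A ^ 4 * A * 2 ^ k) := by
        have : 0 ≤ 16 * A' ^ 4 * (A ^ 4 * A * 2 ^ k) := by positivity
        linarith
      _ ≤ _ := le_mul_of_one_le_right (by positivity) (one_le_pow₀ (by linarith))
  · push Not at ht
    set t := s.im with htdef
    set B := 1 + |t| with hB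
    have hB1 : 1 ≤ B := by linarith
    set D := A' * B ^ k' with hD
    have hD1 : 1 ≤ D := one_le_mul_of_one_le_of_one_le hA' (one_le_pow₀ hB1)
    set Q := A ^ 4 * A * 2 ^ k * B ^ k with hQ
    have hQ1 : 1 ≤ Q := by
      rw [hQ]
      refine one_le_mul_of_one_le_of_one_le (one_le_mul_of_one_le_of_one_le
        (one_le_mul_of_one_le_of_one_le (one_le_pow₀ hA) hA) (one_le_pow₀ (by norm_num)))
        (one_le_pow₀ hB1)
    set η := 1 / (16 * D ^ 4 * Q) with hη
    have hη0 : 0 < η := by positivity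
    have hη1 : η ≤ 1 := by
      rw [hη, div_le_one (by positivity)]
      nlinarith [one_le_pow₀ (n := 4) hD1, one_le_mul_of_one_le_of_one_le
        (one_le_pow₀ (n := 4) hD1) hQ1]
    have key : ∀ x : ℝ, η ≤ x → x ≤ 1 →
        2 * (D * η) ≤ ‖riemannZeta₁ (1 + x + Complex.I * t)‖ := by
      intro x hx hx1
      have hx0 : 0 < x := hη0.trans_le hx
      have h341 := cube_le_norm_riemannZeta₁_mul hx0 ht.le
      have b1 : ‖riemannZeta₁ (1 + x)‖ ≤ A := by
        have := hAb (1 + x) (by simp; linarith) (by simp; linarith)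
        simpa using this
      have b2 : ‖riemannZeta₁ (1 + x + 2 * Complex.I * t)‖ ≤ A * (2 ^ k * B ^ k) := by
        have := hAb (1 + x + 2 * Complex.I * t) (by simp; linarith) (by simp; linarith)
        refine this.trans ?_
        rw [← mul_pow]
        gcongr
        simp [abs_mul]
        linarith
      set v := ‖riemannZeta₁ (1 + x + Complex.I * t)‖
      have h4 : η ^ 3 ≤ v ^ 4 * Q := by
        calc η ^ 3 ≤ x ^ 3 := by gcongr
          _ ≤ _ := h341
          _ ≤ A ^ 3 * v ^ 4 * (A * (2 ^ k * B ^ k)) := by gcongr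
          _ ≤ A * (A ^ 3 * v ^ 4 * (A * (2 ^ k * B ^ k))) :=
            le_mul_of_one_le_left (by positivity) hA
          _ = _ := by rw [hQ]; ring
      have h5 : (2 * (D * η)) ^ 4 * Q = η ^ 3 := by
        have : η * (16 * D ^ 4 * Q) = 1 := by rw [hη]; field_simp
        calc (2 * (D * η)) ^ 4 * Q = η ^ 3 * (η * (16 * D ^ 4 * Q)) := by ring
          _ = _ := by rw [this, mul_one]
      have h6 : (2 * (D * η)) ^ 4 ≤ v ^ 4 := by
        rw [← h5] at h4
        exact le_of_mul_le_mul_right h4 (by linarith)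
      exact le_of_pow_le_pow_left₀ (by norm_num) (norm_nonneg _) h6
    have hs : s = 1 + ((s.re - 1 : ℝ) : ℂ) + Complex.I * t := by
      apply Complex.ext <;> simp [htdef]
    have hlow : η ≤ ‖riemannZeta₁ s‖ := by
      have hDη : η ≤ D * η := le_mul_of_one_le_left hη0.le hD1
      by_cases hx : η ≤ s.re - 1
      · have := key (s.re - 1) hx (by linarith)
        rw [← hs] at this
        linarith
      · push Not at hx
        have h7 := key η le_rfl hη1
        set z := (1 + (η : ℂ) + Complex.I * t) with hz
        have hconv : Convex ℝ {w : ℂ | 1 ≤ w.re ∧ w.re ≤ 2 ∧ w.im = t} := by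
          intro w1 hw1 w2 hw2 a b ha hb hab
          refine ⟨?_, ?_, ?_⟩
          · simp; nlinarith [hw1.1, hw2.1]
          · simp; nlinarith [hw1.2.1, hw2.2.1]
          · simp [hw1.2.2, hw2.2.2]; rw [← add_mul, hab, one_mul]
        have hmv := hconv.norm_image_sub_le_of_norm_deriv_le (f := riemannZeta₁) (C := D)
          (x := s) (y := z)
          (fun w _ => differentiable_riemannZeta₁ w) (fun w hw => by
            have := hA'b w hw.1 hw.2.1
            rwa [hw.2.2] at this) ⟨h1, h2, rfl⟩
          ⟨by simp [hz]; linarith, by simp [hz]; linarith, by simp [hz]⟩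
        have hzs : z - s = ((η - (s.re - 1) : ℝ) : ℂ) := by
          apply Complex.ext <;> simp [hz, htdef]
          ring
        rw [hzs, Complex.norm_real, Real.norm_eq_abs, abs_of_pos (by linarith)] at hmv
        have h8 : D * (η - (s.re - 1)) ≤ D * η := by gcongr; linarith
        have h9 := norm_sub_norm_le (riemannZeta₁ z) (riemannZeta₁ s)
        linarith
    rw [norm_inv]
    calc ‖riemannZeta₁ s‖⁻¹ ≤ η⁻¹ := inv_anti₀ hη0 hlow
      _ = 16 * D ^ 4 * Q := by rw [hη, one_div, inv_inv]
      _ = 16 * A' ^ 4 * (A ^ 4 * A * 2 ^ k) * B ^ (4 * k' + k) := by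
        rw [hD, hQ, pow_add, mul_comm 4 k', pow_mul]; ring
      _ ≤ _ := by
        gcongr
        linarith [le_max_right B₀ 0]

/-- The coefficients `(Λ(n) - 1) log n`. -/
def mangoldtError (n : ℕ) : ℝ := (ArithmeticFunction.vonMangoldt n - 1) * Real.log n

/-- The analytic continuation of the derivative of `logDeriv ζ + ζ` to `1 ≤ re s`. -/
def zetaDiff (s : ℂ) : ℂ :=
  deriv (deriv riemannZeta₁) s * (riemannZeta₁ s)⁻¹
    + -((deriv riemannZeta₁ s * (riemannZeta₁ s)⁻¹) * (deriv riemannZeta₁ s * (riemannZeta₁ s)⁻¹))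
    + deriv riemannZeta₀ s

lemma stripBound_zetaDiff : StripBound 1 2 zetaDiff := by
  have h1 := stripBound_riemannZeta₁.deriv differentiable_riemannZeta₁
    (r := 1 / 8) (by norm_num)
  have h2 := (h1.deriv differentiable_riemannZeta₁.deriv (r := 1 / 8) (by norm_num)).mono
    (a' := 1) (b' := 2) (by norm_num) (by norm_num)
  have h0 := (stripBound_riemannZeta₀.deriv differentiable_riemannZeta₀
    (r := 1 / 4) (by norm_num)).mono (a' := 1) (b' := 2) (by norm_num) (by norm_num)
  have h1' := (h1.mono (a' := 1) (b' := 2) (by norm_num) (by norm_num)).mul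
    stripBound_inv_riemannZeta₁
  exact ((h2.mul stripBound_inv_riemannZeta₁).add (h1'.mul h1').neg).add h0

lemma deriv_logDeriv_riemannZeta {s : ℂ} (hs : 1 < s.re) :
    deriv (fun z => deriv riemannZeta z / riemannZeta z) s + deriv riemannZeta s = zetaDiff s := by
  have hs1 : s ≠ 1 := by rintro rfl; simp at hs
  have hev : (fun z => deriv riemannZeta z / riemannZeta z) =ᶠ[𝓝 s]
      fun z => deriv riemannZeta₁ z / riemannZeta₁ z - (z - 1)⁻¹ := by
    filter_upwards [(isOpen_lt continuous_const Complex.continuous_re).mem_nhds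
      (show s ∈ {z : ℂ | 1 < z.re} from hs)] with z hz
    have hz' : 1 < z.re := hz
    have hz1 : z ≠ 1 := by rintro rfl; simp at hz'
    have h1 := riemannZeta₁_ne_zero hz'.le
    have h2 := sub_ne_zero.2 hz1
    rw [deriv_riemannZeta_eq_neg_inv_sub_sq_mul_add hz1, riemannZeta_eq_inv_sub_mul hz1]
    field_simp
    ring
  rw [hev.deriv_eq, deriv_riemannZeta_eq_neg_inv_sub_sq_add hs1]
  have hne := riemannZeta₁_ne_zero hs.le
  have h2 := sub_ne_zero.2 hs1
  have d1 := ((differentiable_riemannZeta₁.deriv s).hasDerivAt).div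
    (differentiable_riemannZeta₁ s).hasDerivAt hne
  have d2 := ((hasDerivAt_id s).sub_const 1).inv h2
  have d3 : HasDerivAt (fun z => deriv riemannZeta₁ z / riemannZeta₁ z - (z - 1)⁻¹) _ s := d1.sub d2
  rw [d3.deriv]
  unfold zetaDiff
  simp only [id]
  field_simp
  ring

lemma LSeries_mangoldtError {s : ℂ} (hs : 1 < s.re) :
    LSeriesSummable (fun n => (mangoldtError n : ℂ)) s ∧
      LSeries (fun n => (mangoldtError n : ℂ)) s = zetaDiff s := by
  set Λ' : ℕ → ℂ := fun n => (ArithmeticFunction.vonMangoldt n : ℂ) with hΛ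
  have ha : LSeries.abscissaOfAbsConv Λ' < s.re :=
    lt_of_le_of_lt (LSeries.abscissaOfAbsConv_le_of_forall_lt_LSeriesSummable (x := 1)
      fun y hy => ArithmeticFunction.LSeriesSummable_vonMangoldt (by simpa using hy))
      (by exact_mod_cast hs)
  have hb : LSeries.abscissaOfAbsConv (1 : ℕ → ℂ) < s.re := by
    rw [LSeries.abscissaOfAbsConv_one]; exact_mod_cast hs
  have s1 := LSeriesSummable_logMul_of_lt_re ha
  have s2 := LSeriesSummable_logMul_of_lt_re hb
  have e : (fun n => (mangoldtError n : ℂ)) = LSeries.logMul Λ' - LSeries.logMul 1 := by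
    ext n
    simp [mangoldtError, LSeries.logMul, hΛ, Complex.ofReal_log, Nat.cast_nonneg]
    ring
  refine ⟨e ▸ s1.sub s2, ?_⟩
  rw [e, LSeries_sub s1 s2, ← deriv_logDeriv_riemannZeta hs]
  have l1 := LSeries_deriv ha
  have l2 := LSeries_deriv hb
  have hnh := (isOpen_lt continuous_const Complex.continuous_re).mem_nhds
      (show s ∈ {z : ℂ | 1 < z.re} from hs)
  have ev1 : LSeries Λ' =ᶠ[𝓝 s] fun z => -(deriv riemannZeta z / riemannZeta z) := by
    filter_upwards [hnh] with z hz
    rw [hΛ, ArithmeticFunction.LSeries_vonMangoldt_eq_deriv_riemannZeta_div hz, neg_div]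
  have ev2 : LSeries 1 =ᶠ[𝓝 s] riemannZeta := by
    filter_upwards [hnh] with z hz
    exact LSeries_one_eq_riemannZeta hz
  rw [ev1.deriv_eq, deriv.fun_neg] at l1
  rw [ev2.deriv_eq] at l2
  linear_combination l1 - l2

lemma norm_Gamma_le_Gamma_re {s : ℂ} (hs : 0 < s.re) : ‖Complex.Gamma s‖ ≤ Real.Gamma s.re := by
  rw [Complex.Gamma_eq_integral hs, Real.Gamma_eq_integral hs, Complex.GammaIntegral]
  refine (MeasureTheory.norm_integral_le_integral_norm _).trans (le_of_eq ?_)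
  refine MeasureTheory.setIntegral_congr_fun measurableSet_Ioi fun x hx => ?_
  have hx' : 0 < x := hx
  simp only [norm_mul, Complex.norm_real, Real.norm_eq_abs, Real.abs_exp]
  rw [Complex.norm_cpow_eq_rpow_re_of_pos hx']
  simp

lemma exists_norm_Gamma_mul_le (K : ℕ) : ∀ R : ℝ, ∃ C : ℝ, ∀ s : ℂ, 1 ≤ s.re → s.re ≤ R →
    ‖Complex.Gamma s‖ * (1 + |s.im|) ^ K ≤ C := by
  induction K with
  | zero =>
    intro R
    obtain ⟨C, hC⟩ := (isCompact_Icc (a := (1 : ℝ)) (b := R)).exists_bound_of_continuousOn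
      (f := Real.Gamma) (fun x hx => (Real.differentiableAt_Gamma (fun n => by
        have : (0 : ℝ) ≤ n := Nat.cast_nonneg n
        linarith [hx.1])).continuousAt.continuousWithinAt)
    refine ⟨C, fun s h1 h2 => ?_⟩
    rw [pow_zero, mul_one]
    exact (norm_Gamma_le_Gamma_re (by linarith)).trans
      ((le_abs_self _).trans (hC _ ⟨h1, h2⟩))
  | succ K ih =>
    intro R
    obtain ⟨C, hC⟩ := ih (R + 1)
    refine ⟨2 * C, fun s h1 h2 => ?_⟩
    have hs0 : s ≠ 0 := by rintro rfl; simp at h1; linarith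
    have h3 := hC (s + 1) (by simp; linarith) (by simp; linarith)
    rw [Complex.Gamma_add_one s hs0, norm_mul] at h3
    simp only [Complex.add_im, Complex.one_im, add_zero] at h3
    have h4 : 1 + |s.im| ≤ 2 * ‖s‖ := by
      have := Complex.abs_im_le_norm s
      have := Complex.re_le_norm s
      linarith
    calc ‖Complex.Gamma s‖ * (1 + |s.im|) ^ (K + 1)
        = (1 + |s.im|) * (‖Complex.Gamma s‖ * (1 + |s.im|) ^ K) := by ring
      _ ≤ 2 * ‖s‖ * (‖Complex.Gamma s‖ * (1 + |s.im|) ^ K) := by gcongr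
      _ = 2 * (‖s‖ * ‖Complex.Gamma s‖ * (1 + |s.im|) ^ K) := by ring
      _ ≤ _ := by gcongr

/-- The weight `u ^ m * exp (-u)`. -/
def gammaWeight (m : ℕ) (u : ℝ) : ℝ := u ^ m * Real.exp (-u)

lemma integrable_Gamma_vertical {a : ℝ} (ha : 1 ≤ a) :
    MeasureTheory.Integrable fun y : ℝ => Complex.Gamma (a + y * Complex.I) := by
  obtain ⟨C, hC⟩ := exists_norm_Gamma_mul_le 2 a
  refine (integrable_inv_one_add_sq.const_mul C).mono' ?_ (Eventually.of_forall fun y => ?_)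
  · refine Continuous.aestronglyMeasurable (continuous_iff_continuousAt.2 fun y => ?_)
    refine ContinuousAt.comp (g := Complex.Gamma) ?_ (by fun_prop)
    refine (Complex.differentiableAt_Gamma _ fun n h => ?_).continuousAt
    have := congrArg Complex.re h
    have h2 : (0 : ℝ) ≤ n := Nat.cast_nonneg n
    simp at this
    linarith
  · have := hC (a + y * Complex.I) (by simpa using ha) (by simp)
    simp only [Complex.add_im, Complex.ofReal_im, Complex.mul_im, Complex.ofReal_re,
      Complex.I_im, Complex.I_re, mul_one, mul_zero, zero_add, add_zero] at this
    rw [← div_eq_mul_inv, le_div_iff₀ (by positivity)]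
    refine le_trans ?_ this
    gcongr
    nlinarith [abs_nonneg y, sq_abs y]

lemma gammaWeight_eq_integral (m : ℕ) {σ u : ℝ} (hσ : 1 ≤ σ) (hu : 0 < u) :
    (gammaWeight m u : ℂ) = (1 / (2 * π) : ℝ) *
      ∫ y : ℝ, (u : ℂ) ^ (-(σ + y * Complex.I)) * Complex.Gamma (σ + m + y * Complex.I) := by
  have hσm : 1 ≤ σ + m := by have : (0 : ℝ) ≤ m := Nat.cast_nonneg m; linarith
  have hG : ∀ y : ℝ, mellin (fun x : ℝ => ((Real.exp (-x) : ℝ) : ℂ))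
      (((σ + m : ℝ) : ℂ) + y * Complex.I) = Complex.Gamma (σ + m + y * Complex.I) := by
    intro y
    rw [← Complex.GammaIntegral_eq_mellin, Complex.Gamma_eq_integral (by simp; linarith)]
    push_cast
    rfl
  have hinv := mellinInv_mellin_eq (σ + m) (fun x : ℝ => ((Real.exp (-x) : ℝ) : ℂ)) hu ?_ ?_ ?_
  · have h2 : (gammaWeight m u : ℂ) = (u : ℂ) ^ m * ((Real.exp (-u) : ℝ) : ℂ) := by
      simp [gammaWeight]
    rw [h2, ← hinv, mellinInv, Complex.real_smul, mul_left_comm]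
    congr 1
    rw [← MeasureTheory.integral_const_mul]
    congr 1
    ext y
    rw [hG y, smul_eq_mul, ← mul_assoc, ← Complex.cpow_natCast,
      ← Complex.cpow_add _ _ (by exact_mod_cast hu.ne')]
    congr 2
    push_cast
    ring
  · have := Complex.GammaIntegral_convergent (s := ((σ + m : ℝ) : ℂ)) (by simp; linarith)
    refine this.congr_fun (fun x _ => ?_) measurableSet_Ioi
    simp [mul_comm]
  · unfold Complex.VerticalIntegrable
    simp_rw [hG]
    have := integrable_Gamma_vertical hσm
    simpa using this
  · fun_prop

lemma norm_tsum_mangoldtError_le (m : ℕ) : ∃ C : ℝ, 0 ≤ C ∧ ∀ σ Y : ℝ, 1 < σ → σ ≤ 2 → 0 < Y →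
    |∑' n : ℕ, mangoldtError n * gammaWeight m (n / Y)| ≤ C * Y ^ σ := by
  obtain ⟨C₁, k, hC₁, hD⟩ := stripBound_zetaDiff.exists_one_le
  obtain ⟨C₂, hΓ⟩ := exists_norm_Gamma_mul_le (k + 2) (m + 2)
  have hm : (0 : ℝ) ≤ m := Nat.cast_nonneg m
  have hC₂ : 0 ≤ C₂ := le_trans (by positivity) (hΓ 1 (by simp) (by simp; linarith))
  refine ⟨(1 / (2 * π)) * ∫ y : ℝ, C₁ * C₂ * (1 + y ^ 2)⁻¹, ?_, fun σ Y hσ hσ2 hY => ?_⟩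
  · have : 0 ≤ ∫ y : ℝ, C₁ * C₂ * (1 + y ^ 2)⁻¹ :=
      MeasureTheory.integral_nonneg fun y => by positivity
    positivity
  set b : ℕ → ℂ := fun n => (mangoldtError n : ℂ) with hb
  set F : ℕ → ℝ → ℂ := fun n y => LSeries.term b (σ + y * Complex.I) n *
    ((Y : ℂ) ^ (σ + y * Complex.I) * Complex.Gamma (σ + m + y * Complex.I)) with hF
  have hre : ∀ y : ℝ, (σ + y * Complex.I : ℂ).re = σ := fun y => by simp
  have hΓint := integrable_Gamma_vertical (a := σ + m) (by linarith)
  have hF0 : ∀ y, F 0 y = 0 := fun y => by simp [hF]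
  have hFn : ∀ n : ℕ, n ≠ 0 → ∀ y, F n y = b n *
      (((n / Y : ℝ) : ℂ) ^ (-(σ + y * Complex.I)) * Complex.Gamma (σ + m + y * Complex.I)) := by
    intro n hn y
    simp only [hF, LSeries.term_of_ne_zero hn]
    have h1 : ((n / Y : ℝ) : ℂ) ^ (-(σ + y * Complex.I))
        = ((n : ℂ) ^ (σ + y * Complex.I))⁻¹ * (Y : ℂ) ^ (σ + y * Complex.I) := by
      rw [div_eq_mul_inv, Complex.ofReal_mul,
        Complex.mul_cpow_ofReal_nonneg (Nat.cast_nonneg n) (inv_nonneg.2 hY.le),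
        Complex.cpow_neg, Complex.ofReal_inv, Complex.inv_cpow, Complex.cpow_neg, inv_inv]
      · simp
      · rw [Complex.arg_ofReal_of_nonneg hY.le]; exact Real.pi_pos.ne
    rw [h1]
    ring
  have hnorm : ∀ n y, ‖F n y‖ = ‖LSeries.term b σ n‖ * (Y ^ σ *
      ‖Complex.Gamma (σ + m + y * Complex.I)‖) := by
    intro n y
    simp only [hF, norm_mul, Complex.norm_cpow_eq_rpow_re_of_pos hY, hre]
    congr 1
    simp [LSeries.norm_term_eq]
  have hFint : ∀ n, MeasureTheory.Integrable (F n) := by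
    intro n
    have hcont : Continuous fun y : ℝ => LSeries.term b (σ + y * Complex.I) n *
        (Y : ℂ) ^ (σ + y * Complex.I) := by
      by_cases hn : n = 0
      · simp [hn, continuous_const]
      · simp only [LSeries.term_of_ne_zero hn]
        have hn' : (n : ℂ) ≠ 0 := by exact_mod_cast hn
        have hY' : (Y : ℂ) ≠ 0 := by exact_mod_cast hY.ne'
        have c1 : Continuous fun y : ℝ => (σ + y * Complex.I : ℂ) := by fun_prop
        refine Continuous.mul (Continuous.div₀ continuous_const (c1.const_cpow (Or.inl hn'))
          fun y => ?_) (c1.const_cpow (Or.inl hY'))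
        rw [Complex.cpow_ne_zero_iff]; exact Or.inl hn'
    refine (MeasureTheory.Integrable.bdd_mul (c := ‖LSeries.term b σ n‖ * Y ^ σ) hΓint
      hcont.aestronglyMeasurable (Eventually.of_forall fun y => ?_)).congr
        (Eventually.of_forall fun y => ?_)
    · rw [norm_mul, Complex.norm_cpow_eq_rpow_re_of_pos hY, hre]
      refine le_of_eq ?_
      congr 1
      simp [LSeries.norm_term_eq]
    · simp [hF, mul_assoc]
  have hsummable : Summable fun n => ‖LSeries.term b σ n‖ :=
    (LSeries_mangoldtError (s := σ) (by simpa using hσ)).1.norm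
  have hswap := MeasureTheory.hasSum_integral_of_summable_integral_norm hFint (by
    simp_rw [hnorm, MeasureTheory.integral_const_mul]
    exact hsummable.mul_right _)
  have hterm : ∀ n, ((mangoldtError n * gammaWeight m (n / Y) : ℝ) : ℂ)
      = (1 / (2 * π) : ℝ) * ∫ y, F n y := by
    intro n
    by_cases hn : n = 0
    · simp [hn, hF0, mangoldtError]
    · simp_rw [hFn n hn, MeasureTheory.integral_const_mul]
      rw [Complex.ofReal_mul, gammaWeight_eq_integral m hσ.le
        (div_pos (by positivity) hY)]
      ring
  have hsum : ((∑' n : ℕ, mangoldtError n * gammaWeight m (n / Y) : ℝ) : ℂ)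
      = (1 / (2 * π) : ℝ) * ∫ y, ∑' n, F n y := by
    rw [Complex.ofReal_tsum, ← (hswap.mul_left _).tsum_eq]
    exact tsum_congr hterm
  rw [← Real.norm_eq_abs, ← Complex.norm_real, hsum, norm_mul, Complex.norm_real,
    Real.norm_of_nonneg (by positivity),
    mul_assoc]
  gcongr
  rw [← MeasureTheory.integral_mul_const]
  refine MeasureTheory.norm_integral_le_of_norm_le
    ((integrable_inv_one_add_sq.const_mul (C₁ * C₂)).mul_const _) (Eventually.of_forall fun y => ?_)
  have e : ∑' n, F n y = zetaDiff (σ + y * Complex.I) *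
      ((Y : ℂ) ^ (σ + y * Complex.I) * Complex.Gamma (σ + m + y * Complex.I)) := by
    rw [← (LSeries_mangoldtError (s := σ + y * Complex.I) (by rw [hre]; exact hσ)).2,
      LSeries, ← tsum_mul_right]
  rw [e, norm_mul, norm_mul, Complex.norm_cpow_eq_rpow_re_of_pos hY, hre]
  have d1 := hD (σ + y * Complex.I) (by rw [hre]; exact hσ.le) (by rw [hre]; exact hσ2)
  have d2 := hΓ (σ + m + y * Complex.I) (by simp; linarith) (by simp; linarith)
  simp only [Complex.add_im, Complex.ofReal_im, Complex.mul_im, Complex.ofReal_re,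
      Complex.I_im, Complex.I_re, mul_one, mul_zero, zero_add, add_zero, Complex.natCast_im]
    at d1 d2
  set G := ‖Complex.Gamma (σ + m + y * Complex.I)‖
  set B := 1 + |y| with hB
  have hB1 : 1 ≤ B := by linarith [abs_nonneg y]
  have h3 : (1 + y ^ 2) ≤ B ^ 2 := by nlinarith [abs_nonneg y, sq_abs y]
  calc _ ≤ C₁ * B ^ k * (Y ^ σ * G) := by gcongr
    _ = C₁ * (G * B ^ (k + 2)) * (B ^ 2)⁻¹ * Y ^ σ := by
      field_simp
      ring
    _ ≤ C₁ * C₂ * (1 + y ^ 2)⁻¹ * Y ^ σ := by gcongr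

/-- The prime number theorem in smoothed form. -/
theorem abs_tsum_mangoldtError_le (m : ℕ) : ∃ C : ℝ, 0 ≤ C ∧ ∀ Y : ℝ, 0 < Y →
    |∑' n : ℕ, mangoldtError n * gammaWeight m (n / Y)| ≤ C * Y := by
  obtain ⟨C, hC, h⟩ := norm_tsum_mangoldtError_le m
  refine ⟨C, hC, fun Y hY => ?_⟩
  have hlim : Tendsto (fun σ : ℝ => C * Y ^ σ) (𝓝[>] 1) (𝓝 (C * Y ^ (1 : ℝ))) :=
    ((Real.continuousAt_const_rpow hY.ne').tendsto.const_mul C).mono_left nhdsWithin_le_nhds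
  rw [Real.rpow_one] at hlim
  refine ge_of_tendsto hlim ?_
  filter_upwards [Ioc_mem_nhdsGT (show (1 : ℝ) < 2 by norm_num)] with σ hσ
  exact h σ Y hσ.1 hσ.2 hY

/-- `f u` is `O(u ^ (-1/4))` and `O(u ^ (-3))` on the positive reals. -/
def RapidDecay (f : ℝ → ℝ) : Prop :=
  ∃ C : ℝ, 0 ≤ C ∧ ∀ u : ℝ, 0 < u →
    |f u| ≤ C * u ^ (-(1 / 4) : ℝ) ∧ |f u| ≤ C * u ^ (-3 : ℝ)

lemma one_add_log_sq_le {x : ℝ} (hx : 1 ≤ x) : (1 + Real.log x) ^ 2 ≤ 81 * x ^ (1 / 4 : ℝ) := by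
  have h := Real.log_le_rpow_div (by linarith : 0 ≤ x) (show (0 : ℝ) < 1 / 8 by norm_num)
  have h1 : 1 ≤ x ^ (1 / 8 : ℝ) := Real.one_le_rpow hx (by norm_num)
  have h2 : 1 + Real.log x ≤ 9 * x ^ (1 / 8 : ℝ) := by linarith
  have h3 := Real.log_nonneg hx
  calc (1 + Real.log x) ^ 2 ≤ (9 * x ^ (1 / 8 : ℝ)) ^ 2 := by gcongr
    _ = 81 * x ^ (1 / 4 : ℝ) := by
      rw [mul_pow, ← Real.rpow_natCast (x ^ (1 / 8 : ℝ)), ← Real.rpow_mul (by linarith)]; norm_num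

lemma RapidDecay.mul_log_sq_le {f : ℝ → ℝ} (hf : RapidDecay f) :
    ∃ K : ℝ, 0 ≤ K ∧ ∀ u : ℝ, 0 < u → |f u| * (1 + |Real.log u|) ^ 2 ≤ K * decayBound u := by
  obtain ⟨C, hC, h⟩ := hf
  refine ⟨81 * C, by positivity, fun u hu => ?_⟩
  obtain ⟨h1, h2⟩ := h u hu
  rcases le_total u 1 with hu1 | hu1
  · have e : decayBound u = 1 / √u := by
      refine min_eq_left ?_
      apply one_div_le_one_div_of_le (by positivity)
      rw [Real.le_sqrt (by positivity) hu.le]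
      nlinarith [pow_le_one₀ hu.le hu1 (n := 3), pow_pos hu 3]
    have h3 : |Real.log u| = Real.log u⁻¹ := by
      rw [abs_of_nonpos (Real.log_nonpos hu.le hu1), Real.log_inv]
    have h4 := one_add_log_sq_le ((one_le_inv₀ hu).2 hu1)
    rw [e, h3]
    calc _ ≤ (C * u ^ (-(1 / 4) : ℝ)) * (81 * u⁻¹ ^ (1 / 4 : ℝ)) := by gcongr
      _ = 81 * C * (u ^ (-(1 / 4) : ℝ) * u⁻¹ ^ (1 / 4 : ℝ)) := by ring
      _ = _ := by
        rw [Real.inv_rpow hu.le, ← Real.rpow_neg hu.le, ← Real.rpow_add hu, Real.sqrt_eq_rpow,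
          one_div (u ^ (1 / 2 : ℝ)), ← Real.rpow_neg hu.le]
        norm_num
  · have h3 : |Real.log u| = Real.log u := abs_of_nonneg (Real.log_nonneg hu1)
    rw [decayBound_of_one_le hu1, h3]
    calc _ ≤ (C * u ^ (-3 : ℝ)) * (81 * u ^ (1 / 4 : ℝ)) := by
          gcongr
          exact one_add_log_sq_le hu1
      _ = 81 * C * (u ^ (-3 : ℝ) * u ^ (1 / 4 : ℝ)) := by ring
      _ ≤ 81 * C * u ^ (-2 : ℝ) := by
        rw [← Real.rpow_add hu]
        refine mul_le_mul_of_nonneg_left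
          (Real.rpow_le_rpow_of_exponent_le hu1 (by norm_num)) (by positivity)
      _ = _ := by rw [Real.rpow_neg hu.le, one_div]; norm_cast

lemma LinearlyBounded.const_nonneg {ι : Type*} {N a : ι → ℝ} {K : ℝ}
    (h : LinearlyBounded N a K) : 0 ≤ K := by
  simpa using h.sum_le ∅ 1 zero_le_one (by simp)

lemma RapidDecay.tsum_le {ι : Type*} {N a : ι → ℝ} {K : ℝ} (h : LinearlyBounded N a K)
    {f : ℝ → ℝ} (hf : RapidDecay f) :
    ∃ C : ℝ, 0 ≤ C ∧ ∀ Y : ℝ, 0 < Y → ∀ g : ι → ℝ,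
      (∀ i, |g i| ≤ |f (N i / Y)| * (1 + |Real.log (N i / Y)|) ^ 2) →
      Summable (fun i => a i * g i) ∧ |∑' i, a i * g i| ≤ C * Y := by
  obtain ⟨D, hD, hfD⟩ := hf.mul_log_sq_le
  have hK := h.const_nonneg
  refine ⟨D * (8 * K), by positivity, fun Y hY g hg => ?_⟩
  have hb : ∀ i, ‖a i * g i‖ ≤ D * (a i * decayBound (N i / Y)) := by
    intro i
    rw [norm_mul, Real.norm_of_nonneg (h.nonneg i), Real.norm_eq_abs, mul_left_comm]
    exact mul_le_mul_of_nonneg_left ((hg i).trans (hfD _ (div_pos (h.pos i) hY))) (h.nonneg i)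
  have hs := (h.summable_decayBound hY).mul_left D
  refine ⟨Summable.of_norm_bounded hs hb, ?_⟩
  rw [← Real.norm_eq_abs]
  refine (tsum_of_norm_bounded hs.hasSum hb).trans ?_
  rw [tsum_mul_left, mul_assoc]
  gcongr
  exact h.tsum_decayBound_le hY

lemma le_mul_one_add_abs_sq (x y : ℝ) : |x| ≤ |x| * (1 + |y|) ^ 2 :=
  le_mul_of_one_le_right (abs_nonneg _) (one_le_pow₀ (by linarith [abs_nonneg y]))

lemma mul_abs_le_mul_one_add_abs_sq (x y : ℝ) : |x * y| ≤ |x| * (1 + |y|) ^ 2 := by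
  rw [abs_mul]
  gcongr
  nlinarith [abs_nonneg y]

lemma gammaWeight_nonneg (m : ℕ) {u : ℝ} (hu : 0 ≤ u) : 0 ≤ gammaWeight m u := by
  unfold gammaWeight; positivity

lemma rapidDecay_gammaWeight (m : ℕ) : RapidDecay (gammaWeight m) := by
  refine ⟨(m + 3).factorial, by positivity, fun u hu => ?_⟩
  rw [abs_of_nonneg (gammaWeight_nonneg m hu.le)]
  have hfac : (1 : ℝ) ≤ (m + 3).factorial := by exact_mod_cast Nat.factorial_pos _
  rcases le_total u 1 with hu1 | hu1
  · have h1 : gammaWeight m u ≤ 1 :=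
      mul_le_one₀ (pow_le_one₀ hu.le hu1) (by positivity) (Real.exp_le_one_iff.2 (by linarith))
    constructor
    · exact h1.trans (one_le_mul_of_one_le_of_one_le hfac
        (Real.one_le_rpow_of_pos_of_le_one_of_nonpos hu hu1 (by norm_num)))
    · exact h1.trans (one_le_mul_of_one_le_of_one_le hfac
        (Real.one_le_rpow_of_pos_of_le_one_of_nonpos hu hu1 (by norm_num)))
  · have h3 : gammaWeight m u ≤ (m + 3).factorial * u ^ (-3 : ℝ) := by
      have := Real.pow_div_factorial_le_exp u hu.le (m + 3)
      rw [div_le_iff₀ (by positivity)] at this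
      have e : u ^ (-3 : ℝ) = (u ^ 3)⁻¹ := by rw [Real.rpow_neg hu.le]; norm_cast
      rw [gammaWeight, e, Real.exp_neg, ← div_eq_mul_inv, ← div_eq_mul_inv,
        div_le_div_iff₀ (Real.exp_pos _) (by positivity), ← pow_add]
      linarith
    refine ⟨h3.trans ?_, h3⟩
    exact mul_le_mul_of_nonneg_left
      (Real.rpow_le_rpow_of_exponent_le hu1 (by norm_num)) (by positivity)

lemma linearlyBounded_mangoldt_nonprime : ∃ K : ℝ,
    LinearlyBounded (fun n : ℕ+ => (n : ℝ))
      (fun n => if (n : ℕ).Prime then 0 else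
        ArithmeticFunction.vonMangoldt n * Real.log n) K := by
  obtain ⟨c, hc⟩ := Chebyshev.psi_sub_theta_le_mul_sqrt
  refine ⟨2 * |c|, ⟨fun n => by exact_mod_cast n.pos, fun n => ?_, fun s x hx hs => ?_⟩⟩
  · split_ifs
    · exact le_rfl
    · exact mul_nonneg ArithmeticFunction.vonMangoldt_nonneg (Real.log_natCast_nonneg _)
  · rcases lt_or_ge x 1 with hx1 | hx1
    · have : s = ∅ := by
        refine Finset.eq_empty_of_forall_notMem fun n hn => ?_
        have h1 := hs n hn
        have h2 : (1 : ℝ) ≤ (n : ℕ) := by exact_mod_cast n.pos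
        linarith
      rw [this, Finset.sum_empty]; positivity
    have hlog := Real.log_nonneg hx1
    have hpsi : Chebyshev.psi x - Chebyshev.theta x = ∑ n ∈ Finset.Ioc 0 ⌊x⌋₊,
        if n.Prime then 0 else ArithmeticFunction.vonMangoldt n := by
      rw [Chebyshev.psi, Chebyshev.theta, Finset.sum_filter, ← Finset.sum_sub_distrib]
      refine Finset.sum_congr rfl fun n _ => ?_
      split_ifs with hp
      · rw [ArithmeticFunction.vonMangoldt_apply_prime hp, sub_self]
      · rw [sub_zero]
    have h1 : ∑ i ∈ s, (if (i : ℕ).Prime then (0 : ℝ) else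
        ArithmeticFunction.vonMangoldt i * Real.log (i : ℕ)) ≤
        ∑ i ∈ s, (if (i : ℕ).Prime then 0 else ArithmeticFunction.vonMangoldt i) * Real.log x := by
      refine Finset.sum_le_sum fun n hn => ?_
      split_ifs
      · simp
      · exact mul_le_mul_of_nonneg_left
          (Real.log_le_log (by exact_mod_cast n.pos) (hs n hn))
          ArithmeticFunction.vonMangoldt_nonneg
    have h2 : ∑ i ∈ s, (if (i : ℕ).Prime then (0 : ℝ) else ArithmeticFunction.vonMangoldt i)
        ≤ Chebyshev.psi x - Chebyshev.theta x := by
      rw [hpsi]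
      refine (Finset.sum_map s ⟨fun n : ℕ+ => (n : ℕ), PNat.coe_injective⟩
        (fun n : ℕ => if n.Prime then (0 : ℝ) else
          ArithmeticFunction.vonMangoldt n)).symm.le.trans ?_
      refine Finset.sum_le_sum_of_subset_of_nonneg (fun n hn => ?_) fun n _ _ => ?_
      · obtain ⟨k, hk, rfl⟩ := Finset.mem_map.1 hn
        exact Finset.mem_Ioc.2 ⟨k.pos, Nat.le_floor (hs k hk)⟩
      · split_ifs
        · exact le_rfl
        · exact ArithmeticFunction.vonMangoldt_nonneg
    have h3 : Real.log x ≤ 2 * √x := by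
      have := Real.log_le_rpow_div hx (show (0 : ℝ) < 1 / 2 by norm_num)
      rw [← Real.sqrt_eq_rpow] at this
      linarith
    rw [← Finset.sum_mul] at h1
    have h4 : Chebyshev.psi x - Chebyshev.theta x ≤ |c| * √x :=
      (hc x).trans (by gcongr; exact le_abs_self c)
    calc _ ≤ _ := h1
      _ ≤ (|c| * √x) * (2 * √x) := by
        refine mul_le_mul (h2.trans h4) h3 hlog (by positivity)
      _ = 2 * |c| * (√x * √x) := by ring
      _ = _ := by rw [Real.mul_self_sqrt hx]

lemma integral_gammaWeight (m : ℕ) : ∫ u in Set.Ioi 0, gammaWeight m u = m.factorial := by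
  rw [← Real.Gamma_nat_eq_factorial, Real.Gamma_eq_integral (by positivity)]
  refine MeasureTheory.setIntegral_congr_fun measurableSet_Ioi fun x hx => ?_
  simp [gammaWeight, mul_comm]

lemma integrableOn_gammaWeight (m : ℕ) :
    MeasureTheory.IntegrableOn (gammaWeight m) (Set.Ioi 0) := by
  refine (Real.GammaIntegral_convergent (s := m + 1) (by positivity)).congr_fun (fun x hx => ?_)
    measurableSet_Ioi
  simp [gammaWeight, mul_comm]

lemma gammaWeight_le_factorial (m : ℕ) {u : ℝ} (hu : 0 ≤ u) : gammaWeight m u ≤ m.factorial := by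
  have := Real.pow_div_factorial_le_exp u hu m
  rw [div_le_iff₀ (by positivity)] at this
  rw [gammaWeight, Real.exp_neg, ← div_eq_mul_inv, div_le_iff₀ (Real.exp_pos _)]
  linarith

lemma exists_gammaWeight_le (m : ℕ) : ∃ C : ℝ, 0 ≤ C ∧
    ∀ u : ℝ, 0 ≤ u → gammaWeight m u ≤ C * ((1 + u) ^ 2)⁻¹ := by
  refine ⟨m.factorial + 2 * (m + 1).factorial + (m + 2).factorial, by positivity, fun u hu => ?_⟩
  rw [← div_eq_mul_inv, le_div_iff₀ (by positivity)]
  have h0 := gammaWeight_le_factorial m hu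
  have h1 := gammaWeight_le_factorial (m + 1) hu
  have h2 := gammaWeight_le_factorial (m + 2) hu
  have e : gammaWeight m u * (1 + u) ^ 2
      = gammaWeight m u + 2 * gammaWeight (m + 1) u + gammaWeight (m + 2) u := by
    simp only [gammaWeight]; ring
  linarith

lemma hasDerivAt_gammaWeight (m : ℕ) (u : ℝ) : HasDerivAt (gammaWeight m)
    (m * gammaWeight (m - 1) u - gammaWeight m u) u := by
  have h1 := (hasDerivAt_pow m u).mul ((hasDerivAt_neg u).exp)
  refine h1.congr_deriv ?_
  simp only [gammaWeight]; ring

lemma exists_abs_deriv_gammaWeight_le (m : ℕ) : ∃ C : ℝ, 0 ≤ C ∧ ∀ u : ℝ, 0 ≤ u →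
    |m * gammaWeight (m - 1) u - gammaWeight m u| ≤ C * ((1 + u) ^ 2)⁻¹ := by
  obtain ⟨C, hC, h⟩ := exists_gammaWeight_le m
  obtain ⟨D, hD, h'⟩ := exists_gammaWeight_le (m - 1)
  refine ⟨m * D + C, by positivity, fun u hu => ?_⟩
  refine (abs_sub _ _).trans ?_
  rw [abs_mul, abs_of_nonneg (gammaWeight_nonneg _ hu), abs_of_nonneg (gammaWeight_nonneg _ hu),
    Nat.abs_cast, add_mul, mul_assoc]
  gcongr
  · exact h' u hu
  · exact h u hu

lemma sum_range_inv_sq_le {Y : ℝ} (hY : 0 < Y) (N : ℕ) :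
    ∑ n ∈ Finset.range N, ((1 + n / Y) ^ 2)⁻¹ ≤ 1 + Y := by
  have key : ∀ N : ℕ, ∑ n ∈ Finset.range (N + 1), ((1 + n / Y) ^ 2)⁻¹
      ≤ 1 + Y - Y / (1 + N / Y) := by
    intro N
    induction N with
    | zero => simp
    | succ N ih =>
      rw [Finset.sum_range_succ]
      set a := 1 + N / Y with ha
      have ha0 : 0 < a := by positivity
      have hb : 1 + ((N + 1 : ℕ) : ℝ) / Y = a + 1 / Y := by rw [ha]; push_cast; ring
      rw [hb]
      set b := a + 1 / Y with hb'
      have hab : a ≤ b := by rw [hb']; linarith [show 0 < 1 / Y by positivity]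
      have hb0 : 0 < b := by linarith
      have h1 : Y / a - Y / b = (a * b)⁻¹ := by
        have : Y * (b - a) = 1 := by rw [hb']; field_simp; ring
        rw [div_sub_div _ _ ha0.ne' hb0.ne', show Y * b - a * Y = 1 by linarith, one_div]
      have h2 : (b ^ 2)⁻¹ ≤ (a * b)⁻¹ := by
        apply inv_anti₀ (by positivity)
        nlinarith
      linarith
  cases N with
  | zero => simp; linarith
  | succ N =>
    have : 0 ≤ Y / (1 + N / Y) := by positivity
    linarith [key N]

lemma summable_gammaWeight_pnat (m : ℕ) {Y : ℝ} (hY : 0 < Y) :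
    Summable fun n : ℕ+ => gammaWeight m ((n : ℕ) / Y) := by
  obtain ⟨C, hC, h⟩ := (rapidDecay_gammaWeight m).tsum_le linearlyBounded_pnat
  simpa using (h Y hY (fun n => gammaWeight m ((n : ℕ) / Y))
    (fun n => le_mul_one_add_abs_sq _ _)).1

lemma abs_tsum_gammaWeight_sub_le (m : ℕ) : ∃ C : ℝ, 0 ≤ C ∧ ∀ Y : ℝ, 1 ≤ Y →
    |∑' n : ℕ+, gammaWeight m ((n : ℕ) / Y) - m.factorial * Y| ≤ C := by
  obtain ⟨C, hC, hd⟩ := exists_abs_deriv_gammaWeight_le m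
  refine ⟨C * 2, by positivity, fun Y hY => ?_⟩
  have hY0 : 0 < Y := by linarith
  have hcont : Continuous (gammaWeight m) :=
    continuous_iff_continuousAt.2 fun u => (hasDerivAt_gammaWeight m u).continuousAt
  have hsm := summable_gammaWeight_pnat m hY0
  rw [tsum_pnat_eq_tsum_succ (f := fun n : ℕ => gammaWeight m (n / Y))]
  have hsm' : Summable fun n : ℕ => gammaWeight m ((n + 1 : ℕ) / Y) :=
    (summable_pnat_iff_summable_succ (f := fun n : ℕ => gammaWeight m (n / Y))).1 hsm
  have lim1 := hsm'.tendsto_sum_tsum_nat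
  have lim2 : Tendsto (fun N : ℕ => ∫ x in (0 : ℝ)..N, gammaWeight m (x / Y)) atTop
      (𝓝 (m.factorial * Y)) := by
    have h1 := MeasureTheory.intervalIntegral_tendsto_integral_Ioi 0 (integrableOn_gammaWeight m)
      (tendsto_natCast_atTop_atTop.atTop_div_const hY0)
    rw [integral_gammaWeight] at h1
    have h2 := h1.const_mul Y
    rw [mul_comm] at h2
    refine h2.congr fun N => ?_
    rw [intervalIntegral.integral_comp_div _ hY0.ne', zero_div, smul_eq_mul]
  refine le_of_tendsto (lim1.sub lim2).abs (Eventually.of_forall fun N => ?_)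
  have hii : ∀ a b : ℝ, IntervalIntegrable (fun x => gammaWeight m (x / Y))
      MeasureTheory.volume a b := fun a b => (by fun_prop : Continuous _).intervalIntegrable a b
  have hsum : ∫ x in (0 : ℝ)..N, gammaWeight m (x / Y) =
      ∑ n ∈ Finset.range N, ∫ x in (n : ℝ)..(n + 1 : ℕ), gammaWeight m (x / Y) := by
    have := intervalIntegral.sum_integral_adjacent_intervals (a := fun n : ℕ => (n : ℝ)) (n := N)
      (f := fun x => gammaWeight m (x / Y)) (μ := MeasureTheory.volume) (fun k _ => hii _ _)
    simpa using this.symm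
  rw [hsum, ← Finset.sum_sub_distrib]
  refine (Finset.abs_sum_le_sum_abs _ _).trans ?_
  have hterm : ∀ n : ℕ, |gammaWeight m ((n + 1 : ℕ) / Y)
      - ∫ x in (n : ℝ)..(n + 1 : ℕ), gammaWeight m (x / Y)| ≤ C / Y * ((1 + n / Y) ^ 2)⁻¹ := by
    intro n
    have hn0 : (0 : ℝ) ≤ n := Nat.cast_nonneg n
    have e : gammaWeight m ((n + 1 : ℕ) / Y)
      - ∫ x in (n : ℝ)..(n + 1 : ℕ), gammaWeight m (x / Y)
      = ∫ x in (n : ℝ)..(n + 1 : ℕ),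
        (gammaWeight m ((n + 1 : ℕ) / Y) - gammaWeight m (x / Y)) := by
      rw [intervalIntegral.integral_sub (by simp) (hii _ _)]
      simp
    rw [e]
    have := intervalIntegral.norm_integral_le_of_norm_le_const (a := (n : ℝ)) (b := (n + 1 : ℕ))
      (f := fun x => gammaWeight m ((n + 1 : ℕ) / Y) - gammaWeight m (x / Y))
      (C := C / Y * ((1 + n / Y) ^ 2)⁻¹) (fun x hx => ?_)
    · simpa using this
    · rw [Set.uIoc_of_le (by simp)] at hx
      have hmv := (convex_Ici ((n : ℝ) / Y)).norm_image_sub_le_of_norm_hasDerivWithin_le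
        (f := gammaWeight m) (C := C * ((1 + n / Y) ^ 2)⁻¹)
        (fun u _ => (hasDerivAt_gammaWeight m u).hasDerivWithinAt) (fun u hu => by
          have hu' : (n : ℝ) / Y ≤ u := hu
          have hu0 : 0 ≤ u := le_trans (by positivity) hu'
          refine (hd u hu0).trans ?_
          gcongr)
        (x := x / Y) (y := (n + 1 : ℕ) / Y)
        (by simp only [Set.mem_Ici]; gcongr; exact hx.1.le)
        (by simp only [Set.mem_Ici]; gcongr; simp)
      refine hmv.trans ?_
      have h5 : ‖((n + 1 : ℕ) : ℝ) / Y - x / Y‖ ≤ 1 / Y := by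
        rw [← sub_div, norm_div, Real.norm_of_nonneg hY0.le, Real.norm_eq_abs]
        gcongr
        have h6 := hx.1
        have h7 := hx.2
        push_cast at h7 ⊢
        rw [abs_of_nonneg (by linarith)]
        linarith
      calc _ ≤ C * ((1 + n / Y) ^ 2)⁻¹ * (1 / Y) := by gcongr
        _ = _ := by ring
  calc _ ≤ ∑ n ∈ Finset.range N, C / Y * ((1 + n / Y) ^ 2)⁻¹ :=
        Finset.sum_le_sum fun n _ => hterm n
    _ = C / Y * ∑ n ∈ Finset.range N, ((1 + n / Y) ^ 2)⁻¹ := by rw [Finset.mul_sum]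
    _ ≤ C / Y * (1 + Y) := by gcongr; exact sum_range_inv_sq_le hY0 N
    _ ≤ C / Y * (2 * Y) := by gcongr; linarith
    _ = C * 2 := by field_simp

/-- The Chebyshev-type sum `∑ₚ log p · f (p / Y)`. -/
def primeSum (f : ℝ → ℝ) (Y : ℝ) : ℝ := ∑' p : Nat.Primes, Real.log p * f (p / Y)

lemma log_eq_log_add_log_div {x Y : ℝ} (hx : 0 < x) (hY : 0 < Y) :
    Real.log x = Real.log Y + Real.log (x / Y) := by
  rw [Real.log_div hx.ne' hY.ne']; ring

lemma RapidDecay.tsum_le' {ι : Type*} {N a : ι → ℝ} {K : ℝ} (h : LinearlyBounded N a K)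
    {f : ℝ → ℝ} (hf : RapidDecay f) :
    ∃ C : ℝ, 0 ≤ C ∧ ∀ Y : ℝ, 0 < Y →
      Summable (fun i => a i * f (N i / Y)) ∧ |∑' i, a i * f (N i / Y)| ≤ C * Y ∧
      Summable (fun i => a i * (Real.log (N i) * f (N i / Y))) ∧
      |∑' i, a i * (Real.log (N i) * f (N i / Y)) - Real.log Y * ∑' i, a i * f (N i / Y)|
        ≤ C * Y := by
  obtain ⟨C, hC, h'⟩ := hf.tsum_le h
  refine ⟨C, hC, fun Y hY => ?_⟩
  obtain ⟨s1, b1⟩ := h' Y hY (fun i => f (N i / Y)) (fun i => le_mul_one_add_abs_sq _ _)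
  obtain ⟨s2, b2⟩ := h' Y hY (fun i => f (N i / Y) * Real.log (N i / Y))
    (fun i => mul_abs_le_mul_one_add_abs_sq _ _)
  have e : ∀ i, a i * (Real.log (N i) * f (N i / Y)) =
      Real.log Y * (a i * f (N i / Y)) + a i * (f (N i / Y) * Real.log (N i / Y)) := by
    intro i
    rw [log_eq_log_add_log_div (h.pos i) hY]; ring
  refine ⟨s1, b1, ?_, ?_⟩
  · simp_rw [e]; exact (s1.mul_left _).add s2
  · simp_rw [e]
    rw [(s1.mul_left _).tsum_add s2, tsum_mul_left, add_sub_cancel_left]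
    exact b2

lemma abs_le_of_mangoldt_split {T A P Q S L lY mY C1 C2 C3 C4 C5 Y : ℝ}
    (hT : T = A + P - Q) (hTb : |T| ≤ C1 * Y) (hP : |P| ≤ C2 * Y)
    (hQ : |Q - lY * S| ≤ C3 * Y) (hS : |lY * (S - mY)| ≤ C4 * Y)
    (hA : |A - lY * L| ≤ C5 * Y) :
    |lY * (L - mY)| ≤ (C1 + C2 + C3 + C4 + C5) * Y := by
  have : lY * (L - mY) = T - P + (Q - lY * S) + lY * (S - mY) - (A - lY * L) := by
    rw [hT]; ring
  rw [this]
  rw [abs_le] at *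
  constructor <;> nlinarith

/-- The prime number theorem with a smooth weight and a logarithmic saving. -/
theorem abs_primeSum_gammaWeight_sub_le (m : ℕ) : ∃ C : ℝ, 0 ≤ C ∧ ∀ Y : ℝ, 0 < Y →
    (1 + Real.posLog Y) * |primeSum (gammaWeight m) Y - m.factorial * Y| ≤ C * Y := by
  obtain ⟨C1, hC1, hT⟩ := abs_tsum_mangoldtError_le m
  obtain ⟨K, hK⟩ := linearlyBounded_mangoldt_nonprime
  obtain ⟨C2, hC2, hP⟩ := (rapidDecay_gammaWeight m).tsum_le' hK
  obtain ⟨C3, hC3, hQ⟩ := (rapidDecay_gammaWeight m).tsum_le' linearlyBounded_pnat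
  obtain ⟨C4, hC4, hS⟩ := abs_tsum_gammaWeight_sub_le m
  obtain ⟨C5, hC5, hA⟩ := (rapidDecay_gammaWeight m).tsum_le' linearlyBounded_log_primes
  have htriv : ∀ Y : ℝ, 0 < Y →
      |primeSum (gammaWeight m) Y - m.factorial * Y| ≤ (C5 + m.factorial) * Y := by
    intro Y hY
    have h1 := (hA Y hY).2.1
    refine (abs_sub _ _).trans ?_
    rw [add_mul, abs_of_nonneg (by positivity : 0 ≤ (m.factorial : ℝ) * Y)]
    exact add_le_add_left h1 _
  refine ⟨(C5 + m.factorial) + (C1 + C2 + C3 + C4 + C5), by positivity, fun Y hY => ?_⟩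
  rcases le_total Y 1 with hY1 | hY1
  · have : Real.posLog Y = 0 := by
      rw [Real.posLog_eq_zero_iff, abs_of_pos hY]; exact hY1
    rw [this, add_zero, one_mul]
    have : 0 ≤ C1 + C2 + C3 + C4 + C5 := by positivity
    exact (htriv Y hY).trans (mul_le_mul_of_nonneg_right (by linarith) hY.le)
  · have hlog := Real.log_nonneg hY1
    rw [Real.posLog_eq_log (by rwa [abs_of_pos hY]), add_mul, one_mul, add_mul]
    refine add_le_add (htriv Y hY) ?_
    set w := gammaWeight m
    obtain ⟨sP, bP, -, -⟩ := hP Y hY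
    obtain ⟨-, -, sQ, bQ⟩ := hQ Y hY
    obtain ⟨-, -, sA, bA⟩ := hA Y hY
    simp only [one_mul] at sQ bQ
    set F1 : ℕ → ℝ := fun n => Real.log n * w (n / Y) with hF1
    set F2 : ℕ → ℝ := fun n => (if n.Prime then 0 else
        ArithmeticFunction.vonMangoldt n * Real.log n) * w (n / Y) with hF2
    set F3 : ℕ → ℝ := fun n => if n.Prime then Real.log n * (Real.log n * w (n / Y)) else 0
      with hF3
    have u1 : Function.support F1 ⊆ Set.range ((↑) : ℕ+ → ℕ) := by
      intro n hn
      have : n ≠ 0 := by rintro rfl; simp [hF1] at hn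
      exact ⟨⟨n, Nat.pos_of_ne_zero this⟩, rfl⟩
    have u2 : Function.support F2 ⊆ Set.range ((↑) : ℕ+ → ℕ) := by
      intro n hn
      have : n ≠ 0 := by rintro rfl; simp [hF2] at hn
      exact ⟨⟨n, Nat.pos_of_ne_zero this⟩, rfl⟩
    have u3 : Function.support F3 ⊆ Set.range ((↑) : Nat.Primes → ℕ) := by
      intro n hn
      have : n.Prime := by by_contra h; simp [hF3, h] at hn
      exact ⟨⟨n, this⟩, rfl⟩
    have e3 : ∀ p : Nat.Primes, F3 p = Real.log p * (Real.log p * w (p / Y)) := by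
      intro p; simp only [hF3, p.2, if_true]
    have s1 : Summable F1 :=
      (PNat.coe_injective.summable_iff fun n hn => by
        by_contra h; exact hn (u1 h)).1 sQ
    have s2 : Summable F2 :=
      (PNat.coe_injective.summable_iff fun n hn => by
        by_contra h; exact hn (u2 h)).1 sP
    have s3 : Summable F3 :=
      (Nat.Primes.coe_nat_injective.summable_iff fun n hn => by
        by_contra h; exact hn (u3 h)).1 (sA.congr fun p => (e3 p).symm)
    have t1 := PNat.coe_injective.tsum_eq u1
    have t2 := PNat.coe_injective.tsum_eq u2
    have t3 : ∑' p : Nat.Primes, Real.log p * (Real.log p * w (p / Y)) = ∑' n, F3 n := by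
      rw [← Nat.Primes.coe_nat_injective.tsum_eq u3]
      exact tsum_congr fun p => (e3 p).symm
    have hpt : ∀ n : ℕ, mangoldtError n * w (n / Y) = F3 n + F2 n - F1 n := by
      intro n
      simp only [hF1, hF2, hF3, mangoldtError]
      split_ifs with hp
      · rw [ArithmeticFunction.vonMangoldt_apply_prime hp]; ring
      · ring
    have hTsum : ∑' n : ℕ, mangoldtError n * w (n / Y) = ∑' n, F3 n + ∑' n, F2 n - ∑' n, F1 n := by
      simp_rw [hpt]
      rw [(s3.add s2).tsum_sub s1, s3.tsum_add s2]
    rw [← t1, ← t2, ← t3] at hTsum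
    have hS' : |Real.log Y * (∑' n : ℕ+, w ((n : ℕ) / Y) - m.factorial * Y)| ≤ C4 * Y := by
      rw [abs_mul, abs_of_nonneg hlog, mul_comm]
      exact mul_le_mul (hS Y hY1) ((Real.log_le_sub_one_of_pos hY).trans (by linarith)) hlog hC4
    have := abs_le_of_mangoldt_split hTsum (hT Y hY) bP bQ hS' bA
    rwa [abs_mul, abs_of_nonneg hlog] at this

/-- The weight `∑_j (1/j) w_m(j u)` where `w_m = gammaWeight m`. -/
def logWeight (m : ℕ) (u : ℝ) : ℝ := ∑' j : ℕ+, 1 / (j : ℝ) * gammaWeight m (j * u)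

lemma summable_pnat_rpow {s : ℝ} (hs : s < -1) : Summable fun j : ℕ+ => (j : ℝ) ^ s :=
  (Real.summable_nat_rpow.2 hs).comp_injective PNat.coe_injective

lemma RapidDecay.logWeight_aux {w : ℝ → ℝ} {B s : ℝ} (hs : s < 0)
    (hw : ∀ u : ℝ, 0 < u → |w u| ≤ B * u ^ s) {u : ℝ} (hu : 0 < u) :
    Summable (fun j : ℕ+ => 1 / (j : ℝ) * w (j * u)) ∧
      |∑' j : ℕ+, 1 / (j : ℝ) * w (j * u)| ≤ (B * ∑' j : ℕ+, (j : ℝ) ^ (s - 1)) * u ^ s := by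
  have hj : ∀ j : ℕ+, (0 : ℝ) < j := fun j => by exact_mod_cast j.pos
  have hb : ∀ j : ℕ+, ‖1 / (j : ℝ) * w (j * u)‖ ≤ (B * u ^ s) * (j : ℝ) ^ (s - 1) := by
    intro j
    rw [Real.norm_eq_abs, abs_mul, abs_of_pos (by have := hj j; positivity)]
    calc _ ≤ 1 / (j : ℝ) * (B * (j * u) ^ s) := by
          have := hj j
          exact mul_le_mul_of_nonneg_left (hw _ (by positivity)) (by positivity)
      _ = _ := by
          rw [Real.mul_rpow (hj j).le hu.le, Real.rpow_sub_one (hj j).ne']; ring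
  have hsum := (summable_pnat_rpow (s := s - 1) (by linarith)).mul_left (B * u ^ s)
  refine ⟨Summable.of_norm_bounded hsum hb, ?_⟩
  have := tsum_of_norm_bounded hsum.hasSum hb
  rw [tsum_mul_left, Real.norm_eq_abs] at this
  linarith

lemma rapidDecay_logWeight (m : ℕ) : RapidDecay (logWeight m) := by
  obtain ⟨C, hC, h⟩ := rapidDecay_gammaWeight m
  set A := ∑' j : ℕ+, (j : ℝ) ^ (-(1 / 4 : ℝ) - 1)
  set A' := ∑' j : ℕ+, (j : ℝ) ^ ((-3 : ℝ) - 1)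
  have hA : 0 ≤ A := tsum_nonneg fun j => by positivity
  have hA' : 0 ≤ A' := tsum_nonneg fun j => by positivity
  refine ⟨C * A + C * A', by positivity, fun u hu => ⟨?_, ?_⟩⟩
  · refine (RapidDecay.logWeight_aux (by norm_num) (fun u hu => (h u hu).1) hu).2.trans ?_
    exact mul_le_mul_of_nonneg_right (le_add_of_nonneg_right (by positivity)) (by positivity)
  · refine (RapidDecay.logWeight_aux (by norm_num) (fun u hu => (h u hu).2) hu).2.trans ?_
    exact mul_le_mul_of_nonneg_right (le_add_of_nonneg_left (by positivity)) (by positivity)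

lemma primeSum_logWeight (m : ℕ) {Y : ℝ} (hY : 0 < Y) :
    Summable (fun j : ℕ+ => 1 / (j : ℝ) * primeSum (gammaWeight m) (Y / j)) ∧
    primeSum (logWeight m) Y = ∑' j : ℕ+, 1 / (j : ℝ) * primeSum (gammaWeight m) (Y / j) := by
  obtain ⟨C, hC, h⟩ := (rapidDecay_gammaWeight m).tsum_le' linearlyBounded_log_primes
  have hj : ∀ j : ℕ+, (0 : ℝ) < j := fun j => by exact_mod_cast j.pos
  have hlog : ∀ p : Nat.Primes, 0 ≤ Real.log p := fun p =>
    Real.log_nonneg (by exact_mod_cast p.2.one_lt.le)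
  have hw : ∀ (j : ℕ+) (p : Nat.Primes), 0 ≤ gammaWeight m (p / (Y / j)) := fun j p =>
    gammaWeight_nonneg m (by have := hj j; positivity)
  have s1 : Summable (fun j : ℕ+ => 1 / (j : ℝ) * primeSum (gammaWeight m) (Y / j)) := by
    refine Summable.of_nonneg_of_le (fun j => mul_nonneg (by positivity)
      (tsum_nonneg fun p => mul_nonneg (hlog p) (hw j p))) (fun j => ?_)
      ((summable_pnat_rpow (s := -2) (by norm_num)).mul_left (C * Y))
    have hj' := hj j
    have := (le_abs_self _).trans (h (Y / j) (by positivity)).2.1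
    calc _ ≤ 1 / (j : ℝ) * (C * (Y / j)) := mul_le_mul_of_nonneg_left this (by positivity)
      _ = _ := by rw [Real.rpow_neg hj'.le, Real.rpow_two]; field_simp
  refine ⟨s1, ?_⟩
  have s2 : Summable (Function.uncurry fun (j : ℕ+) (p : Nat.Primes) =>
      1 / (j : ℝ) * (Real.log p * gammaWeight m (p / (Y / j)))) := by
    refine (summable_prod_of_nonneg fun x => ?_).2 ⟨fun j => ?_, ?_⟩
    · exact mul_nonneg (by positivity) (mul_nonneg (hlog _) (hw _ _))
    · exact ((h (Y / j) (div_pos hY (hj j))).1).mul_left (1 / (j : ℝ))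
    · simpa only [Function.uncurry, tsum_mul_left, primeSum] using s1
  have := s2.tsum_comm
  simp only [tsum_mul_left] at this
  rw [show (∑' j : ℕ+, 1 / (j : ℝ) * primeSum (gammaWeight m) (Y / j)) = _ from this.symm]
  refine tsum_congr fun p => ?_
  rw [logWeight, ← tsum_mul_left]
  refine tsum_congr fun j => ?_
  rw [show (j : ℝ) * (p / Y) = p / (Y / j) by have := hj j; field_simp]
  ring

lemma one_add_posLog_le (Y : ℝ) (j : ℕ+) :
    1 + Real.posLog Y ≤ (1 + Real.posLog (Y / j)) * (3 * (j : ℝ) ^ (1 / 2 : ℝ)) := by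
  have hj : (1 : ℝ) ≤ j := by exact_mod_cast j.pos
  have h0 := Real.posLog_nonneg (x := Y / j)
  have h1 : Real.posLog Y ≤ Real.posLog (Y / j) + Real.log j := by
    have := Real.posLog_mul (x := Y / j) (y := j)
    rwa [div_mul_cancel₀ _ (by positivity), Real.posLog_eq_log (x := (j : ℝ))
      (by rwa [abs_of_pos (by positivity)])] at this
  have h2 : Real.log j ≤ 2 * (j : ℝ) ^ (1 / 2 : ℝ) := by
    have := Real.log_le_rpow_div (x := (j : ℝ)) (by positivity) (ε := 1 / 2) (by norm_num)
    linarith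
  have h3 : 1 ≤ (j : ℝ) ^ (1 / 2 : ℝ) := Real.one_le_rpow hj (by norm_num)
  nlinarith

theorem abs_primeSum_logWeight_sub_le (m : ℕ) : ∃ C : ℝ, 0 ≤ C ∧ ∀ Y : ℝ, 0 < Y →
    (1 + Real.posLog Y) *
      |primeSum (logWeight m) Y - m.factorial * (∑' j : ℕ+, (j : ℝ) ^ (-2 : ℝ)) * Y| ≤ C * Y := by
  obtain ⟨C, hC, h⟩ := abs_primeSum_gammaWeight_sub_le m
  have hj : ∀ j : ℕ+, (0 : ℝ) < j := fun j => by exact_mod_cast j.pos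
  set A := ∑' j : ℕ+, (j : ℝ) ^ (-(3 / 2) : ℝ)
  have hA : 0 ≤ A := tsum_nonneg fun j => by positivity
  refine ⟨3 * C * A, by positivity, fun Y hY => ?_⟩
  obtain ⟨s1, e1⟩ := primeSum_logWeight m hY
  have s2 : Summable fun j : ℕ+ => m.factorial * (j : ℝ) ^ (-2 : ℝ) * Y :=
    ((summable_pnat_rpow (s := -2) (by norm_num)).mul_left _).mul_right _
  rw [e1, ← tsum_mul_left, ← tsum_mul_right, ← s1.tsum_sub s2]
  have h1 := Real.posLog_nonneg (x := Y)
  rw [← abs_of_nonneg (by positivity : 0 ≤ 1 + Real.posLog Y), ← abs_mul, ← tsum_mul_left,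
    ← Real.norm_eq_abs]
  have s3 := ((summable_pnat_rpow (s := -(3 / 2)) (by norm_num)).mul_left (3 * C)).mul_right Y
  refine (tsum_of_norm_bounded s3.hasSum fun j => ?_).trans_eq
    (by rw [tsum_mul_right, tsum_mul_left])
  have hj' := hj j
  have e2 : 1 / (j : ℝ) * primeSum (gammaWeight m) (Y / j) - m.factorial * (j : ℝ) ^ (-2 : ℝ) * Y
      = 1 / (j : ℝ) * (primeSum (gammaWeight m) (Y / j) - m.factorial * (Y / j)) := by
    rw [Real.rpow_neg hj'.le, Real.rpow_two]; field_simp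
  rw [e2, Real.norm_eq_abs, abs_mul, abs_mul, abs_of_nonneg (by positivity : 0 ≤ 1 + Real.posLog Y),
    abs_of_pos (by positivity : 0 < 1 / (j : ℝ))]
  set D := |primeSum (gammaWeight m) (Y / j) - m.factorial * (Y / j)|
  calc _ ≤ ((1 + Real.posLog (Y / j)) * (3 * (j : ℝ) ^ (1 / 2 : ℝ))) * (1 / (j : ℝ) * D) :=
        mul_le_mul_of_nonneg_right (one_add_posLog_le Y j) (by positivity)
    _ = (3 * (j : ℝ) ^ (1 / 2 : ℝ) * (1 / j)) * ((1 + Real.posLog (Y / j)) * D) := by ring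
    _ ≤ (3 * (j : ℝ) ^ (1 / 2 : ℝ) * (1 / j)) * (C * (Y / j)) :=
        mul_le_mul_of_nonneg_left (h _ (by positivity)) (by positivity)
    _ = _ := by
        rw [show (-(3 / 2) : ℝ) = 1 / 2 - 1 - 1 by norm_num, Real.rpow_sub_one hj'.ne',
          Real.rpow_sub_one hj'.ne']
        field_simp

lemma zeta2_eq_tsum : zeta2 = ∑' j : ℕ+, (j : ℝ) ^ (-2 : ℝ) := by
  rw [zeta2, riemannZeta_two, tsum_pnat_eq_tsum_succ (f := fun n : ℕ => (n : ℝ) ^ (-2 : ℝ))]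
  have h := hasSum_zeta_two
  rw [← hasSum_nat_add_iff' 1] at h
  simp only [Finset.range_one, Finset.sum_singleton, Nat.cast_zero, ne_eq, OfNat.ofNat_ne_zero,
    not_false_eq_true, zero_pow, div_zero, sub_zero] at h
  have e : ((π : ℂ) ^ 2 / 6).re = π ^ 2 / 6 := by
    rw [← Complex.ofReal_re (π ^ 2 / 6)]; push_cast; rfl
  rw [e, ← h.tsum_eq]
  refine tsum_congr fun n => ?_
  rw [Real.rpow_neg (by positivity), Real.rpow_two, one_div]

lemma log_two_le_log_prime (p : Nat.Primes) : Real.log 2 ≤ Real.log p :=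
  Real.log_le_log (by norm_num) (by exact_mod_cast p.2.two_le)

lemma one_le_log_prime_div (p : Nat.Primes) : 1 ≤ 2 * Real.log p := by
  have := log_two_le_log_prime p
  have := Real.log_two_gt_d9
  linarith

lemma prime_pos (p : Nat.Primes) : (0 : ℝ) < p := by exact_mod_cast p.2.pos

lemma RapidDecay.tsum_primes_le {f : ℝ → ℝ} (hf : RapidDecay f) :
    ∃ C : ℝ, 0 ≤ C ∧ ∀ X : ℝ, 1 < X → ∀ g : Nat.Primes → ℝ,
      (∀ p : Nat.Primes, |g p| ≤ |f (p / X)| * (1 + |Real.log (p / X)|)) →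
      Summable g ∧ |∑' p, g p| ≤ C * (X / Real.log X) := by
  obtain ⟨C, hC, h⟩ := hf.tsum_le linearlyBounded_log_primes
  refine ⟨3 * C, by positivity, fun X hX g hg => ?_⟩
  have hl := Real.log_pos hX
  have hX0 : 0 < X := by linarith
  obtain ⟨s, b⟩ := h X hX0 (fun p => |f (p / X)| * (1 + |Real.log (p / X)|) ^ 2)
    (fun p => (abs_of_nonneg (by positivity)).le)
  have hb : ∀ p : Nat.Primes, ‖g p‖ ≤ 3 / Real.log X *
      (Real.log p * (|f (p / X)| * (1 + |Real.log (p / X)|) ^ 2)) := by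
    intro p
    refine (hg p).trans ?_
    have h1 := one_le_log_prime_div p
    have h2 : Real.log X ≤ 3 * Real.log p * (1 + |Real.log (p / X)|) := by
      have := log_eq_log_add_log_div (prime_pos p) hX0
      have h3 := neg_abs_le (Real.log (p / X))
      nlinarith [abs_nonneg (Real.log (p / X))]
    rw [div_mul_eq_mul_div, le_div_iff₀ hl]
    calc _ ≤ |f (p / X)| * (1 + |Real.log (p / X)|) *
          (3 * Real.log p * (1 + |Real.log (p / X)|)) := by gcongr
      _ = _ := by ring
  refine ⟨Summable.of_norm_bounded (s.mul_left _) hb, ?_⟩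
  refine (tsum_of_norm_bounded (s.mul_left _).hasSum hb).trans ?_
  rw [tsum_mul_left]
  calc _ ≤ 3 / Real.log X * (C * X) :=
        mul_le_mul_of_nonneg_left ((le_abs_self _).trans b) (by positivity)
    _ = _ := by ring

lemma le_mul_one_add_abs (x y : ℝ) : |x| ≤ |x| * (1 + |y|) :=
  le_mul_of_one_le_right (abs_nonneg _) (by linarith [abs_nonneg y])

/-- `∑ₚ exp (-p / X)`. -/
def primeExpSum (X : ℝ) : ℝ := ∑' p : Nat.Primes, gammaWeight 0 (p / X)

theorem abs_primeExpSum_sub_le : ∃ C : ℝ, 0 ≤ C ∧ ∀ X : ℝ, 1 < X →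
    |primeExpSum X - X / Real.log X| ≤ C * (X / Real.log X ^ 2) := by
  obtain ⟨C1, hC1, h1⟩ := abs_primeSum_gammaWeight_sub_le 0
  obtain ⟨C2, hC2, h2⟩ := (rapidDecay_gammaWeight 0).tsum_primes_le
  refine ⟨C1 + C2, by positivity, fun X hX => ?_⟩
  have hl := Real.log_pos hX
  have hX0 : 0 < X := by linarith
  obtain ⟨s1, -⟩ := h2 X hX (fun p => gammaWeight 0 (p / X)) (fun p => le_mul_one_add_abs _ _)
  obtain ⟨s2, b2⟩ := h2 X hX (fun p => gammaWeight 0 (p / X) * Real.log (p / X)) (fun p => by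
    rw [abs_mul]; gcongr; linarith)
  have e : primeSum (gammaWeight 0) X = Real.log X * primeExpSum X +
      ∑' p : Nat.Primes, gammaWeight 0 (p / X) * Real.log (p / X) := by
    rw [primeExpSum, ← tsum_mul_left, ← (s1.mul_left _).tsum_add s2]
    refine tsum_congr fun p => ?_
    rw [log_eq_log_add_log_div (prime_pos p) hX0]; ring
  have b1 := h1 X hX0
  rw [Real.posLog_eq_log (by rw [abs_of_pos hX0]; exact hX.le), Nat.factorial_zero, Nat.cast_one,
    one_mul] at b1
  set D := ∑' p : Nat.Primes, gammaWeight 0 (p / X) * Real.log (p / X)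
  have e2 : primeExpSum X - X / Real.log X =
      (primeSum (gammaWeight 0) X - X - D) / Real.log X := by
    rw [e]; field_simp; ring
  have b3 : |primeSum (gammaWeight 0) X - X| ≤ C1 * (X / Real.log X) := by
    rw [← mul_div_assoc, le_div_iff₀ hl]
    nlinarith [abs_nonneg (primeSum (gammaWeight 0) X - X)]
  rw [e2, abs_div, abs_of_pos hl, div_le_iff₀ hl]
  refine (abs_sub _ _).trans ((add_le_add b3 b2).trans_eq ?_)
  field_simp

/-- `∑ₚ (1/p) exp (-p / X)`. -/
def primeRecipExpSum (X : ℝ) : ℝ := ∑' p : Nat.Primes, 1 / (p : ℝ) * Real.exp (-(p / X))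

lemma summable_primes_exp {A : ℝ} (hA : 0 < A) :
    Summable fun p : Nat.Primes => Real.exp (-((p : ℝ) / A)) := by
  have : Summable fun n : ℕ => Real.exp (-((n : ℝ) / A)) := by
    have := Real.summable_exp_nat_mul_iff.2 (show -(1 / A) < 0 by
      have : 0 < 1 / A := by positivity
      linarith)
    refine this.congr fun n => ?_
    congr 1; ring
  exact this.comp_injective Nat.Primes.coe_nat_injective

lemma hasDerivAt_primeRecipExpSum {X : ℝ} (hX : 1 < X) :
    HasDerivAt primeRecipExpSum (primeExpSum X / X ^ 2) X := by
  have key : HasDerivAt primeRecipExpSum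
      (∑' p : Nat.Primes, Real.exp (-((p : ℝ) / X)) / X ^ 2) X := by
    refine hasDerivAt_tsum_of_isPreconnected (t := Set.Ioo 1 (X + 1)) (𝕜 := ℝ)
      (g := fun (p : Nat.Primes) X => 1 / (p : ℝ) * Real.exp (-(p / X)))
      (g' := fun (p : Nat.Primes) X => Real.exp (-((p : ℝ) / X)) / X ^ 2)
      (summable_primes_exp (show 0 < X + 1 by linarith)) isOpen_Ioo isPreconnected_Ioo
      (fun p y hy => ?_) (fun p y hy => ?_) (y₀ := X) ⟨hX, by linarith⟩ ?_ ⟨hX, by linarith⟩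
    · have hy0 : y ≠ 0 := by linarith [hy.1]
      have h1 : HasDerivAt (fun y : ℝ => -((p : ℝ) / y)) (p / y ^ 2) y := by
        have := ((hasDerivAt_inv hy0).const_mul (p : ℝ)).neg
        refine (this.congr_deriv ?_).congr_of_eventuallyEq (Eventually.of_forall fun z => ?_)
        · field_simp
        · simp [div_eq_mul_inv]
      refine (h1.exp.const_mul (1 / (p : ℝ))).congr_deriv ?_
      have := (prime_pos p).ne'
      field_simp
    · have := prime_pos p
      have hy1 := hy.1
      rw [Real.norm_of_nonneg (by positivity)]
      refine (div_le_self (by positivity) (by nlinarith)).trans ?_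
      refine Real.exp_le_exp.2 (neg_le_neg ?_)
      gcongr
      exact hy.2.le
    · refine Summable.of_nonneg_of_le (fun p => by positivity) (fun p => ?_)
        (summable_primes_exp (show 0 < X by linarith))
      have : (1 : ℝ) ≤ p := by exact_mod_cast p.2.one_lt.le
      exact mul_le_of_le_one_left (by positivity) (by rwa [div_le_one (by positivity)])
  convert key using 1
  rw [tsum_div_const, primeExpSum]
  simp [gammaWeight]

lemma exists_abs_sub_le_of_deriv {h h' : ℝ → ℝ} {C : ℝ}
    (hd : ∀ x : ℝ, 1 < x → HasDerivAt h (h' x) x)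
    (hb : ∀ x : ℝ, 1 < x → |h' x| ≤ C / (x * Real.log x ^ 2)) :
    ∃ c : ℝ, ∀ x : ℝ, 1 < x → |h x - c| ≤ C / Real.log x := by
  have hlog : ∀ x : ℝ, 1 < x →
      HasDerivAt (fun x => C / Real.log x) (-C / (x * Real.log x ^ 2)) x := by
    intro x hx
    have hl := (Real.log_pos hx).ne'
    have hx0 : x ≠ 0 := by linarith
    refine (((hasDerivAt_const x C).div (Real.hasDerivAt_log hx0) hl)).congr_deriv ?_
    field_simp; ring
  have mono : MonotoneOn (fun x => h x - C / Real.log x) (Set.Ioi 1) := by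
    refine monotoneOn_of_hasDerivWithinAt_nonneg (convex_Ioi 1)
      (f' := fun x => h' x - -C / (x * Real.log x ^ 2)) ?_ ?_ ?_
    · exact fun x hx => ((hd x hx).sub (hlog x hx)).continuousAt.continuousWithinAt
    · intro x hx; rw [interior_Ioi] at hx
      exact ((hd x hx).sub (hlog x hx)).hasDerivWithinAt
    · intro x hx; rw [interior_Ioi] at hx
      have := (abs_le.1 (hb x hx)).1
      rw [neg_div]; linarith
  have anti : AntitoneOn (fun x => h x + C / Real.log x) (Set.Ioi 1) := by
    refine antitoneOn_of_hasDerivWithinAt_nonpos (convex_Ioi 1)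
      (f' := fun x => h' x + -C / (x * Real.log x ^ 2)) ?_ ?_ ?_
    · exact fun x hx => ((hd x hx).add (hlog x hx)).continuousAt.continuousWithinAt
    · intro x hx; rw [interior_Ioi] at hx
      exact ((hd x hx).add (hlog x hx)).hasDerivWithinAt
    · intro x hx; rw [interior_Ioi] at hx
      have := (abs_le.1 (hb x hx)).2
      rw [neg_div]; linarith
  have hC : 0 ≤ C := by
    have h2 := (abs_nonneg _).trans (hb 2 (by norm_num))
    by_contra hneg
    have : C / (2 * Real.log 2 ^ 2) < 0 :=
      div_neg_of_neg_of_pos (not_le.1 hneg)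
        (by have := Real.log_pos (x := 2) (by norm_num); positivity)
    linarith
  have cross : ∀ x y : ℝ, 1 < x → 1 < y → h x - C / Real.log x ≤ h y + C / Real.log y := by
    intro x y hx hy
    have hx' := div_nonneg hC (Real.log_pos hx).le
    have hy' := div_nonneg hC (Real.log_pos hy).le
    rcases le_total x y with hxy | hxy
    · have := mono hx hy hxy
      simp only at this; linarith
    · have := anti hy hx hxy
      simp only at this; linarith
  refine ⟨⨆ x : Set.Ioi (1 : ℝ), (h x - C / Real.log x), fun x hx => ?_⟩
  have hbdd : BddAbove (Set.range fun x : Set.Ioi (1 : ℝ) => h x - C / Real.log x) :=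
    ⟨h 2 + C / Real.log 2, by rintro _ ⟨y, rfl⟩; exact cross _ _ y.2 (by norm_num)⟩
  have h1 := le_ciSup hbdd ⟨x, hx⟩
  have : Nonempty (Set.Ioi (1 : ℝ)) := ⟨⟨2, by norm_num⟩⟩
  have h2 : ⨆ y : Set.Ioi (1 : ℝ), (h y - C / Real.log y) ≤ h x + C / Real.log x :=
    ciSup_le fun y => cross _ _ y.2 hx
  simp only at h1
  rw [abs_le]; constructor <;> linarith

theorem exists_abs_primeRecipExpSum_sub_le : ∃ c C : ℝ, 0 ≤ C ∧ ∀ X : ℝ, 1 < X →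
    |primeRecipExpSum X - Real.log (Real.log X) - c| ≤ C / Real.log X := by
  obtain ⟨C, hC, h⟩ := abs_primeExpSum_sub_le
  obtain ⟨c, hc⟩ := exists_abs_sub_le_of_deriv
    (h := fun X => primeRecipExpSum X - Real.log (Real.log X))
    (h' := fun X => primeExpSum X / X ^ 2 - 1 / X / Real.log X) (C := C)
    (fun X hX => (hasDerivAt_primeRecipExpSum hX).sub (by
      have := (Real.hasDerivAt_log (show X ≠ 0 by linarith)).log (Real.log_pos hX).ne'
      simpa using this))
    (fun X hX => by
      have hl := Real.log_pos hX
      have e : primeExpSum X / X ^ 2 - 1 / X / Real.log X =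
          (primeExpSum X - X / Real.log X) / X ^ 2 := by field_simp
      rw [e, abs_div, abs_of_pos (by positivity : 0 < X ^ 2), div_le_iff₀ (by positivity)]
      refine (h X hX).trans_eq ?_
      field_simp)
  exact ⟨c, C, hC, hc⟩

/-- `∑_{p ≤ x} 1/p`. -/
def primeRecipSum (x : ℝ) : ℝ := ∑' p : Nat.Primes, if (p : ℝ) ≤ x then 1 / (p : ℝ) else 0

lemma finite_primes_le (x : ℝ) : {p : Nat.Primes | (p : ℝ) ≤ x}.Finite := by
  refine Set.Finite.of_finite_image (f := fun p : Nat.Primes => (p : ℕ)) ?_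
    Nat.Primes.coe_nat_injective.injOn
  refine (Set.finite_Iic ⌊x⌋₊).subset ?_
  rintro _ ⟨p, hp, rfl⟩
  exact Nat.le_floor hp

lemma summable_ite_primes_le (x : ℝ) (a : Nat.Primes → ℝ) :
    Summable fun p : Nat.Primes => if (p : ℝ) ≤ x then a p else 0 :=
  summable_of_hasFiniteSupport ((finite_primes_le x).subset fun p hp => by
    by_contra h; exact hp (if_neg h))

lemma monotone_primeRecipSum : Monotone primeRecipSum := by
  intro x y hxy
  refine Summable.tsum_le_tsum (fun p => ?_) (summable_ite_primes_le _ _)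
    (summable_ite_primes_le _ _)
  have := prime_pos p
  split_ifs with h1 h2
  · rfl
  · exact absurd (h1.trans hxy) h2
  · positivity
  · rfl

lemma primeRecipSum_nonneg (x : ℝ) : 0 ≤ primeRecipSum x :=
  tsum_nonneg fun p => by split_ifs <;> positivity

lemma primeRecipSum_eq_zero {x : ℝ} (hx : x < 2) : primeRecipSum x = 0 := by
  refine (tsum_congr fun p => if_neg ?_).trans tsum_zero
  have : (2 : ℝ) ≤ p := by exact_mod_cast p.2.two_le
  linarith

lemma abs_exp_sub_ite_le {u : ℝ} (hu : 0 < u) :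
    Real.exp (-1) * (1 / u * |Real.exp (-u) - if u ≤ 1 then 1 else 0|) ≤ gammaWeight 0 u := by
  have h0 : gammaWeight 0 u = Real.exp (-u) := by simp [gammaWeight]
  rw [h0]
  split_ifs with h
  · have h1 : 1 / u * |Real.exp (-u) - 1| ≤ 1 := by
      rw [one_div_mul_eq_div, div_le_one hu, abs_le]
      constructor
      · linarith [Real.add_one_le_exp (-u)]
      · linarith [Real.exp_le_one_iff.2 (by linarith : -u ≤ 0)]
    calc _ ≤ Real.exp (-1) * 1 := by gcongr
      _ ≤ _ := by rw [mul_one]; exact Real.exp_le_exp.2 (by linarith)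
  · rw [sub_zero, abs_of_pos (Real.exp_pos _), ← mul_assoc]
    refine mul_le_of_le_one_left (Real.exp_pos _).le (mul_le_one₀ ?_ (by positivity) ?_)
    · exact Real.exp_le_one_iff.2 (by norm_num)
    · rw [div_le_one hu]; linarith

theorem exists_abs_primeRecipSum_sub_le : ∃ c C : ℝ, 0 ≤ C ∧ ∀ X : ℝ, 1 < X →
    |primeRecipSum X - Real.log (Real.log X) - c| ≤ C / Real.log X := by
  obtain ⟨c, C1, hC1, h1⟩ := exists_abs_primeRecipExpSum_sub_le
  obtain ⟨C2, hC2, h2⟩ := (rapidDecay_gammaWeight 0).tsum_primes_le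
  refine ⟨c, C1 + Real.exp 1 * C2, by positivity, fun X hX => ?_⟩
  have hX0 : 0 < X := by linarith
  have hl := Real.log_pos hX
  have e : ∀ p : Nat.Primes,
      1 / (p : ℝ) * Real.exp (-(p / X)) - (if (p : ℝ) ≤ X then 1 / (p : ℝ) else 0) =
      1 / X * (1 / (p / X) * (Real.exp (-(p / X)) - if (p : ℝ) / X ≤ 1 then 1 else 0)) := by
    intro p
    have hp := prime_pos p
    simp only [div_le_one hX0]
    split_ifs <;> field_simp
    ring
  obtain ⟨s2, b2⟩ := h2 X hX (fun p => Real.exp (-1) *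
    (1 / (p / X) * (Real.exp (-(p / X)) - if (p : ℝ) / X ≤ 1 then 1 else 0))) (fun p => by
      have hp : 0 < (p : ℝ) / X := div_pos (prime_pos p) hX0
      rw [abs_mul, abs_mul, abs_of_pos (Real.exp_pos _),
        abs_of_pos (by positivity : 0 < 1 / ((p : ℝ) / X))]
      exact (abs_exp_sub_ite_le hp).trans ((le_abs_self _).trans (le_mul_one_add_abs _ _)))
  have s1 : Summable fun p : Nat.Primes => 1 / (p : ℝ) * Real.exp (-(p / X)) := by
    have : Summable fun p : Nat.Primes =>
        1 / (p : ℝ) * Real.exp (-(p / X)) - (if (p : ℝ) ≤ X then 1 / (p : ℝ) else 0) := by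
      simp_rw [e]
      refine ((s2.mul_left (Real.exp 1)).mul_left (1 / X)).congr fun p => ?_
      rw [← mul_assoc (Real.exp 1), ← Real.exp_add]; norm_num
    refine (this.add (summable_ite_primes_le X fun p => 1 / (p : ℝ))).congr fun p => ?_
    ring
  have e2 : primeRecipExpSum X - primeRecipSum X = 1 / X * (Real.exp 1 *
      ∑' p : Nat.Primes, Real.exp (-1) *
        (1 / (p / X) * (Real.exp (-(p / X)) - if (p : ℝ) / X ≤ 1 then 1 else 0))) := by
    rw [primeRecipExpSum, primeRecipSum, ← s1.tsum_sub (summable_ite_primes_le _ _),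
      ← tsum_mul_left, ← tsum_mul_left]
    refine tsum_congr fun p => ?_
    rw [e, ← mul_assoc (Real.exp 1), ← Real.exp_add]; norm_num
  have b3 : |primeRecipExpSum X - primeRecipSum X| ≤ Real.exp 1 * C2 / Real.log X := by
    rw [e2, abs_mul, abs_mul, abs_of_pos (Real.exp_pos _), abs_of_pos (by positivity : 0 < 1 / X)]
    calc _ ≤ 1 / X * (Real.exp 1 * (C2 * (X / Real.log X))) := by gcongr
      _ = _ := by field_simp
  have := h1 X hX
  rw [add_div]
  rw [abs_le] at *
  constructor <;> linarith

/-- `∑ₚ p^{-s}`. -/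
def primeZeta (s : ℝ) : ℝ := ∑' p : Nat.Primes, (p : ℝ) ^ (-s)

lemma abs_log_one_sub_add_le {x : ℝ} (h0 : 0 ≤ x) (h1 : x ≤ 1 / 2) :
    |Real.log (1 - x) + x| ≤ 2 * x ^ 2 := by
  have := Real.abs_log_sub_add_sum_range_le (x := x) (by rw [abs_of_nonneg h0]; linarith) 1
  simp only [Finset.range_one, Finset.sum_singleton, zero_add, pow_one, Nat.cast_zero, div_one,
    one_add_one_eq_two, abs_of_nonneg h0] at this
  rw [add_comm]
  refine this.trans ?_
  rw [div_le_iff₀ (by linarith)]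
  nlinarith [sq_nonneg x]

lemma summable_primes_rpow_neg {s : ℝ} (hs : 1 < s) :
    Summable fun p : Nat.Primes => (p : ℝ) ^ (-s) :=
  (Real.summable_nat_rpow.2 (by linarith)).comp_injective Nat.Primes.coe_nat_injective

lemma prime_rpow_neg_le (p : Nat.Primes) {s : ℝ} (hs : 1 ≤ s) : (p : ℝ) ^ (-s) ≤ 1 / p := by
  rw [one_div, ← Real.rpow_neg_one]
  exact Real.rpow_le_rpow_of_exponent_le (by exact_mod_cast p.2.one_lt.le) (by linarith)

lemma abs_log_one_sub_prime_rpow_add_le (p : Nat.Primes) {s : ℝ} (hs : 1 ≤ s) :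
    |Real.log (1 - (p : ℝ) ^ (-s)) + (p : ℝ) ^ (-s)| ≤ 2 * (p : ℝ) ^ (-2 : ℝ) := by
  have hp := prime_pos p
  have h2 : (2 : ℝ) ≤ p := by exact_mod_cast p.2.two_le
  have h := prime_rpow_neg_le p hs
  have h0 : 0 ≤ (p : ℝ) ^ (-s) := by positivity
  have h3 : 1 / (p : ℝ) ≤ 1 / 2 := one_div_le_one_div_of_le (by norm_num) h2
  refine (abs_log_one_sub_add_le h0 (h.trans h3)).trans ?_
  have e : (p : ℝ) ^ (-2 : ℝ) = (1 / (p : ℝ)) ^ 2 := by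
    rw [Real.rpow_neg hp.le, Real.rpow_two, one_div, inv_pow]
  rw [e]
  gcongr

lemma log_riemannZeta_eq_tsum {s : ℝ} (hs : 1 < s) :
    Real.log (riemannZeta s).re = primeZeta s -
      ∑' p : Nat.Primes, (Real.log (1 - (p : ℝ) ^ (-s)) + (p : ℝ) ^ (-s)) := by
  have h := riemannZeta_eulerProduct_exp_log (s := s) (by simpa using hs)
  have e : ∀ p : Nat.Primes, -Complex.log (1 - (p : ℂ) ^ (-(s : ℂ))) =
      ((-Real.log (1 - (p : ℝ) ^ (-s)) : ℝ) : ℂ) := by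
    intro p
    have h1 := prime_rpow_neg_le p hs.le
    have h2 : (2 : ℝ) ≤ p := by exact_mod_cast p.2.two_le
    have h3 : 1 / (p : ℝ) ≤ 1 / 2 := one_div_le_one_div_of_le (by norm_num) h2
    rw [Complex.ofReal_neg, Complex.ofReal_log (by linarith), Complex.ofReal_sub,
      Complex.ofReal_cpow (prime_pos p).le]
    simp
  simp_rw [e] at h
  rw [← Complex.ofReal_tsum, ← Complex.ofReal_exp] at h
  rw [← h, Complex.ofReal_re, Real.log_exp, primeZeta]
  have s2 : Summable fun p : Nat.Primes => Real.log (1 - (p : ℝ) ^ (-s)) + (p : ℝ) ^ (-s) :=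
    Summable.of_norm_bounded ((summable_primes_rpow_neg one_lt_two).mul_left 2)
      (fun p => abs_log_one_sub_prime_rpow_add_le p hs.le)
  rw [← (summable_primes_rpow_neg hs).tsum_sub s2]
  exact tsum_congr fun p => by ring

lemma tendsto_primeZeta_add_log : Tendsto (fun s : ℝ => primeZeta s + Real.log (s - 1)) (𝓝[>] 1)
    (𝓝 (∑' p : Nat.Primes, (Real.log (1 - 1 / (p : ℝ)) + 1 / (p : ℝ)))) := by
  have h1 : Tendsto (fun s : ℝ => Real.log (riemannZeta s).re + Real.log (s - 1)) (𝓝[>] 1)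
      (𝓝 0) := (Asymptotics.isLittleO_one_iff ℝ).1 log_riemannZeta_add_log_sub_isLittleO_ofReal
  have h2 : Tendsto (fun s : ℝ => ∑' p : Nat.Primes,
      (Real.log (1 - (p : ℝ) ^ (-s)) + (p : ℝ) ^ (-s))) (𝓝[>] 1)
      (𝓝 (∑' p : Nat.Primes, (Real.log (1 - 1 / (p : ℝ)) + 1 / (p : ℝ)))) := by
    refine tendsto_tsum_of_dominated_convergence
      ((summable_primes_rpow_neg one_lt_two).mul_left 2) (fun p => ?_) ?_
    · have hp := prime_pos p
      have h2 : (2 : ℝ) ≤ p := by exact_mod_cast p.2.two_le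
      have h3 : 1 / (p : ℝ) ≤ 1 / 2 := one_div_le_one_div_of_le (by norm_num) h2
      have h4 : Tendsto (fun s : ℝ => (p : ℝ) ^ (-s)) (𝓝[>] 1) (𝓝 (1 / (p : ℝ))) := by
        rw [one_div, ← Real.rpow_neg_one]
        refine tendsto_nhdsWithin_of_tendsto_nhds ?_
        exact (Real.continuous_const_rpow hp.ne').tendsto _ |>.comp (continuous_neg.tendsto _)
      exact ((tendsto_const_nhds.sub h4).log (by linarith)).add h4
    · filter_upwards [self_mem_nhdsWithin] with s hs p
      exact abs_log_one_sub_prime_rpow_add_le p (le_of_lt hs)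
  have h3 := h1.add h2
  rw [zero_add] at h3
  refine h3.congr' ?_
  filter_upwards [self_mem_nhdsWithin] with s hs
  rw [log_riemannZeta_eq_tsum hs]; ring

open MeasureTheory in
lemma integral_exp_mul_primeRecipSum {δ : ℝ} (hδ : 0 < δ) :
    ∫ v in Set.Ioi 0, Real.exp (-v) * primeRecipSum (Real.exp (v / δ)) = primeZeta (1 + δ) := by
  set F : Nat.Primes → ℝ → ℝ := fun p v =>
    Real.exp (-v) * (if (p : ℝ) ≤ Real.exp (v / δ) then 1 / (p : ℝ) else 0) with hF
  have hF' : ∀ p : Nat.Primes, F p = (Set.Ici (δ * Real.log p)).indicator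
      (fun v => 1 / (p : ℝ) * Real.exp (-v)) := by
    intro p
    ext v
    have hp := prime_pos p
    have : (p : ℝ) ≤ Real.exp (v / δ) ↔ v ∈ Set.Ici (δ * Real.log p) := by
      rw [← Real.log_le_iff_le_exp hp, le_div_iff₀ hδ, Set.mem_Ici, mul_comm]
    simp only [hF, this, Set.indicator_apply]
    split_ifs <;> ring
  have hpos : ∀ p : Nat.Primes, 0 < δ * Real.log p := fun p =>
    mul_pos hδ (Real.log_pos (by exact_mod_cast p.2.one_lt))
  have hF_int : ∀ p : Nat.Primes, IntegrableOn (F p) (Set.Ioi 0) := by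
    intro p
    rw [hF']
    exact ((integrableOn_exp_neg_Ioi 0).const_mul _).indicator measurableSet_Ici
  have hval : ∀ p : Nat.Primes, ∫ v in Set.Ioi 0, F p v = (p : ℝ) ^ (-(1 + δ)) := by
    intro p
    have hp := prime_pos p
    rw [hF', setIntegral_indicator measurableSet_Ici, Set.inter_eq_right.2
      (Set.Ici_subset_Ioi.2 (hpos p)), integral_Ici_eq_integral_Ioi, integral_const_mul,
      integral_exp_neg_Ioi, neg_add, Real.rpow_add hp, Real.rpow_neg_one, one_div,
      Real.rpow_def_of_pos hp]
    congr 2; ring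
  have hnn : ∀ p v, 0 ≤ F p v := fun p v => by simp only [hF]; split_ifs <;> positivity
  have h := hasSum_integral_of_summable_integral_norm hF_int (by
    simp_rw [Real.norm_of_nonneg (hnn _ _), hval]
    exact summable_primes_rpow_neg (by linarith))
  simp_rw [hval] at h
  rw [primeZeta, h.tsum_eq]
  simp_rw [hF, tsum_mul_left]
  rfl

open MeasureTheory in
lemma integrableOn_exp_mul_abs_log :
    IntegrableOn (fun v => Real.exp (-v) * |Real.log v|) (Set.Ioi 0) := by
  have h1 := Real.GammaIntegral_convergent (s := 3 / 2) (by norm_num)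
  have h2 := Real.GammaIntegral_convergent (s := 1 / 2) (by norm_num)
  refine ((h1.const_mul 2).add (h2.const_mul 2)).mono' ?_ ?_
  · exact (by fun_prop : Measurable fun v => Real.exp (-v) * |Real.log v|).aestronglyMeasurable
  · refine (ae_restrict_iff' measurableSet_Ioi).2 (Eventually.of_forall fun v (hv : 0 < v) => ?_)
    rw [Real.norm_of_nonneg (by positivity)]
    have a1 := Real.log_le_rpow_div hv.le (show (0 : ℝ) < 1 / 2 by norm_num)
    have a2 := Real.log_le_rpow_div (inv_pos.2 hv).le (show (0 : ℝ) < 1 / 2 by norm_num)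
    rw [Real.log_inv, Real.inv_rpow hv.le, ← Real.rpow_neg hv.le] at a2
    have b1 : 0 < v ^ (1 / 2 : ℝ) := by positivity
    have b2 : 0 < v ^ (-(1 / 2) : ℝ) := by positivity
    have : |Real.log v| ≤ 2 * v ^ (1 / 2 : ℝ) + 2 * v ^ (-(1 / 2) : ℝ) := by
      rw [abs_le]; constructor <;> linarith
    rw [show (3 / 2 - 1 : ℝ) = 1 / 2 by norm_num, show (1 / 2 - 1 : ℝ) = -(1 / 2) by norm_num]
    calc _ ≤ Real.exp (-v) * (2 * v ^ (1 / 2 : ℝ) + 2 * v ^ (-(1 / 2) : ℝ)) := by gcongr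
      _ = _ := by simp only [Pi.add_apply]; ring

open MeasureTheory in
lemma integrableOn_exp_mul_log :
    IntegrableOn (fun v => Real.exp (-v) * Real.log v) (Set.Ioi 0) := by
  refine integrableOn_exp_mul_abs_log.mono' ?_ (Eventually.of_forall fun v => ?_)
  · exact (by fun_prop : Measurable fun v => Real.exp (-v) * Real.log v).aestronglyMeasurable
  · rw [norm_mul, Real.norm_of_nonneg (Real.exp_pos _).le, Real.norm_eq_abs]

open MeasureTheory in
lemma integral_exp_mul_log :
    ∫ v in Set.Ioi 0, Real.exp (-v) * Real.log v = -Real.eulerMascheroniConstant := by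
  have h1 := Complex.hasDerivAt_GammaIntegral (s := 1) (by simp)
  have h2 : Complex.GammaIntegral =ᶠ[𝓝 1] Complex.Gamma := by
    have : IsOpen {s : ℂ | 0 < s.re} := Complex.continuous_re.isOpen_preimage _ isOpen_Ioi
    filter_upwards [this.mem_nhds (show (0 : ℝ) < (1 : ℂ).re by simp)] with s hs
    exact (Complex.Gamma_eq_integral hs).symm
  have h3 := (h1.congr_of_eventuallyEq h2.symm).unique Complex.hasDerivAt_Gamma_one
  have h4 : (∫ t : ℝ in Set.Ioi 0, (t : ℂ) ^ ((1 : ℂ) - 1) * (Real.log t * Real.exp (-t))) =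
      ((∫ v in Set.Ioi 0, Real.exp (-v) * Real.log v : ℝ) : ℂ) := by
    rw [← integral_complex_ofReal]
    refine integral_congr_ae (Eventually.of_forall fun t => ?_)
    simp [mul_comm]
  rw [h4] at h3
  exact_mod_cast h3

open MeasureTheory in
lemma tendsto_primeZeta_add_log_of_mertens {c C : ℝ} (hC : 0 ≤ C) (h : ∀ X : ℝ, 1 < X →
    |primeRecipSum X - Real.log (Real.log X) - c| ≤ C / Real.log X) :
    Tendsto (fun δ : ℝ => primeZeta (1 + δ) + Real.log δ) (𝓝[>] 0)
      (𝓝 (c - Real.eulerMascheroniConstant)) := by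
  set D : ℝ → ℝ := fun s => primeRecipSum (Real.exp s) - Real.log s - c with hD
  have hDle : ∀ s, 0 < s → |D s| ≤ C / s := by
    intro s hs
    have := h (Real.exp s) (Real.one_lt_exp_iff.2 hs)
    rwa [Real.log_exp] at this
  have hlog2 : 1 / 2 < Real.log 2 := by have := Real.log_two_gt_d9; linarith
  have hdom : ∀ v δ : ℝ, 0 < v → 0 < δ → δ < 1 → |D (v / δ)| ≤ 2 * C + |c| + |Real.log v| := by
    intro v δ hv hδ hδ1
    have hs : 0 < v / δ := by positivity
    have hvs : v ≤ v / δ := by rw [le_div_iff₀ hδ]; nlinarith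
    rcases lt_or_ge (v / δ) (Real.log 2) with h1 | h1
    · have h0 : primeRecipSum (Real.exp (v / δ)) = 0 :=
        primeRecipSum_eq_zero ((Real.lt_log_iff_exp_lt (by norm_num)).1 h1)
      have hl1 : Real.log 2 < 1 := by have := Real.log_two_lt_d9; linarith
      have h2 : |Real.log (v / δ)| ≤ |Real.log v| := by
        have a := Real.log_nonpos hs.le (by linarith)
        have b := Real.log_le_log hv hvs
        rw [abs_of_nonpos a, abs_of_nonpos (by linarith)]; linarith
      simp only [hD, h0]
      calc |0 - Real.log (v / δ) - c| = |Real.log (v / δ) + c| := by rw [← abs_neg]; ring_nf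
        _ ≤ |Real.log (v / δ)| + |c| := abs_add_le _ _
        _ ≤ _ := by linarith
    · refine (hDle _ hs).trans ?_
      have : C / (v / δ) ≤ 2 * C := by
        rw [div_le_iff₀ hs]; nlinarith
      linarith [abs_nonneg c, abs_nonneg (Real.log v)]
  have hI : ∀ a : ℝ, IntegrableOn (fun v => Real.exp (-v) * a) (Set.Ioi 0) := fun a =>
    (integrableOn_exp_neg_Ioi 0).mul_const a
  have hmeas : ∀ δ : ℝ, Measurable fun v => D (v / δ) := by
    intro δ
    have := monotone_primeRecipSum.measurable
    fun_prop
  have key : Tendsto (fun δ => ∫ v in Set.Ioi 0, Real.exp (-v) * D (v / δ)) (𝓝[>] 0)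
      (𝓝 (∫ v in Set.Ioi (0 : ℝ), (0 : ℝ))) := by
    refine tendsto_integral_filter_of_dominated_convergence
      (fun v => Real.exp (-v) * (2 * C + |c|) + Real.exp (-v) * |Real.log v|) ?_ ?_ ?_ ?_
    · refine Eventually.of_forall fun δ => ?_
      have : Measurable fun v : ℝ => Real.exp (-v) := by fun_prop
      exact (this.mul (hmeas δ)).aestronglyMeasurable
    · filter_upwards [Ioo_mem_nhdsGT (zero_lt_one (α := ℝ))] with δ hδ
      refine (ae_restrict_iff' measurableSet_Ioi).2 (Eventually.of_forall fun v (hv : 0 < v) => ?_)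
      rw [norm_mul, Real.norm_of_nonneg (Real.exp_pos _).le, Real.norm_eq_abs, ← mul_add]
      gcongr
      exact hdom v δ hv hδ.1 hδ.2
    · exact (hI _).add integrableOn_exp_mul_abs_log
    · refine (ae_restrict_iff' measurableSet_Ioi).2 (Eventually.of_forall fun v (hv : 0 < v) => ?_)
      suffices Tendsto (fun δ => D (v / δ)) (𝓝[>] 0) (𝓝 0) by
        simpa using this.const_mul (Real.exp (-v))
      refine squeeze_zero_norm' (a := fun δ => C / v * δ) ?_ ?_
      · filter_upwards [self_mem_nhdsWithin] with δ (hδ : 0 < δ)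
        refine (hDle _ (by positivity)).trans_eq ?_
        field_simp
      · refine tendsto_nhdsWithin_of_tendsto_nhds ?_
        have : Tendsto (fun δ : ℝ => C / v * δ) (𝓝 0) (𝓝 (C / v * 0)) :=
          tendsto_id.const_mul _
        rwa [mul_zero] at this
  rw [integral_zero] at key
  have key2 := key.add_const (c - Real.eulerMascheroniConstant)
  rw [zero_add] at key2
  refine key2.congr' ?_
  filter_upwards [Ioo_mem_nhdsGT (zero_lt_one (α := ℝ))] with δ hδ
  have iD : IntegrableOn (fun v => Real.exp (-v) * D (v / δ)) (Set.Ioi 0) := by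
    refine Integrable.mono' (((hI (2 * C + |c|)).add integrableOn_exp_mul_abs_log)) ?_ ?_
    · have : Measurable fun v : ℝ => Real.exp (-v) := by fun_prop
      exact (this.mul (hmeas δ)).aestronglyMeasurable
    · refine (ae_restrict_iff' measurableSet_Ioi).2 (Eventually.of_forall fun v (hv : 0 < v) => ?_)
      rw [norm_mul, Real.norm_of_nonneg (Real.exp_pos _).le, Real.norm_eq_abs, Pi.add_apply,
        ← mul_add]
      gcongr
      exact hdom v δ hv hδ.1 hδ.2
  have e : ∫ v in Set.Ioi 0, Real.exp (-v) * primeRecipSum (Real.exp (v / δ)) =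
      ∫ v in Set.Ioi 0, (Real.exp (-v) * D (v / δ) +
        (Real.exp (-v) * Real.log v + Real.exp (-v) * (c - Real.log δ))) := by
    refine setIntegral_congr_fun measurableSet_Ioi fun v (hv : 0 < v) => ?_
    simp only [hD]
    rw [Real.log_div hv.ne' hδ.1.ne']; ring
  rw [← integral_exp_mul_primeRecipSum hδ.1, e, integral_add iD
    (g := fun v => Real.exp (-v) * Real.log v + Real.exp (-v) * (c - Real.log δ))
    (integrableOn_exp_mul_log.add (hI _)), integral_add integrableOn_exp_mul_log (hI _),
    integral_exp_mul_log, integral_mul_const, integral_exp_neg_Ioi_zero]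
  ring

/-- Mertens' second theorem. -/
theorem abs_primeRecipSum_sub_le : ∃ C : ℝ, 0 ≤ C ∧ ∀ X : ℝ, 1 < X →
    |primeRecipSum X - Real.log (Real.log X) - meisselMertens| ≤ C / Real.log X := by
  obtain ⟨c, C, hC, h⟩ := exists_abs_primeRecipSum_sub_le
  have h1 := tendsto_primeZeta_add_log_of_mertens hC h
  have h2 : Tendsto (fun δ : ℝ => 1 + δ) (𝓝[>] 0) (𝓝[>] 1) := by
    refine tendsto_nhdsWithin_iff.2 ⟨tendsto_nhdsWithin_of_tendsto_nhds ?_, ?_⟩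
    · have : Continuous fun δ : ℝ => 1 + δ := by fun_prop
      simpa using this.tendsto 0
    · filter_upwards [self_mem_nhdsWithin] with δ (hδ : 0 < δ)
      exact lt_add_of_pos_right _ hδ
  have h3 := tendsto_primeZeta_add_log.comp h2
  have h4 := tendsto_nhds_unique (h1.congr fun δ => by simp [Function.comp]) h3
  refine ⟨C, hC, ?_⟩
  rw [meisselMertens, ← h4, add_sub_cancel]
  exact h

lemma log_prime_nonneg (p : Nat.Primes) : 0 ≤ Real.log p :=
  Real.log_nonneg (by exact_mod_cast p.2.one_lt.le)

lemma log_prime_mul_rpow_le (p : Nat.Primes) (s : ℝ) :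
    Real.log p * (p : ℝ) ^ (-s) ≤ 2 * (p : ℝ) ^ (-(s - 1 / 2)) := by
  have hp := prime_pos p
  have := Real.log_le_rpow_div hp.le (show (0 : ℝ) < 1 / 2 by norm_num)
  calc _ ≤ ((p : ℝ) ^ (1 / 2 : ℝ) / (1 / 2)) * (p : ℝ) ^ (-s) := by gcongr
    _ = 2 * ((p : ℝ) ^ (1 / 2 : ℝ) * (p : ℝ) ^ (-s)) := by ring
    _ = _ := by rw [← Real.rpow_add hp]; ring_nf

lemma RapidDecay.tsum_log_primes_le {f : ℝ → ℝ} (hf : RapidDecay f) :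
    ∃ C : ℝ, 0 ≤ C ∧ ∀ Y : ℝ, 0 < Y →
      Summable (fun p : Nat.Primes =>
        Real.log p * (|f (p / Y)| * (1 + |Real.log (p / Y)|) ^ 2)) ∧
      ∑' p : Nat.Primes, Real.log p * (|f (p / Y)| * (1 + |Real.log (p / Y)|) ^ 2) ≤ C * Y ∧
      ∑' p : Nat.Primes, Real.log p * (|f (p / Y)| * (1 + |Real.log (p / Y)|) ^ 2) ≤ C * Y ^ 2 := by
  obtain ⟨C, hC, h⟩ := hf.tsum_le linearlyBounded_log_primes
  obtain ⟨K, hK, hd⟩ := hf.mul_log_sq_le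
  have hs := summable_primes_rpow_neg (s := 2 - 1 / 2) (by norm_num)
  set A := ∑' p : Nat.Primes, (p : ℝ) ^ (-(2 - 1 / 2) : ℝ)
  have hA : 0 ≤ A := tsum_nonneg fun p => by positivity
  refine ⟨C + K * 2 * A, by positivity, fun Y hY => ?_⟩
  obtain ⟨s, b⟩ := h Y hY (fun p : Nat.Primes => |f (p / Y)| * (1 + |Real.log (p / Y)|) ^ 2)
    (fun p => (abs_of_nonneg (by positivity)).le)
  refine ⟨s, ?_, ?_⟩
  · refine ((le_abs_self _).trans b).trans ?_
    gcongr
    exact le_add_of_nonneg_right (by positivity)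
  · have hb : ∀ p : Nat.Primes, Real.log p * (|f (p / Y)| * (1 + |Real.log (p / Y)|) ^ 2) ≤
        K * 2 * Y ^ 2 * (p : ℝ) ^ (-(2 - 1 / 2) : ℝ) := by
      intro p
      have hp := prime_pos p
      have hl := log_prime_nonneg p
      calc _ ≤ Real.log p * (K * (1 / (p / Y) ^ 2)) := by
            refine mul_le_mul_of_nonneg_left ((hd _ (by positivity)).trans ?_) hl
            exact mul_le_mul_of_nonneg_left (decayBound_le_sq _) hK
        _ = K * Y ^ 2 * (Real.log p * (p : ℝ) ^ (-2 : ℝ)) := by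
            rw [Real.rpow_neg hp.le, Real.rpow_two]; field_simp
        _ ≤ K * Y ^ 2 * (2 * (p : ℝ) ^ (-(2 - 1 / 2) : ℝ)) := by
            exact mul_le_mul_of_nonneg_left (log_prime_mul_rpow_le p 2) (by positivity)
        _ = _ := by ring
    refine (s.tsum_le_tsum hb (hs.mul_left _)).trans ?_
    rw [tsum_mul_left]
    change K * 2 * Y ^ 2 * A ≤ _
    nlinarith [mul_nonneg hC (sq_nonneg Y)]

lemma RapidDecay.abs_primeSum_le_cube {f : ℝ → ℝ} (hf : RapidDecay f) :
    ∃ C : ℝ, 0 ≤ C ∧ ∀ Y : ℝ, 0 < Y → |primeSum f Y| ≤ C * Y ^ 3 := by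
  obtain ⟨C, hC, h⟩ := hf
  have hs := summable_primes_rpow_neg (s := 3 - 1 / 2) (by norm_num)
  set A := ∑' p : Nat.Primes, (p : ℝ) ^ (-(3 - 1 / 2) : ℝ)
  have hA : 0 ≤ A := tsum_nonneg fun p => by positivity
  refine ⟨C * 2 * A, by positivity, fun Y hY => ?_⟩
  have hb : ∀ p : Nat.Primes, ‖Real.log p * f (p / Y)‖ ≤
        C * 2 * Y ^ 3 * (p : ℝ) ^ (-(3 - 1 / 2) : ℝ) := by
    intro p
    have hp := prime_pos p
    have hl := log_prime_nonneg p
    rw [norm_mul, Real.norm_of_nonneg hl, Real.norm_eq_abs]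
    calc _ ≤ Real.log p * (C * (p / Y) ^ (-3 : ℝ)) :=
          mul_le_mul_of_nonneg_left (h _ (by positivity)).2 hl
      _ = C * Y ^ 3 * (Real.log p * (p : ℝ) ^ (-3 : ℝ)) := by
          have e : ∀ x : ℝ, 0 < x → x ^ (-3 : ℝ) = (x ^ 3)⁻¹ := fun x hx => by
            rw [Real.rpow_neg hx.le]; norm_cast
          rw [e _ (by positivity), e _ hp]
          field_simp
      _ ≤ C * Y ^ 3 * (2 * (p : ℝ) ^ (-(3 - 1 / 2) : ℝ)) := by
          exact mul_le_mul_of_nonneg_left (log_prime_mul_rpow_le p 3) (by positivity)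
      _ = _ := by ring
  refine (tsum_of_norm_bounded (hs.mul_left _).hasSum hb).trans_eq ?_
  rw [tsum_mul_left]; ring

lemma tsum_primes_min_le : ∃ C : ℝ, 0 ≤ C ∧ ∀ X : ℝ, 0 < X →
    Summable (fun q : Nat.Primes => min (X / q) ((X / q) ^ 2)) ∧
    ∑' q : Nat.Primes, min (X / q) ((X / q) ^ 2) ≤ C * X * (primeRecipSum X + 1) := by
  have hK := Real.log_pos (show (1 : ℝ) < 4 by norm_num)
  refine ⟨1 + 2 * (8 * Real.log 4), by positivity, fun X hX => ?_⟩
  have s1 := (summable_ite_primes_le X fun q => 1 / (q : ℝ)).mul_left X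
  have s2 := (linearlyBounded_log_primes.summable_decayBound hX).mul_left 2
  have hb : ∀ q : Nat.Primes, min (X / q) ((X / q) ^ 2) ≤
      X * (if (q : ℝ) ≤ X then 1 / (q : ℝ) else 0) +
        2 * (Real.log q * decayBound (q / X)) := by
    intro q
    have hq := prime_pos q
    split_ifs with h
    · have := mul_nonneg (log_prime_nonneg q) (decayBound_nonneg (q / X))
      refine (min_le_left _ _).trans ?_
      rw [mul_one_div]; linarith
    · rw [decayBound_of_one_le (by rw [one_le_div hX]; linarith)]
      refine (min_le_right _ _).trans ?_
      have := one_le_log_prime_div q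
      have e : (1 : ℝ) / (q / X) ^ 2 = (X / q) ^ 2 := by field_simp
      rw [e]
      nlinarith [sq_nonneg (X / q)]
  have s3 : Summable (fun q : Nat.Primes => min (X / q) ((X / q) ^ 2)) :=
    Summable.of_nonneg_of_le (fun q => by positivity) hb (s1.add s2)
  refine ⟨s3, (s3.tsum_le_tsum hb (s1.add s2)).trans ?_⟩
  rw [s1.tsum_add s2, tsum_mul_left, tsum_mul_left]
  have := linearlyBounded_log_primes.tsum_decayBound_le hX
  change X * primeRecipSum X + _ ≤ _
  have hB := primeRecipSum_nonneg X
  have h1 : 0 ≤ Real.log 4 * X * primeRecipSum X := by positivity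
  nlinarith

lemma exp_one_le_log {X : ℝ} (hX : 16 ≤ X) : Real.exp 1 ≤ Real.log X := by
  have h1 : Real.log 16 ≤ Real.log X := Real.log_le_log (by norm_num) hX
  have h2 : Real.log 16 = 4 * Real.log 2 := by
    rw [show (16 : ℝ) = 2 ^ 4 by norm_num, Real.log_pow]; norm_num
  have h3 := Real.log_two_gt_d9
  have h4 := Real.exp_one_lt_d9
  linarith

lemma one_le_log_log {X : ℝ} (hX : 16 ≤ X) : 1 ≤ Real.log (Real.log X) := by
  rw [← Real.log_exp 1]
  exact Real.log_le_log (Real.exp_pos 1) (exp_one_le_log hX)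

lemma one_le_log {X : ℝ} (hX : 16 ≤ X) : 1 ≤ Real.log X :=
  (Real.one_le_exp zero_le_one).trans (exp_one_le_log hX)

lemma exists_primeRecipSum_le : ∃ C : ℝ, 0 ≤ C ∧ ∀ X : ℝ, 16 ≤ X →
    primeRecipSum X + 1 ≤ C * Real.log (Real.log X) := by
  obtain ⟨C, hC, h⟩ := abs_primeRecipSum_sub_le
  refine ⟨2 + C + |meisselMertens|, by positivity, fun X hX => ?_⟩
  have h1 := (abs_le.1 (h X (by linarith))).2
  have h2 := one_le_log_log hX
  have h3 : C / Real.log X ≤ C := div_le_self hC (one_le_log hX)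
  have h4 := le_abs_self meisselMertens
  have h5 := abs_nonneg meisselMertens
  nlinarith

lemma sum_log_primes_mul_inv_le {X : ℝ} (hX : 16 ≤ X) (s : Finset Nat.Primes) :
    ∑ q ∈ s, Real.log q * (if (q : ℝ) ≤ X then 1 / ((q : ℝ) * (1 + Real.log (X / q))) else 0) ≤
      16 * Real.log (Real.log X) := by
  have hX0 : 0 < X := by linarith
  have h2 := Real.log_pos one_lt_two
  have h2' := Real.log_two_gt_d9
  have hl := one_le_log hX
  have hll := one_le_log_log hX
  set K := ⌊Real.log X / Real.log 2⌋₊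
  set c : ℕ → ℝ := fun k => if k ∈ Finset.range (K + 1) then
    2 / (X * Real.log 2) * (2 ^ k * (1 / ((k : ℝ) + 1))) else 0
  set t : ℕ → ℝ := fun k => (2 ^ k)⁻¹
  have hct : ∀ k, c k * t k = if k ∈ Finset.range (K + 1) then
      2 / (X * Real.log 2) * (1 / ((k : ℝ) + 1)) else 0 := by
    intro k
    simp only [c, t, ite_mul, zero_mul]
    congr 1
    field_simp
  have hsum : ∑' k, c k * t k = 2 / (X * Real.log 2) * (harmonic (K + 1) : ℚ) := by
    rw [tsum_congr hct, tsum_eq_sum (s := Finset.range (K + 1)) (fun k hk => if_neg hk)]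
    rw [Finset.sum_congr rfl fun k hk => if_pos hk, ← Finset.mul_sum, harmonic]
    push_cast
    simp
  have hsm : Summable fun k => c k * t k := by
    refine (summable_of_ne_finset_zero (s := Finset.range (K + 1)) fun k hk => ?_)
    rw [hct, if_neg hk]
  have hharm : ((harmonic (K + 1) : ℚ) : ℝ) ≤ 4 * Real.log (Real.log X) := by
    refine (harmonic_le_one_add_log (K + 1)).trans ?_
    have hK : ((K + 1 : ℕ) : ℝ) ≤ 3 * Real.log X := by
      push_cast
      have : (K : ℝ) ≤ Real.log X / Real.log 2 := Nat.floor_le (by positivity)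
      have : Real.log X / Real.log 2 ≤ 2 * Real.log X := by
        rw [div_le_iff₀ h2]; nlinarith
      linarith
    have h3 := Real.log_le_log (by positivity) hK
    rw [Real.log_mul (by norm_num) (by positivity)] at h3
    have := Real.log_le_sub_one_of_pos (show (0 : ℝ) < 3 by norm_num)
    linarith
  have := linearlyBounded_log_primes.sum_mul_le (c := c) (t := t)
    (fun k => by simp only [c]; split_ifs <;> positivity) (fun k => by positivity) hsm
    (G := fun q : Nat.Primes => if (q : ℝ) ≤ X then 1 / ((q : ℝ) * (1 + Real.log (X / q))) else 0)
    hX0 (fun q => ?_) s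
  · refine this.trans ?_
    rw [hsum]
    have h4 : Real.log 4 = 2 * Real.log 2 := by
      rw [show (4 : ℝ) = 2 ^ 2 by norm_num, Real.log_pow]; norm_num
    rw [h4, show 2 * Real.log 2 * X * (2 / (X * Real.log 2) * ((harmonic (K + 1) : ℚ) : ℝ)) =
      4 * ((harmonic (K + 1) : ℚ) : ℝ) by field_simp; ring]
    linarith
  · by_cases hq : (q : ℝ) ≤ X
    · right
      have hq0 := prime_pos q
      have hxq : 1 ≤ X / q := (one_le_div hq0).2 hq
      obtain ⟨k, hk1, hk2⟩ := exists_nat_pow_near hxq one_lt_two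
      have hq1 : (1 : ℝ) ≤ q := by exact_mod_cast q.2.one_lt.le
      have hkl : k * Real.log 2 ≤ Real.log (X / q) := by
        rw [← Real.log_pow]; exact Real.log_le_log (by positivity) hk1
      refine ⟨k, ?_, ?_⟩
      · simp only [t]
        rw [le_div_iff₀ hq0] at hk1
        rw [inv_mul_eq_div, le_div_iff₀ (by positivity)]
        linarith
      · have hkK : k ∈ Finset.range (K + 1) := by
          rw [Finset.mem_range, Nat.lt_succ_iff]
          refine Nat.le_floor ?_
          rw [le_div_iff₀ h2]
          exact hkl.trans (Real.log_le_log (by positivity) (div_le_self hX0.le hq1))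
        simp only [c, if_pos hkK, if_pos hq]
        rw [div_lt_iff₀ hq0] at hk2
        have e : 2 / (X * Real.log 2) * (2 ^ k * (1 / ((k : ℝ) + 1))) =
            1 / ((X / 2 ^ (k + 1)) * (Real.log 2 * (k + 1))) := by
          field_simp; ring
        rw [e]
        have h5 : X / 2 ^ (k + 1) ≤ q := by
          rw [div_le_iff₀ (by positivity)]; linarith
        have h6 : Real.log 2 * (k + 1) ≤ 1 + Real.log (X / q) := by
          have := Real.log_two_lt_d9
          linarith
        have h7 : 0 < Real.log 2 * ((k : ℝ) + 1) := by positivity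
        exact one_div_le_one_div_of_le (by positivity) (mul_le_mul h5 h6 h7.le hq0.le)
    · left
      simp [hq]

lemma exists_tsum_primes_inv_le : ∃ C : ℝ, 0 ≤ C ∧ ∀ X : ℝ, 16 ≤ X →
    ∑' q : Nat.Primes, (if (q : ℝ) ≤ X then 1 / ((q : ℝ) * (1 + Real.log (X / q))) else 0) ≤
      C * (Real.log (Real.log X) / Real.log X) := by
  obtain ⟨C, hC, h⟩ := exists_primeRecipSum_le
  refine ⟨C + 16, by positivity, fun X hX => ?_⟩
  have hX0 : 0 < X := by linarith
  have hl := one_le_log hX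
  have s0 := summable_ite_primes_le X fun q => 1 / (q : ℝ)
  have s1 := summable_ite_primes_le X fun q => 1 / ((q : ℝ) * (1 + Real.log (X / q)))
  have s2 : Summable fun q : Nat.Primes =>
      Real.log q * (if (q : ℝ) ≤ X then 1 / ((q : ℝ) * (1 + Real.log (X / q))) else 0) :=
    (summable_ite_primes_le X fun q =>
      Real.log q * (1 / ((q : ℝ) * (1 + Real.log (X / q))))).congr fun q => by
        split_ifs <;> simp
  have hS2 := Real.tsum_le_of_sum_le (fun q => ?_) (sum_log_primes_mul_inv_le hX)
  swap
  · split_ifs with hq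
    · have := Real.log_nonneg ((one_le_div (prime_pos q)).2 hq)
      have := prime_pos q
      have := log_prime_nonneg q
      positivity
    · simp
  have hb : ∀ q : Nat.Primes,
      Real.log X * (if (q : ℝ) ≤ X then 1 / ((q : ℝ) * (1 + Real.log (X / q))) else 0) ≤
      (if (q : ℝ) ≤ X then 1 / (q : ℝ) else 0) + Real.log q *
        (if (q : ℝ) ≤ X then 1 / ((q : ℝ) * (1 + Real.log (X / q))) else 0) := by
    intro q
    split_ifs with hq
    · have hq0 := prime_pos q
      have h1 := Real.log_nonneg ((one_le_div hq0).2 hq)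
      have h2 : Real.log X = Real.log q + Real.log (X / q) := by
        rw [Real.log_div hX0.ne' hq0.ne']; ring
      rw [h2]
      have : 1 / (q : ℝ) = (1 + Real.log (X / q)) * (1 / ((q : ℝ) * (1 + Real.log (X / q)))) := by
        have : 1 + Real.log (X / q) ≠ 0 := by positivity
        field_simp
      rw [this, ← add_mul]
      refine mul_le_mul_of_nonneg_right (by linarith) (by positivity)
    · simp
  have := (s1.mul_left (Real.log X)).tsum_le_tsum hb (s0.add s2)
  rw [s0.tsum_add s2, tsum_mul_left] at this
  have hP := h X hX
  change _ ≤ primeRecipSum X + _ at this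
  rw [mul_div_assoc', le_div_iff₀ (by linarith), mul_comm]
  linarith

/-- The product of a pair of primes, as a real number. -/
def pairProd (i : Nat.Primes × Nat.Primes) : ℝ := (i.1 : ℝ) * (i.2 : ℝ)

lemma pairProd_pos (i : Nat.Primes × Nat.Primes) : 0 < pairProd i :=
  mul_pos (prime_pos i.1) (prime_pos i.2)

lemma pairProd_swap (i : Nat.Primes × Nat.Primes) : pairProd i.swap = pairProd i :=
  mul_comm _ _

lemma pairProd_div (p q : Nat.Primes) (X : ℝ) : pairProd (p, q) / X = p / (X / q) := by
  rw [div_div_eq_mul_div]; rfl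

lemma RapidDecay.summable_pairs_log {f : ℝ → ℝ} (hf : RapidDecay f) :
    ∃ C : ℝ, 0 ≤ C ∧ ∀ X : ℝ, 16 ≤ X →
      Summable (fun i : Nat.Primes × Nat.Primes => Real.log i.1 *
        (|f (pairProd i / X)| * (1 + |Real.log (pairProd i / X)|) ^ 2)) ∧
      ∑' i : Nat.Primes × Nat.Primes, Real.log i.1 *
        (|f (pairProd i / X)| * (1 + |Real.log (pairProd i / X)|) ^ 2) ≤
          C * (X * Real.log (Real.log X)) := by
  obtain ⟨C1, hC1, h1⟩ := hf.tsum_log_primes_le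
  obtain ⟨C2, hC2, h2⟩ := tsum_primes_min_le
  obtain ⟨C3, hC3, h3⟩ := exists_primeRecipSum_le
  refine ⟨C1 * C2 * C3, by positivity, fun X hX => ?_⟩
  have hX0 : 0 < X := by linarith
  obtain ⟨s2, b2⟩ := h2 X hX0
  set F : Nat.Primes × Nat.Primes → ℝ := fun i => Real.log i.1 *
        (|f (pairProd i / X)| * (1 + |Real.log (pairProd i / X)|) ^ 2)
  have hF : ∀ i, 0 ≤ F i := fun i => mul_nonneg (log_prime_nonneg _) (by positivity)
  have hY : ∀ q : Nat.Primes, 0 < X / q := fun q => div_pos hX0 (prime_pos q)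
  have hFe : ∀ q p : Nat.Primes, F (p, q) =
      Real.log p * (|f (p / (X / q))| * (1 + |Real.log (p / (X / q))|) ^ 2) := by
    intro q p
    simp only [F, pairProd_div]
  have hin : ∀ q : Nat.Primes, Summable fun p => F (p, q) := fun q =>
    (h1 _ (hY q)).1.congr fun p => (hFe q p).symm
  have hb : ∀ q : Nat.Primes, ∑' p, F (p, q) ≤ C1 * min (X / q) ((X / q) ^ 2) := by
    intro q
    rw [tsum_congr (hFe q), mul_min_of_nonneg _ _ hC1]
    exact le_min (h1 _ (hY q)).2.1 (h1 _ (hY q)).2.2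
  have hout : Summable fun q => ∑' p, F (p, q) :=
    Summable.of_nonneg_of_le (fun q => tsum_nonneg fun p => hF _) hb (s2.mul_left C1)
  have hs : Summable (fun i : Nat.Primes × Nat.Primes => F i.swap) :=
    (summable_prod_of_nonneg fun i => hF _).2 ⟨hin, hout⟩
  have hs' : Summable F := (Equiv.prodComm Nat.Primes Nat.Primes).summable_iff.1 hs
  refine ⟨hs', ?_⟩
  have e : ∑' i, F i = ∑' q, ∑' p, F (p, q) := by
    rw [← (Equiv.prodComm Nat.Primes Nat.Primes).tsum_eq F]
    exact hs.tsum_prod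
  rw [e]
  refine (hout.tsum_le_tsum hb (s2.mul_left C1)).trans ?_
  rw [tsum_mul_left]
  calc _ ≤ C1 * (C2 * X * (primeRecipSum X + 1)) := mul_le_mul_of_nonneg_left b2 hC1
    _ ≤ C1 * (C2 * X * (C3 * Real.log (Real.log X))) := by
        gcongr; exact h3 X hX
    _ = _ := by ring

lemma RapidDecay.tsum_pairs_le {f : ℝ → ℝ} (hf : RapidDecay f) :
    ∃ C : ℝ, 0 ≤ C ∧ ∀ X : ℝ, 16 ≤ X → ∀ g : Nat.Primes × Nat.Primes → ℝ,
      (∀ i, |g i| ≤ |f (pairProd i / X)| * (1 + |Real.log (pairProd i / X)|)) →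
      Summable g ∧ |∑' i, g i| ≤ C * (X * Real.log (Real.log X) / Real.log X) := by
  obtain ⟨C, hC, h⟩ := hf.summable_pairs_log
  refine ⟨4 * C, by positivity, fun X hX g hg => ?_⟩
  have hX0 : 0 < X := by linarith
  have hl := one_le_log hX
  obtain ⟨s, b⟩ := h X hX
  set F : Nat.Primes × Nat.Primes → ℝ := fun i => Real.log i.1 *
        (|f (pairProd i / X)| * (1 + |Real.log (pairProd i / X)|) ^ 2)
  have hs' : Summable fun i => F (Equiv.prodComm _ _ i) :=
    (Equiv.prodComm Nat.Primes Nat.Primes).summable_iff.2 s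
  have e : ∑' i, F (Equiv.prodComm _ _ i) = ∑' i, F i :=
    (Equiv.prodComm Nat.Primes Nat.Primes).tsum_eq F
  have hb : ∀ i, ‖g i‖ ≤ (Real.log X)⁻¹ * (3 * F i + F (Equiv.prodComm _ _ i)) := by
    intro i
    rw [Real.norm_eq_abs, inv_mul_eq_div, le_div_iff₀ (by linarith)]
    have hFs : F (Equiv.prodComm _ _ i) = Real.log i.2 *
        (|f (pairProd i / X)| * (1 + |Real.log (pairProd i / X)|) ^ 2) := by
      simp only [F, Equiv.prodComm_apply, pairProd_swap, Prod.fst_swap]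
    have hlX : Real.log X = Real.log i.1 + Real.log i.2 - Real.log (pairProd i / X) := by
      rw [Real.log_div (pairProd_pos i).ne' hX0.ne', pairProd,
        Real.log_mul (prime_pos _).ne' (prime_pos _).ne']
      ring
    rw [hFs]
    simp only [F]
    set L := Real.log (pairProd i / X)
    have hL0 := abs_nonneg L
    have h1 := one_le_log_prime_div i.1
    have h2 := log_prime_nonneg i.1
    have h3 := log_prime_nonneg i.2
    have hlX' : Real.log X ≤ (1 + |L|) * (3 * Real.log i.1 + Real.log i.2) := by
      have := neg_abs_le L
      nlinarith
    calc |g i| * Real.log X ≤ (|f (pairProd i / X)| * (1 + |L|)) *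
          ((1 + |L|) * (3 * Real.log i.1 + Real.log i.2)) :=
          mul_le_mul (hg i) hlX' (by linarith) (by positivity)
      _ = _ := by ring
  have hs := ((s.mul_left 3).add hs').mul_left (Real.log X)⁻¹
  refine ⟨Summable.of_norm_bounded hs hb, (tsum_of_norm_bounded hs.hasSum hb).trans ?_⟩
  rw [tsum_mul_left, (s.mul_left 3).tsum_add hs', tsum_mul_left, e, inv_mul_eq_div,
    ← mul_div_assoc]
  gcongr
  linarith

lemma RapidDecay.pairs_log_mul {f : ℝ → ℝ} (hf : RapidDecay f) :
    ∃ C : ℝ, 0 ≤ C ∧ ∀ X : ℝ, 16 ≤ X →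
      |Real.log X * (∑' i : Nat.Primes × Nat.Primes, f (pairProd i / X)) -
        2 * ∑' q : Nat.Primes, primeSum f (X / q)| ≤
          C * (X * Real.log (Real.log X) / Real.log X) := by
  obtain ⟨C, hC, h⟩ := hf.tsum_pairs_le
  obtain ⟨_, _, h'⟩ := hf.summable_pairs_log
  refine ⟨C, hC, fun X hX => ?_⟩
  have hX0 : 0 < X := by linarith
  obtain ⟨s0, -⟩ := h' X hX
  obtain ⟨s1, -⟩ := h X hX (fun i => f (pairProd i / X)) fun i => le_mul_one_add_abs _ _
  obtain ⟨s2, b2⟩ := h X hX (fun i => f (pairProd i / X) * Real.log (pairProd i / X)) fun i => by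
    rw [abs_mul]; gcongr; linarith
  have s3 : Summable fun i : Nat.Primes × Nat.Primes => Real.log i.1 * f (pairProd i / X) := by
    refine Summable.of_norm_bounded s0 fun i => ?_
    rw [norm_mul, Real.norm_of_nonneg (log_prime_nonneg _), Real.norm_eq_abs]
    exact mul_le_mul_of_nonneg_left (le_mul_one_add_abs_sq _ _) (log_prime_nonneg _)
  have s4 : Summable fun i : Nat.Primes × Nat.Primes => Real.log i.2 * f (pairProd i / X) := by
    refine ((Equiv.prodComm Nat.Primes Nat.Primes).summable_iff.2 s3).congr fun i => ?_
    simp only [Function.comp_apply, Equiv.prodComm_apply, pairProd_swap, Prod.fst_swap]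
  have e4 : ∑' i : Nat.Primes × Nat.Primes, Real.log i.2 * f (pairProd i / X) =
      ∑' q : Nat.Primes, primeSum f (X / q) := by
    refine s4.tsum_prod.trans (tsum_congr fun q => tsum_congr fun p => ?_)
    rw [← pairProd_div, ← pairProd_swap]; rfl
  have e3 : ∑' i : Nat.Primes × Nat.Primes, Real.log i.1 * f (pairProd i / X) =
      ∑' q : Nat.Primes, primeSum f (X / q) := by
    rw [← e4, ← (Equiv.prodComm Nat.Primes Nat.Primes).tsum_eq]
    refine tsum_congr fun i => ?_
    simp only [Equiv.prodComm_apply, pairProd_swap, Prod.fst_swap]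
  have e : Real.log X * (∑' i : Nat.Primes × Nat.Primes, f (pairProd i / X)) =
      2 * (∑' q : Nat.Primes, primeSum f (X / q)) -
        ∑' i : Nat.Primes × Nat.Primes, f (pairProd i / X) * Real.log (pairProd i / X) := by
    rw [two_mul]
    nth_rewrite 1 [← e3]
    rw [← e4, ← s3.tsum_add s4, ← (s3.add s4).tsum_sub s2, ← tsum_mul_left]
    refine tsum_congr fun i => ?_
    rw [Real.log_div (pairProd_pos i).ne' hX0.ne', pairProd,
        Real.log_mul (prime_pos _).ne' (prime_pos _).ne']
    ring
  rw [e, sub_sub_cancel_left, abs_neg]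
  exact b2

lemma RapidDecay.tsum_primeSum_sub_le {f : ℝ → ℝ} (hf : RapidDecay f) {W : ℝ}
    (hW : ∃ C : ℝ, 0 ≤ C ∧ ∀ Y : ℝ, 0 < Y →
      (1 + Real.posLog Y) * |primeSum f Y - W * Y| ≤ C * Y) :
    ∃ C : ℝ, 0 ≤ C ∧ ∀ X : ℝ, 16 ≤ X →
      |(∑' q : Nat.Primes, primeSum f (X / q)) - W * X * primeRecipSum X| ≤
        C * (X * Real.log (Real.log X) / Real.log X) := by
  obtain ⟨C1, hC1, h1⟩ := hW
  obtain ⟨C2, hC2, h2⟩ := hf.abs_primeSum_le_cube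
  obtain ⟨C3, hC3, h3⟩ := exists_tsum_primes_inv_le
  set g : ℝ → ℝ := fun u => if 1 < u then u ^ (-3 : ℝ) else 0
  have hg : RapidDecay g := by
    refine ⟨1, zero_le_one, fun u hu => ?_⟩
    have p1 := Real.rpow_nonneg hu.le (-(1 / 4))
    have p2 := Real.rpow_nonneg hu.le (-3)
    simp only [g]
    split_ifs with h
    · rw [abs_of_nonneg p2, one_mul, one_mul]
      exact ⟨Real.rpow_le_rpow_of_exponent_le h.le (by norm_num), le_rfl⟩
    · rw [abs_zero, one_mul, one_mul]
      exact ⟨p1, p2⟩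
  obtain ⟨C4, hC4, h4⟩ := hg.tsum_primes_le
  refine ⟨C1 * C3 + C2 * C4, by positivity, fun X hX => ?_⟩
  have hX0 : 0 < X := by linarith
  have hl := one_le_log hX
  have hll := one_le_log_log hX
  have s1 := (summable_ite_primes_le X fun q => 1 / ((q : ℝ) * (1 + Real.log (X / q)))).mul_left
    (C1 * X)
  obtain ⟨s2, b2⟩ := h4 X (by linarith) (fun q => g (q / X)) fun q => le_mul_one_add_abs _ _
  have s0 := (summable_ite_primes_le X fun q => 1 / (q : ℝ)).mul_left (W * X)
  set B : Nat.Primes → ℝ := fun q => C1 * X *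
    (if (q : ℝ) ≤ X then 1 / ((q : ℝ) * (1 + Real.log (X / q))) else 0) + C2 * g (q / X) with hB
  have hb : ∀ q : Nat.Primes, ‖primeSum f (X / q) -
      W * X * (if (q : ℝ) ≤ X then 1 / (q : ℝ) else 0)‖ ≤ B q := by
    intro q
    have hq := prime_pos q
    simp only [B, g]
    rw [Real.norm_eq_abs]
    have hiff : 1 < (q : ℝ) / X ↔ X < q := one_lt_div hX0
    by_cases h : (q : ℝ) ≤ X
    · rw [if_pos h, if_pos h, if_neg (hiff.not.2 (not_lt.2 h))]
      have h5 := h1 (X / q) (by positivity)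
      have h6 : 1 ≤ X / q := (one_le_div hq).2 h
      have h7 := Real.log_nonneg h6
      rw [Real.posLog_eq_log (by rwa [abs_of_nonneg (by positivity)])] at h5
      have h8 : 0 < 1 + Real.log (X / q) := by linarith
      rw [← le_div_iff₀' h8] at h5
      calc _ = |primeSum f (X / q) - W * (X / q)| := by rw [mul_one_div, mul_div_assoc]
        _ ≤ C1 * (X / q) / (1 + Real.log (X / q)) := h5
        _ = _ := by rw [mul_zero, add_zero]; field_simp
    · rw [if_neg h, if_neg h, if_pos (hiff.2 (not_le.1 h)), mul_zero, mul_zero, zero_add, sub_zero]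
      refine (h2 _ (by positivity)).trans_eq ?_
      rw [Real.rpow_neg (by positivity), ← Real.inv_rpow (by positivity), inv_div]
      norm_cast
  have sB : Summable B := s1.add (s2.mul_left C2)
  have sd := Summable.of_norm_bounded sB hb
  have sp : Summable fun q : Nat.Primes => primeSum f (X / q) :=
    (sd.add s0).congr fun q => by ring
  have e : (∑' q : Nat.Primes, primeSum f (X / q)) - W * X * primeRecipSum X =
      ∑' q : Nat.Primes, (primeSum f (X / q) -
        W * X * (if (q : ℝ) ≤ X then 1 / (q : ℝ) else 0)) := by
    rw [sp.tsum_sub s0, tsum_mul_left]; rfl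
  rw [e]
  refine (tsum_of_norm_bounded sB.hasSum hb).trans ?_
  rw [hB, s1.tsum_add (s2.mul_left C2), tsum_mul_left, tsum_mul_left]
  have h5 := h3 X hX
  have h6 := (le_abs_self _).trans b2
  have h7 : X / Real.log X ≤ X * Real.log (Real.log X) / Real.log X := by
    gcongr; nlinarith
  calc _ ≤ C1 * X * (C3 * (Real.log (Real.log X) / Real.log X)) +
        C2 * (C4 * (X * Real.log (Real.log X) / Real.log X)) := by
        refine add_le_add (mul_le_mul_of_nonneg_left h5 (by positivity))
          (mul_le_mul_of_nonneg_left (h6.trans ?_) hC2)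
        exact mul_le_mul_of_nonneg_left h7 hC4
    _ = _ := by ring

theorem RapidDecay.abs_tsum_pairs_sub_le {f : ℝ → ℝ} (hf : RapidDecay f) {W : ℝ}
    (hW : ∃ C : ℝ, 0 ≤ C ∧ ∀ Y : ℝ, 0 < Y →
      (1 + Real.posLog Y) * |primeSum f Y - W * Y| ≤ C * Y) :
    ∃ C : ℝ, 0 ≤ C ∧ ∀ X : ℝ, 16 ≤ X →
      |(∑' i : Nat.Primes × Nat.Primes, f (pairProd i / X)) -
        2 * W * X * (meisselMertens + Real.log (Real.log X)) / Real.log X| ≤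
        C * (X * Real.log (Real.log X) / Real.log X ^ 2) := by
  obtain ⟨C1, hC1, h1⟩ := hf.pairs_log_mul
  obtain ⟨C2, hC2, h2⟩ := hf.tsum_primeSum_sub_le hW
  obtain ⟨C3, hC3, h3⟩ := abs_primeRecipSum_sub_le
  refine ⟨C1 + 2 * C2 + 2 * |W| * C3, by positivity, fun X hX => ?_⟩
  have hX0 : 0 < X := by linarith
  have hl := one_le_log hX
  have hll := one_le_log_log hX
  have b1 := h1 X hX
  have b2 := h2 X hX
  have b3 := h3 X (by linarith)
  set V := ∑' i : Nat.Primes × Nat.Primes, f (pairProd i / X)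
  set S := ∑' q : Nat.Primes, primeSum f (X / q)
  set P := primeRecipSum X
  set LL := Real.log (Real.log X)
  set l := Real.log X
  have hl0 : 0 < l := by linarith
  have b4 : |2 * W * X * (P - LL - meisselMertens)| ≤ 2 * |W| * C3 * (X * LL / l) := by
    rw [abs_mul, abs_mul, abs_mul, abs_two, abs_of_pos hX0]
    calc _ ≤ 2 * |W| * X * (C3 / l) := by gcongr
      _ ≤ 2 * |W| * X * (C3 * LL / l) := by
        gcongr; nlinarith
      _ = _ := by ring
  have e : V - 2 * W * X * (meisselMertens + LL) / l =
      ((l * V - 2 * S) + 2 * (S - W * X * P) + 2 * W * X * (P - LL - meisselMertens)) / l := by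
    field_simp; ring
  rw [e, abs_div, abs_of_pos hl0, div_le_iff₀ hl0]
  refine (abs_add_three _ _ _).trans ?_
  rw [abs_mul 2, abs_two]
  calc _ ≤ C1 * (X * LL / l) + 2 * (C2 * (X * LL / l)) + 2 * |W| * C3 * (X * LL / l) := by
        gcongr
    _ = _ := by field_simp

lemma hasDerivAt_tsum_mul_pow {ι : Type*} {b : ι → ℝ} {e : ι → ℕ} (hb : ∀ i, 0 ≤ b i)
    (hs : ∀ r ∈ Set.Ioo (0 : ℝ) 1, Summable fun i => b i * r ^ e i)
    (hs' : ∀ r ∈ Set.Ioo (0 : ℝ) 1, Summable fun i => b i * (e i * r ^ (e i - 1)))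
    {x : ℝ} (hx : x ∈ Set.Ioo (0 : ℝ) 1) :
    HasDerivAt (fun y => ∑' i, b i * y ^ e i) (∑' i, b i * (e i * x ^ (e i - 1))) x := by
  obtain ⟨r, hxr, hr⟩ := exists_between hx.2
  refine hasDerivAt_tsum_of_isPreconnected (t := Set.Ioo 0 r) (𝕜 := ℝ)
    (g := fun i y => b i * y ^ e i) (g' := fun i y => b i * (e i * y ^ (e i - 1)))
    (hs' r ⟨hx.1.trans hxr, hr⟩) isOpen_Ioo isPreconnected_Ioo
    (fun i y _ => (hasDerivAt_pow (e i) y).const_mul (b i)) (fun i y hy => ?_)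
    (y₀ := x) ⟨hx.1, hxr⟩ (hs x hx) ⟨hx.1, hxr⟩
  have hy0 := hy.1.le
  rw [Real.norm_of_nonneg (mul_nonneg (hb i) (by positivity))]
  have := hb i
  have := hy.2.le
  gcongr

lemma iterate_Dop_eq {ι : Type*} {c : ι → ℝ} {N : ι → ℕ} (hc : ∀ i, 0 ≤ c i)
    (hN : ∀ i, 0 < N i)
    (hs : ∀ k : ℕ, ∀ r ∈ Set.Ioo (0 : ℝ) 1, Summable fun i => c i * (N i : ℝ) ^ k * r ^ N i)
    {F : ℝ → ℝ} (hF : ∀ r ∈ Set.Ioo (0 : ℝ) 1, F r = ∑' i, c i * r ^ N i) (m : ℕ) :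
    ∀ r ∈ Set.Ioo (0 : ℝ) 1, (Dop^[m] F) r = ∑' i, c i * (N i : ℝ) ^ m * r ^ N i := by
  induction m with
  | zero => intro r hr; simpa using hF r hr
  | succ k ih =>
    intro r hr
    have hpow : ∀ x : ℝ, ∀ i, x * (c i * (N i : ℝ) ^ k * (N i * x ^ (N i - 1))) =
        c i * (N i : ℝ) ^ (k + 1) * x ^ N i := by
      intro x i
      rw [← mul_pow_sub_one (hN i).ne' x]
      ring
    have hd := hasDerivAt_tsum_mul_pow (b := fun i => c i * (N i : ℝ) ^ k) (e := N)
      (fun i => mul_nonneg (hc i) (by positivity)) (hs k) (fun x hx => by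
        refine ((hs (k + 1) x hx).mul_left x⁻¹).congr fun i => ?_
        rw [← hpow x i, inv_mul_cancel_left₀ hx.1.ne']) hr
    have he : Dop^[k] F =ᶠ[𝓝 r] fun y => ∑' i, c i * (N i : ℝ) ^ k * y ^ N i :=
      eventually_of_mem (isOpen_Ioo.mem_nhds hr) ih
    rw [Function.iterate_succ_apply']
    change r * deriv (Dop^[k] F) r = _
    rw [he.deriv_eq, hd.deriv, ← tsum_mul_left]
    exact tsum_congr (hpow r)

lemma descFactorial_mul_pow_sub (N k : ℕ) {r : ℝ} (hr : 0 < r) :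
    (N.descFactorial k : ℝ) * r ^ (N - k) = (r ^ k)⁻¹ * (N.descFactorial k * r ^ N) := by
  rcases lt_or_ge N k with h | h
  · simp [Nat.descFactorial_of_lt h]
  · rw [pow_sub₀ r hr.ne' h]; ring

lemma iteratedDeriv_eq {ι : Type*} {c : ι → ℝ} {N : ι → ℕ} (hc : ∀ i, 0 ≤ c i)
    (hs : ∀ k : ℕ, ∀ r ∈ Set.Ioo (0 : ℝ) 1, Summable fun i => c i * (N i : ℝ) ^ k * r ^ N i)
    {F : ℝ → ℝ} (hF : ∀ r ∈ Set.Ioo (0 : ℝ) 1, F r = ∑' i, c i * r ^ N i) (m : ℕ) :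
    ∀ r ∈ Set.Ioo (0 : ℝ) 1,
      iteratedDeriv m F r = ∑' i, c i * ((N i).descFactorial m : ℝ) * r ^ (N i - m) := by
  have hsd : ∀ k : ℕ, ∀ r ∈ Set.Ioo (0 : ℝ) 1,
      Summable fun i => c i * ((N i).descFactorial k : ℝ) * r ^ (N i - k) := by
    intro k r hr
    have hr0 := hr.1
    refine Summable.of_nonneg_of_le (fun i => ?_) (fun i => ?_)
      ((hs k r hr).mul_left (r ^ k)⁻¹)
    · have := hc i; positivity
    · rw [mul_assoc, descFactorial_mul_pow_sub _ _ hr0]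
      have h1 : ((N i).descFactorial k : ℝ) ≤ (N i : ℝ) ^ k := by
        exact_mod_cast Nat.descFactorial_le_pow _ _
      have := hc i
      calc _ = (r ^ k)⁻¹ * (c i * ((N i).descFactorial k : ℝ) * r ^ N i) := by ring
        _ ≤ _ := by gcongr
  induction m with
  | zero => intro r hr; simpa using hF r hr
  | succ k ih =>
    intro r hr
    have hpow : ∀ x : ℝ, ∀ i, c i * ((N i).descFactorial k : ℝ) *
        ((N i - k : ℕ) * x ^ (N i - k - 1)) =
        c i * ((N i).descFactorial (k + 1) : ℝ) * x ^ (N i - (k + 1)) := by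
      intro x i
      rw [Nat.descFactorial_succ, Nat.sub_sub]
      push_cast
      ring
    have hd := hasDerivAt_tsum_mul_pow (b := fun i => c i * ((N i).descFactorial k : ℝ))
      (e := fun i => N i - k)
      (fun i => mul_nonneg (hc i) (by positivity)) (hsd k) (fun x hx =>
        (hsd (k + 1) x hx).congr fun i => (hpow x i).symm) hr
    have he : iteratedDeriv k F =ᶠ[𝓝 r]
        fun y => ∑' i, c i * ((N i).descFactorial k : ℝ) * y ^ (N i - k) :=
      eventually_of_mem (isOpen_Ioo.mem_nhds hr) ih
    rw [iteratedDeriv_succ, he.deriv_eq, hd.deriv]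
    exact tsum_congr (hpow r)

lemma pow_sub_descFactorial_le (N m : ℕ) :
    (N : ℝ) ^ (m + 1) - N * (N.descFactorial m : ℝ) ≤ (m : ℝ) ^ 2 * (N : ℝ) ^ m := by
  induction m with
  | zero => simp
  | succ k ih =>
    have h1 : ((N : ℝ) - k) * (N.descFactorial k : ℝ) ≤ (N.descFactorial (k + 1) : ℝ) := by
      rw [Nat.descFactorial_succ, Nat.cast_mul]
      gcongr
      have : N ≤ (N - k) + k := by omega
      have : (N : ℝ) ≤ ((N - k : ℕ) : ℝ) + k := by exact_mod_cast this
      linarith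
    have h2 : (N.descFactorial k : ℝ) ≤ (N : ℝ) ^ k := by
      exact_mod_cast Nat.descFactorial_le_pow _ _
    have hN : (0 : ℝ) ≤ N := by positivity
    have hk : (0 : ℝ) ≤ k := by positivity
    have h3 := mul_le_mul_of_nonneg_left h1 hN
    have h4 := mul_le_mul_of_nonneg_left ih hN
    have h5 := mul_le_mul_of_nonneg_left h2 (mul_nonneg hk hN)
    have h6 : 0 ≤ ((k : ℝ) + 1) * (N * (N : ℝ) ^ k) := by positivity
    push_cast
    simp only [pow_succ] at *
    nlinarith

lemma pow_succ_sub_descFactorial_le {N : ℕ} (hN : 0 < N) (m : ℕ) :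
    (N : ℝ) ^ (m + 1) - (N.descFactorial (m + 1) : ℝ) ≤ ((m : ℝ) + 1) ^ 2 * (N : ℝ) ^ m := by
  have h := pow_sub_descFactorial_le N (m + 1)
  have hN' : (0 : ℝ) < N := by exact_mod_cast hN
  push_cast at h
  rw [pow_succ _ (m + 1)] at h
  refine le_of_mul_le_mul_left ?_ hN'
  calc _ = (N : ℝ) ^ (m + 1) * N - N * (N.descFactorial (m + 1) : ℝ) := by ring
    _ ≤ _ := h
    _ = _ := by ring

/-- The exponent `p q j` attached to a triple `(j, p, q)`. -/
def tripleProd (i : ℕ+ × Nat.Primes × Nat.Primes) : ℕ := (i.2.1 : ℕ) * (i.2.2 : ℕ) * (i.1 : ℕ)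

lemma tripleProd_pos (i : ℕ+ × Nat.Primes × Nat.Primes) : 0 < tripleProd i :=
  mul_pos (mul_pos i.2.1.2.pos i.2.2.2.pos) i.1.pos

lemma cast_tripleProd (j : ℕ+) (i : Nat.Primes × Nat.Primes) :
    (tripleProd (j, i) : ℝ) = pairProd i * j := by
  simp [tripleProd, pairProd]

lemma summable_tripleProd_inv_sq : Summable fun i => 1 / (tripleProd i : ℝ) ^ 2 := by
  have h1 := summable_primes_rpow_neg (s := 2) (by norm_num)
  have h2 := summable_pnat_rpow (s := -2) (by norm_num)
  have h3 := h2.mul_of_nonneg (h1.mul_of_nonneg h1 (fun p => by positivity)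
    (fun p => by positivity)) (fun j => by positivity) (fun i => by positivity)
  refine h3.congr fun i => ?_
  have e : ∀ x : ℝ, 0 ≤ x → x ^ (-2 : ℝ) = 1 / x ^ 2 := fun x hx => by
    rw [Real.rpow_neg hx, Real.rpow_two, one_div]
  have h := cast_tripleProd i.1 i.2
  rw [h, e _ (by positivity), e _ (by positivity), e _ (by positivity), pairProd]
  ring

lemma summable_tripleProd (k : ℕ) {r : ℝ} (hr : r ∈ Set.Ioo (0 : ℝ) 1) :
    Summable fun i => 1 / (i.1 : ℝ) * (tripleProd i : ℝ) ^ k * r ^ tripleProd i := by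
  obtain ⟨C, hC⟩ :=
    (tendsto_pow_const_mul_const_pow_of_lt_one (k + 2) hr.1.le hr.2).bddAbove_range
  have hr0 := hr.1
  refine Summable.of_nonneg_of_le (fun i => by positivity) (fun i => ?_)
    (summable_tripleProd_inv_sq.mul_left C)
  have h := hC (Set.mem_range_self (tripleProd i))
  have hN : (0 : ℝ) < tripleProd i := by exact_mod_cast tripleProd_pos i
  have hj : 1 / (i.1 : ℝ) ≤ 1 := by
    rw [div_le_one (by exact_mod_cast i.1.pos)]
    exact_mod_cast i.1.pos
  calc _ ≤ 1 * (tripleProd i : ℝ) ^ k * r ^ tripleProd i := by gcongr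
    _ = ((tripleProd i : ℝ) ^ (k + 2) * r ^ tripleProd i) * (1 / (tripleProd i : ℝ) ^ 2) := by
      rw [pow_add]; field_simp
    _ ≤ _ := by gcongr

lemma PhiP2_eq_tsum {r : ℝ} (hr : r ∈ Set.Ioo (0 : ℝ) 1) :
    PhiP2 r = ∑' i : ℕ+ × Nat.Primes × Nat.Primes, 1 / (i.1 : ℝ) * r ^ tripleProd i := by
  have hs : Summable fun i : ℕ+ × Nat.Primes × Nat.Primes => 1 / (i.1 : ℝ) * r ^ tripleProd i :=
    (summable_tripleProd 0 hr).congr fun i => by simp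
  rw [hs.tsum_prod]
  exact tsum_congr fun j => ((hs.prod_factor j).tsum_prod).symm

lemma tsum_tripleProd_exp (m : ℕ) {X : ℝ} (hX : 0 < X) :
    ∑' i : ℕ+ × Nat.Primes × Nat.Primes,
      1 / (i.1 : ℝ) * (tripleProd i : ℝ) ^ m * Real.exp (-1 / X) ^ tripleProd i =
    X ^ m * ∑' i : Nat.Primes × Nat.Primes, logWeight m (pairProd i / X) := by
  have hr : Real.exp (-1 / X) ∈ Set.Ioo (0 : ℝ) 1 :=
    ⟨Real.exp_pos _, by
    rw [Real.exp_lt_one_iff]; exact div_neg_of_neg_of_pos (by norm_num) hX⟩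
  have hs := summable_tripleProd m hr
  have hs' := (Equiv.prodComm (Nat.Primes × Nat.Primes) ℕ+).summable_iff.2 hs
  rw [← (Equiv.prodComm (Nat.Primes × Nat.Primes) ℕ+).tsum_eq, ← tsum_mul_left]
  refine hs'.tsum_prod.trans (tsum_congr fun i => ?_)
  rw [logWeight, ← tsum_mul_left]
  refine tsum_congr fun j => ?_
  simp only [Function.comp_apply, Equiv.prodComm_apply, Prod.swap_prod_mk, gammaWeight]
  rw [← Real.exp_nat_mul, cast_tripleProd]
  have : pairProd i * j * (-1 / X) = -(j * (pairProd i / X)) := by ring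
  have hm : X ^ m * (j * (pairProd i / X)) ^ m = (pairProd i * j) ^ m := by
    rw [← mul_pow]; congr 1; field_simp
  rw [this, ← hm]
  ring

/-- The predicted main term for the `m`-th derivatives of `PhiP2` at `exp (-1 / X)`. -/
def mainTerm (m : ℕ) (X : ℝ) : ℝ :=
  2 * zeta2 * Real.Gamma (m + 1) * X ^ (m + 1) * (meisselMertens + Real.log (Real.log X)) /
    Real.log X

/-- The order of magnitude of the error term for the `m`-th derivatives of `PhiP2`. -/
def errorScale (m : ℕ) (X : ℝ) : ℝ :=
  X ^ (m + 1) * Real.log (Real.log X) / Real.log X ^ 2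

lemma errorScale_nonneg (m : ℕ) {X : ℝ} (hX : 16 ≤ X) : 0 ≤ errorScale m X := by
  have := one_le_log_log hX
  unfold errorScale
  positivity

lemma zeta2_pos : 0 < zeta2 := by
  rw [zeta2, riemannZeta_two]
  norm_cast
  positivity

lemma exp_neg_one_div_mem_Ioo {X : ℝ} (hX : 0 < X) :
    Real.exp (-1 / X) ∈ Set.Ioo (0 : ℝ) 1 :=
  ⟨Real.exp_pos _, by rw [Real.exp_lt_one_iff]; exact div_neg_of_neg_of_pos (by norm_num) hX⟩

/-- The moment `∑_{j, p, q} (1/j) (p q j) ^ m ρ ^ (p q j)` at `ρ = exp (-1 / X)`. -/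
def tripleMoment (m : ℕ) (X : ℝ) : ℝ :=
  ∑' i : ℕ+ × Nat.Primes × Nat.Primes,
      1 / (i.1 : ℝ) * (tripleProd i : ℝ) ^ m * Real.exp (-1 / X) ^ tripleProd i

lemma abs_tripleMoment_sub_le (m : ℕ) : ∃ C : ℝ, 0 ≤ C ∧ ∀ X : ℝ, 16 ≤ X →
    |tripleMoment m X - mainTerm m X| ≤ C * errorScale m X := by
  have hW := abs_primeSum_logWeight_sub_le m
  rw [← zeta2_eq_tsum] at hW
  obtain ⟨C, hC, h⟩ := (rapidDecay_logWeight m).abs_tsum_pairs_sub_le hW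
  refine ⟨C, hC, fun X hX => ?_⟩
  have hX0 : 0 < X := by linarith
  have e : tripleMoment m X - mainTerm m X = X ^ m *
      ((∑' i : Nat.Primes × Nat.Primes, logWeight m (pairProd i / X)) -
        2 * (m.factorial * zeta2) * X * (meisselMertens + Real.log (Real.log X)) /
          Real.log X) := by
    rw [tripleMoment, tsum_tripleProd_exp m hX0, mainTerm, Real.Gamma_nat_eq_factorial]
    ring
  rw [e, abs_mul, abs_of_pos (by positivity)]
  refine (mul_le_mul_of_nonneg_left (h X hX) (by positivity)).trans_eq ?_
  rw [errorScale]; ring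

lemma tripleMoment_nonneg (m : ℕ) (X : ℝ) : 0 ≤ tripleMoment m X :=
  tsum_nonneg fun i => by positivity

lemma log_pow_succ_le (m : ℕ) {X : ℝ} (hX : 16 ≤ X) :
    X ^ m * Real.log (Real.log X) / Real.log X ≤ errorScale m X := by
  have hl := one_le_log hX
  have hll := one_le_log_log hX
  have hlX : Real.log X ≤ X := Real.log_le_self (by linarith)
  rw [errorScale, div_le_div_iff₀ (by positivity) (by positivity)]
  have : 0 ≤ X ^ m * Real.log (Real.log X) * Real.log X := by positivity
  calc _ = X ^ m * Real.log (Real.log X) * Real.log X * Real.log X := by ring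
    _ ≤ X ^ m * Real.log (Real.log X) * Real.log X * X := by gcongr
    _ = _ := by ring

lemma tripleMoment_le (m : ℕ) : ∃ C : ℝ, 0 ≤ C ∧ ∀ X : ℝ, 16 ≤ X →
    tripleMoment m X ≤ C * (X ^ (m + 1) * Real.log (Real.log X) / Real.log X) := by
  obtain ⟨C, hC, h⟩ := abs_tripleMoment_sub_le m
  have hz := zeta2_pos
  have hG : 0 < Real.Gamma (m + 1) := Real.Gamma_pos_of_pos (by positivity)
  refine ⟨C + 2 * zeta2 * Real.Gamma (m + 1) * (|meisselMertens| + 1), by positivity,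
    fun X hX => ?_⟩
  have hX0 : 0 < X := by linarith
  have hl := one_le_log hX
  have hll := one_le_log_log hX
  have h1 := (abs_le.1 (h X hX)).2
  have h2 : errorScale m X ≤ X ^ (m + 1) * Real.log (Real.log X) / Real.log X := by
    rw [errorScale]
    gcongr
    nlinarith
  have h3 : mainTerm m X ≤ 2 * zeta2 * Real.Gamma (m + 1) * (|meisselMertens| + 1) *
      (X ^ (m + 1) * Real.log (Real.log X) / Real.log X) := by
    have h4 : meisselMertens + Real.log (Real.log X) ≤
        (|meisselMertens| + 1) * Real.log (Real.log X) := by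
      have := le_abs_self meisselMertens
      have := abs_nonneg meisselMertens
      nlinarith
    calc mainTerm m X ≤ 2 * zeta2 * Real.Gamma (m + 1) * X ^ (m + 1) *
          ((|meisselMertens| + 1) * Real.log (Real.log X)) / Real.log X := by
          unfold mainTerm; gcongr
      _ = _ := by ring
  have h5 := mul_le_mul_of_nonneg_left h2 hC
  linarith

/-- The factorial moment `∑_{j, p, q} (1/j) (p q j)_m ρ ^ (p q j)` at `ρ = exp (-1 / X)`. -/
def tripleFactorialMoment (m : ℕ) (X : ℝ) : ℝ :=
  ∑' i : ℕ+ × Nat.Primes × Nat.Primes,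
      1 / (i.1 : ℝ) * ((tripleProd i).descFactorial m : ℝ) * Real.exp (-1 / X) ^ tripleProd i

lemma summable_tripleProd_descFactorial (m : ℕ) {r : ℝ} (hr : r ∈ Set.Ioo (0 : ℝ) 1) :
    Summable fun i => 1 / (i.1 : ℝ) * ((tripleProd i).descFactorial m : ℝ) *
      r ^ tripleProd i := by
  have hr0 := hr.1
  refine Summable.of_nonneg_of_le (fun i => by positivity) (fun i => ?_)
    (summable_tripleProd m hr)
  have : ((tripleProd i).descFactorial m : ℝ) ≤ (tripleProd i : ℝ) ^ m := by
    exact_mod_cast Nat.descFactorial_le_pow _ _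
  gcongr

lemma abs_tripleFactorialMoment_sub_le (m : ℕ) : ∃ C : ℝ, 0 ≤ C ∧ ∀ X : ℝ, 16 ≤ X →
    |tripleFactorialMoment m X - tripleMoment m X| ≤ C * errorScale m X := by
  cases m with
  | zero =>
    refine ⟨0, le_rfl, fun X _ => ?_⟩
    simp [tripleFactorialMoment, tripleMoment]
  | succ k =>
    obtain ⟨C, hC, h⟩ := tripleMoment_le k
    refine ⟨((k : ℝ) + 1) ^ 2 * C, by positivity, fun X hX => ?_⟩
    have hr := exp_neg_one_div_mem_Ioo (show 0 < X by linarith)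
    have s1 := summable_tripleProd (k + 1) hr
    have s2 := summable_tripleProd_descFactorial (k + 1) hr
    have s3 := summable_tripleProd k hr
    rw [abs_sub_comm, tripleMoment, tripleFactorialMoment, ← s1.tsum_sub s2]
    have hb : ∀ i : ℕ+ × Nat.Primes × Nat.Primes,
        ‖1 / (i.1 : ℝ) * (tripleProd i : ℝ) ^ (k + 1) * Real.exp (-1 / X) ^ tripleProd i -
          1 / (i.1 : ℝ) * ((tripleProd i).descFactorial (k + 1) : ℝ) *
            Real.exp (-1 / X) ^ tripleProd i‖ ≤
        ((k : ℝ) + 1) ^ 2 * (1 / (i.1 : ℝ) * (tripleProd i : ℝ) ^ k *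
          Real.exp (-1 / X) ^ tripleProd i) := by
      intro i
      have h1 : ((tripleProd i).descFactorial (k + 1) : ℝ) ≤ (tripleProd i : ℝ) ^ (k + 1) := by
        exact_mod_cast Nat.descFactorial_le_pow _ _
      have h2 := pow_succ_sub_descFactorial_le (tripleProd_pos i) k
      have hw : 0 ≤ 1 / (i.1 : ℝ) * Real.exp (-1 / X) ^ tripleProd i := by positivity
      rw [← sub_mul, ← mul_sub, Real.norm_of_nonneg (by
        have := sub_nonneg.2 h1
        positivity)]
      calc _ = (1 / (i.1 : ℝ) * Real.exp (-1 / X) ^ tripleProd i) *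
            ((tripleProd i : ℝ) ^ (k + 1) - ((tripleProd i).descFactorial (k + 1) : ℝ)) := by
            ring
        _ ≤ _ := mul_le_mul_of_nonneg_left h2 hw
        _ = _ := by ring
    refine (tsum_of_norm_bounded (s3.mul_left _).hasSum hb).trans ?_
    rw [tsum_mul_left, mul_assoc]
    refine mul_le_mul_of_nonneg_left ((h X hX).trans ?_) (by positivity)
    exact mul_le_mul_of_nonneg_left (log_pow_succ_le (k + 1) hX) hC

lemma iterate_Dop_PhiP2 (m : ℕ) {X : ℝ} (hX : 0 < X) :
    (Dop^[m] PhiP2) (Real.exp (-1 / X)) = tripleMoment m X :=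
  iterate_Dop_eq (fun _ => by positivity) tripleProd_pos (fun k _ hr => summable_tripleProd k hr)
    (fun _ hr => PhiP2_eq_tsum hr) m _ (exp_neg_one_div_mem_Ioo hX)

lemma iteratedDeriv_PhiP2 (m : ℕ) {X : ℝ} (hX : 0 < X) :
    iteratedDeriv m PhiP2 (Real.exp (-1 / X)) =
      Real.exp (m / X) * tripleFactorialMoment m X := by
  have hr := exp_neg_one_div_mem_Ioo hX
  rw [iteratedDeriv_eq (fun _ => by positivity) (fun k _ hr => summable_tripleProd k hr)
    (fun _ hr => PhiP2_eq_tsum hr) m _ hr, tripleFactorialMoment, ← tsum_mul_left]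
  refine tsum_congr fun i => ?_
  have e : Real.exp (m / X) = (Real.exp (-1 / X) ^ m)⁻¹ := by
    rw [← Real.exp_nat_mul, ← Real.exp_neg]; congr 1; ring
  rw [mul_assoc, descFactorial_mul_pow_sub _ _ hr.1, e]
  ring

lemma abs_iteratedDeriv_PhiP2_sub_le (m : ℕ) : ∃ C : ℝ, 0 ≤ C ∧ ∀ X : ℝ, 16 ≤ X →
    |iteratedDeriv m PhiP2 (Real.exp (-1 / X)) - mainTerm m X| ≤ C * errorScale m X := by
  obtain ⟨C1, hC1, h1⟩ := abs_tripleMoment_sub_le m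
  obtain ⟨C2, hC2, h2⟩ := abs_tripleFactorialMoment_sub_le m
  obtain ⟨C3, hC3, h3⟩ := tripleMoment_le m
  refine ⟨Real.exp m * C2 + m * Real.exp m * C3 + C1, by positivity, fun X hX => ?_⟩
  have hX0 : 0 < X := by linarith
  have hl := one_le_log hX
  have hll := one_le_log_log hX
  rw [iteratedDeriv_PhiP2 m hX0]
  set F := tripleFactorialMoment m X
  have hG := tripleMoment_nonneg m X
  have hE := errorScale_nonneg m hX
  have hm : Real.exp (m / X) ≤ Real.exp m := by
    rw [Real.exp_le_exp]
    exact div_le_self (by positivity) (by linarith)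
  have hm1 : 1 ≤ Real.exp (m / X) := Real.one_le_exp (by positivity)
  have hm2 : Real.exp (m / X) - 1 ≤ m / X * Real.exp m := by
    have h4 := Real.add_one_le_exp (-(m / X : ℝ))
    have h5 : Real.exp (m / X) * Real.exp (-(m / X)) = 1 := by
      rw [← Real.exp_add]; simp
    have h6 : (0 : ℝ) ≤ m / X := by positivity
    nlinarith [mul_le_mul_of_nonneg_left h4 (Real.exp_pos (m / X : ℝ)).le]
  have e : Real.exp (m / X) * F - mainTerm m X =
      Real.exp (m / X) * (F - tripleMoment m X) +
        (Real.exp (m / X) - 1) * tripleMoment m X + (tripleMoment m X - mainTerm m X) := by ring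
  rw [e]
  refine (abs_add_three _ _ _).trans ?_
  rw [abs_mul, abs_mul, abs_of_nonneg hG, abs_of_pos (Real.exp_pos _),
    abs_of_nonneg (sub_nonneg.2 hm1)]
  have b2 : (Real.exp (m / X) - 1) * tripleMoment m X ≤
      m * Real.exp m * C3 * errorScale m X := by
    calc _ ≤ (m / X * Real.exp m) *
          (C3 * (X ^ (m + 1) * Real.log (Real.log X) / Real.log X)) :=
          mul_le_mul hm2 (h3 X hX) hG (by positivity)
      _ = m * Real.exp m * C3 * (X ^ m * Real.log (Real.log X) / Real.log X) := by
          rw [pow_succ]; field_simp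
      _ ≤ _ := mul_le_mul_of_nonneg_left (log_pow_succ_le m hX) (by positivity)
  have b1 : Real.exp (m / X) * |F - tripleMoment m X| ≤
      Real.exp m * (C2 * errorScale m X) :=
    mul_le_mul hm (h2 X hX) (abs_nonneg _) (by positivity)
  have b3 := h1 X hX
  linarith

lemma exists_relative_error {T : ℝ → ℝ} {m : ℕ} (hT : ∃ C : ℝ, 0 ≤ C ∧ ∀ X : ℝ, 16 ≤ X →
    |T X - mainTerm m X| ≤ C * errorScale m X) :
    ∃ E : ℝ → ℝ, E =O[atTop] (fun X => 1 / Real.log X) ∧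
      ∀ᶠ X in atTop, T X = mainTerm m X * (1 + E X) := by
  obtain ⟨C, hC, h⟩ := hT
  have hz := zeta2_pos
  have hG : 0 < Real.Gamma (m + 1) := Real.Gamma_pos_of_pos (by positivity)
  set W := zeta2 * Real.Gamma (m + 1)
  have hW : 0 < W := by positivity
  have hev : ∀ᶠ X : ℝ in atTop, 16 ≤ X ∧ 2 * |meisselMertens| ≤ Real.log (Real.log X) :=
    (eventually_ge_atTop 16).and
      ((Real.tendsto_log_atTop.comp Real.tendsto_log_atTop).eventually_ge_atTop _)
  have hmain : ∀ X : ℝ, 16 ≤ X → 2 * |meisselMertens| ≤ Real.log (Real.log X) →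
      W * Real.log X * errorScale m X ≤ mainTerm m X ∧ 0 < errorScale m X := by
    intro X hX hM
    have hX0 : 0 < X := by linarith
    have hl := one_le_log hX
    have hll := one_le_log_log hX
    have hl0 : 0 < Real.log X := by linarith
    have hll0 : 0 < Real.log (Real.log X) := by linarith
    have h1 : Real.log (Real.log X) / 2 ≤ meisselMertens + Real.log (Real.log X) := by
      have := neg_abs_le meisselMertens
      linarith
    refine ⟨?_, by unfold errorScale; positivity⟩
    calc _ = 2 * W * X ^ (m + 1) * (Real.log (Real.log X) / 2) / Real.log X := by
          rw [errorScale]; field_simp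
      _ ≤ 2 * W * X ^ (m + 1) * (meisselMertens + Real.log (Real.log X)) / Real.log X := by
          gcongr
      _ = _ := by rw [mainTerm]; ring
  refine ⟨fun X => T X / mainTerm m X - 1, Asymptotics.IsBigO.of_bound (C / W) ?_, ?_⟩
  · filter_upwards [hev] with X ⟨hX, hM⟩
    obtain ⟨h1, h2⟩ := hmain X hX hM
    have hl := one_le_log hX
    have hl0 : 0 < Real.log X := by linarith
    have h3 : 0 < mainTerm m X := lt_of_lt_of_le (by positivity) h1
    rw [Real.norm_eq_abs, Real.norm_of_nonneg (by positivity), div_sub_one h3.ne', abs_div,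
      abs_of_pos h3, div_le_iff₀ h3]
    calc _ ≤ C * errorScale m X := h X hX
      _ = C / W * (1 / Real.log X) * (W * Real.log X * errorScale m X) := by field_simp
      _ ≤ _ := mul_le_mul_of_nonneg_left h1 (by positivity)
  · filter_upwards [hev] with X ⟨hX, hM⟩
    obtain ⟨h1, h2⟩ := hmain X hX hM
    have hl := one_le_log hX
    have hl0 : 0 < Real.log X := by linarith
    have h3 : 0 < mainTerm m X := lt_of_lt_of_le (by positivity) h1
    rw [add_sub_cancel, mul_div_cancel₀ _ h3.ne']

/-- Theorem 4.1: for `ρ = e^{−1/X}` and each `m ≥ 0`, as `X → ∞`,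
`(ρ d/dρ)^m Φ(ρ) = 2 ζ(2) Γ(m+1) X^{m+1} (M + log log X)/log X · (1 + O(1/log X))`,
and the same holds for the ordinary `m`-th derivative `Φ^{(m)}(ρ)`. -/
theorem principal_arc_moments (m : ℕ) :
    ∃ E₁ E₂ : ℝ → ℝ,
      (E₁ =O[atTop] fun X : ℝ => 1 / Real.log X) ∧
      (E₂ =O[atTop] fun X : ℝ => 1 / Real.log X) ∧
      (∀ᶠ X : ℝ in atTop,
        (Dop^[m] PhiP2) (Real.exp (-1/X)) =
          2 * zeta2 * Real.Gamma (m+1) * X^(m+1) * (meisselMertens + Real.log (Real.log X))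
            / Real.log X * (1 + E₁ X) ∧
        iteratedDeriv m PhiP2 (Real.exp (-1/X)) =
          2 * zeta2 * Real.Gamma (m+1) * X^(m+1) * (meisselMertens + Real.log (Real.log X))
            / Real.log X * (1 + E₂ X)) := by
  obtain ⟨E₁, hE₁, h₁⟩ := exists_relative_error (abs_tripleMoment_sub_le m)
  obtain ⟨E₂, hE₂, h₂⟩ := exists_relative_error (abs_iteratedDeriv_PhiP2_sub_le m)
  refine ⟨E₁, E₂, hE₁, hE₂, ?_⟩
  filter_upwards [h₁, h₂, eventually_gt_atTop 0] with X h₁ h₂ hX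
  exact ⟨(iterate_Dop_PhiP2 m hX).trans h₁, h₂⟩

end
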